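/- Lower hemicontinuity of the constraint correspondence: assume in addition that either (a) b and σ do not depend on the measure argument, or (c) O is an open interval, σ does not depend on the control argument a, and there exists c_σ > 0 with σ(t,x,m) ≥ c_σ for all (t,x,m) ∈ [0,T]×ℝ×M(Ō×A). Let (μ̄ⁿ, m̄ⁿ)_{n≥1} ⊆ R₀ converge to (μ̄, m̄) ∈ R₀ (weak convergence of μ̄ⁿ, convergence of m̄ⁿ in V) and let (μ, m) ∈ R[m̄]. Then there exist a subsequence (μ̄^{n_k}, m̄^{n_k}) and pairs (μ^k, m^k) ∈ R[m̄^{n_k}] such that μ^k converges weakly to μ and m^k → m in V. -/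

import Mathlib

open MeasureTheory Filter Set Topology

noncomputable section

/-- Membership in `C_b^{1,2}([0,T] × closure O)`: `u` together with its partial
derivatives `ut = ∂_t u`, `ux = ∂_x u`, `uxx = ∂_xx u`, all continuous and bounded
on `[0,T] × closure O`. -/
structure IsCb12 (T : ℝ) (O : Set ℝ) (u ut ux uxx : ℝ → ℝ → ℝ) : Prop where
  cont : ContinuousOn (fun p : ℝ × ℝ => u p.1 p.2) (Set.Icc 0 T ×ˢ closure O)
  cont_t : ContinuousOn (fun p : ℝ × ℝ => ut p.1 p.2) (Set.Icc 0 T ×ˢ closure O)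
  cont_x : ContinuousOn (fun p : ℝ × ℝ => ux p.1 p.2) (Set.Icc 0 T ×ˢ closure O)
  cont_xx : ContinuousOn (fun p : ℝ × ℝ => uxx p.1 p.2) (Set.Icc 0 T ×ˢ closure O)
  deriv_t : ∀ t ∈ Set.Icc (0:ℝ) T, ∀ x ∈ closure O,
    HasDerivWithinAt (fun s => u s x) (ut t x) (Set.Icc 0 T) t
  deriv_x : ∀ t ∈ Set.Icc (0:ℝ) T, ∀ x ∈ closure O,
    HasDerivWithinAt (fun y => u t y) (ux t x) (closure O) x
  deriv_xx : ∀ t ∈ Set.Icc (0:ℝ) T, ∀ x ∈ closure O,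
    HasDerivWithinAt (fun y => ux t y) (uxx t x) (closure O) x
  bdd : ∃ C : ℝ, ∀ t ∈ Set.Icc (0:ℝ) T, ∀ x ∈ closure O,
    |u t x| ≤ C ∧ |ut t x| ≤ C ∧ |ux t x| ≤ C ∧ |uxx t x| ≤ C

/-- Membership in `V`: a flow of finite positive Borel measures on
`closure O × A`, measurable in `t`, with integrable total mass on `[0,T]`. -/
def MemV (T : ℝ) (O A : Set ℝ) (m : ℝ → Measure (ℝ × ℝ)) : Prop :=
  (∀ t, m t Set.univ < ⊤) ∧
  (∀ t, m t ((closure O ×ˢ A)ᶜ) = 0) ∧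
  (∀ B : Set (ℝ × ℝ), MeasurableSet B → Measurable fun t => m t B) ∧
  IntegrableOn (fun t => (m t Set.univ).toReal) (Set.Icc 0 T)

/-- Weak convergence of (finite) measures on `[0,T] × closure O` (tested against
bounded continuous functions). -/
def WeakConv (μn : ℕ → Measure (ℝ × ℝ)) (μ : Measure (ℝ × ℝ)) : Prop :=
  ∀ h : ℝ × ℝ → ℝ, Continuous h → (∃ C : ℝ, ∀ p, |h p| ≤ C) →
    Tendsto (fun n => ∫ p, h p ∂(μn n)) atTop (nhds (∫ p, h p ∂μ))

/-- Convergence `mⁿ → m` in `V`: weak convergence of the associated finite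
measures `m_tⁿ(dx,da)dt` on `[0,T] × closure O × A`. -/
def ConvV (T : ℝ) (mn : ℕ → ℝ → Measure (ℝ × ℝ)) (m : ℝ → Measure (ℝ × ℝ)) : Prop :=
  ∀ h : ℝ → ℝ × ℝ → ℝ, Continuous (fun q : ℝ × ℝ × ℝ => h q.1 q.2) →
    (∃ C : ℝ, ∀ t p, |h t p| ≤ C) →
    Tendsto (fun n => ∫ t in Set.Icc 0 T, (∫ p, h t p ∂(mn n t))) atTop
      (nhds (∫ t in Set.Icc 0 T, (∫ p, h t p ∂(m t))))

/-- Mean-field structural assumptions on a coefficient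
`c(t,x,m,a) = c̄(t, x, ∫ ĉ(t,y) m(dy,du), a)`: Lipschitz in `x` uniformly in the
other variables; `c̄` bounded, measurable and continuous in the variables other than
`t` for each fixed `t`; `ĉ` continuous and bounded on `[0,T] × closure O`. -/
def MFCoeff (T : ℝ) (O A : Set ℝ) (d : ℕ)
    (c : ℝ → ℝ → Measure (ℝ × ℝ) → ℝ → ℝ)
    (cbar : ℝ → ℝ → (Fin d → ℝ) → ℝ → ℝ)
    (chat : ℝ → ℝ → Fin d → ℝ) : Prop :=
  (∃ K : ℝ, ∀ t (ν : Measure (ℝ × ℝ)) a x y, |c t x ν a - c t y ν a| ≤ K * |x - y|) ∧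
  (∀ t x (ν : Measure (ℝ × ℝ)) a, c t x ν a = cbar t x (fun i => ∫ p, chat t p.1 i ∂ν) a) ∧
  (∃ C : ℝ, ∀ t x z a, |cbar t x z a| ≤ C) ∧
  Measurable (fun q : ℝ × ℝ × (Fin d → ℝ) × ℝ => cbar q.1 q.2.1 q.2.2.1 q.2.2.2) ∧
  (∀ t, ContinuousOn (fun q : ℝ × (Fin d → ℝ) × ℝ => cbar t q.1 q.2.1 q.2.2)
      (Set.univ ×ˢ Set.univ ×ˢ A)) ∧
  ContinuousOn (fun p : ℝ × ℝ => chat p.1 p.2) (Set.Icc 0 T ×ˢ closure O) ∧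
  (∃ C : ℝ, ∀ t x, ‖chat t x‖ ≤ C)

/-- Mean-field structural assumptions on the running reward
`f(t,x,m,a) = f̄(t, x, ∫ f̂(t,y) m(dy,du), a)` with `f̄` bounded, measurable,
continuous in the variables other than `t` for each fixed `t`, and `f̂` continuous
and bounded. -/
def MFRunning (T : ℝ) (O A : Set ℝ) (d : ℕ)
    (f : ℝ → ℝ → Measure (ℝ × ℝ) → ℝ → ℝ)
    (fbar : ℝ → ℝ → (Fin d → ℝ) → ℝ → ℝ)
    (fhat : ℝ → ℝ → Fin d → ℝ) : Prop :=
  (∀ t x (ν : Measure (ℝ × ℝ)) a, f t x ν a = fbar t x (fun i => ∫ p, fhat t p.1 i ∂ν) a) ∧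
  (∃ C : ℝ, ∀ t x z a, |fbar t x z a| ≤ C) ∧
  Measurable (fun q : ℝ × ℝ × (Fin d → ℝ) × ℝ => fbar q.1 q.2.1 q.2.2.1 q.2.2.2) ∧
  (∀ t, ContinuousOn (fun q : ℝ × (Fin d → ℝ) × ℝ => fbar t q.1 q.2.1 q.2.2)
      (closure O ×ˢ Set.univ ×ˢ A)) ∧
  ContinuousOn (fun p : ℝ × ℝ => fhat p.1 p.2) (Set.Icc 0 T ×ˢ closure O) ∧
  (∃ C : ℝ, ∀ t x, ‖fhat t x‖ ≤ C)

/-- Mean-field structural assumptions on the terminal reward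
`g(t,x,μ) = ḡ(t, x, ∫ ĝ(s,y) μ(ds,dy))` with `ḡ` and `ĝ` continuous and bounded. -/
def MFTerminal (T : ℝ) (O : Set ℝ) (d : ℕ)
    (g : ℝ → ℝ → Measure (ℝ × ℝ) → ℝ)
    (gbar : ℝ → ℝ → (Fin d → ℝ) → ℝ)
    (ghat : ℝ → ℝ → Fin d → ℝ) : Prop :=
  (∀ t x (ν : Measure (ℝ × ℝ)), g t x ν = gbar t x (fun i => ∫ p, ghat p.1 p.2 i ∂ν)) ∧
  ContinuousOn (fun q : ℝ × ℝ × (Fin d → ℝ) => gbar q.1 q.2.1 q.2.2)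
    (Set.Icc 0 T ×ˢ closure O ×ˢ Set.univ) ∧
  (∃ C : ℝ, ∀ t x z, |gbar t x z| ≤ C) ∧
  ContinuousOn (fun p : ℝ × ℝ => ghat p.1 p.2) (Set.Icc 0 T ×ˢ closure O) ∧
  (∃ C : ℝ, ∀ t x, ‖ghat t x‖ ≤ C)

/-- Standing assumption on the initial measure in the mean-field setting: a
probability measure on `O` with `∫ |x|² dm₀* < ∞`. -/
def InitAssumption2 (O : Set ℝ) (m0 : Measure ℝ) : Prop :=
  IsProbabilityMeasure m0 ∧ m0 Oᶜ = 0 ∧ Integrable (fun x => x ^ 2) m0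

/-- Membership in `R[m̄]`: the Fokker–Planck constraint with coefficients frozen
along the flow `m̄`. -/
def MemRm (T : ℝ) (O A : Set ℝ)
    (b σ : ℝ → ℝ → Measure (ℝ × ℝ) → ℝ → ℝ) (m0 : Measure ℝ)
    (mbar : ℝ → Measure (ℝ × ℝ))
    (μ : Measure (ℝ × ℝ)) (m : ℝ → Measure (ℝ × ℝ)) : Prop :=
  IsProbabilityMeasure μ ∧ μ ((Set.Icc 0 T ×ˢ closure O)ᶜ) = 0 ∧ MemV T O A m ∧
  ∀ u ut ux uxx : ℝ → ℝ → ℝ, IsCb12 T O u ut ux uxx →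
    ∫ p, u p.1 p.2 ∂μ
      = (∫ x, u 0 x ∂m0)
        + ∫ t in Set.Icc 0 T,
            (∫ p, (ut t p.1 + (b t p.1 (mbar t) p.2 * ux t p.1
                + σ t p.1 (mbar t) p.2 ^ 2 / 2 * uxx t p.1)) ∂(m t))

/-- Membership in `R₀`: for every test function `u ∈ C_b^{1,2}` and every constant
`C` dominating `|L u|` uniformly over `[0,T] × closure O × M(Ō×A) × A`, the relaxed
Fokker–Planck inequality holds. -/
def MemR0 (T : ℝ) (O A : Set ℝ)
    (b σ : ℝ → ℝ → Measure (ℝ × ℝ) → ℝ → ℝ) (m0 : Measure ℝ)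
    (μ : Measure (ℝ × ℝ)) (m : ℝ → Measure (ℝ × ℝ)) : Prop :=
  IsProbabilityMeasure μ ∧ μ ((Set.Icc 0 T ×ˢ closure O)ᶜ) = 0 ∧ MemV T O A m ∧
  ∀ u ut ux uxx : ℝ → ℝ → ℝ, IsCb12 T O u ut ux uxx →
    ∀ C : ℝ,
      (∀ t ∈ Set.Icc (0:ℝ) T, ∀ x ∈ closure O, ∀ ν : Measure (ℝ × ℝ),
          ν Set.univ < ⊤ → ν ((closure O ×ˢ A)ᶜ) = 0 → ∀ a ∈ A,
          |b t x ν a * ux t x + σ t x ν a ^ 2 / 2 * uxx t x| ≤ C) →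
      ∫ p, u p.1 p.2 ∂μ
        ≤ (∫ x, u 0 x ∂m0)
          + (∫ t in Set.Icc 0 T, (∫ p, ut t p.1 ∂(m t)))
          + C * ∫ t in Set.Icc 0 T, ((m t) Set.univ).toReal

/-- The mean-field reward functional
`Γ[μ̄,m̄](μ,m) = ∫₀^T ∫ f(t,x,m̄_t,a) m_t(dx,da) dt + ∫ g(t,x,μ̄) μ(dt,dx)`. -/
def GammaMF (T : ℝ)
    (f : ℝ → ℝ → Measure (ℝ × ℝ) → ℝ → ℝ) (g : ℝ → ℝ → Measure (ℝ × ℝ) → ℝ)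
    (μbar : Measure (ℝ × ℝ)) (mbar : ℝ → Measure (ℝ × ℝ))
    (μ : Measure (ℝ × ℝ)) (m : ℝ → Measure (ℝ × ℝ)) : ℝ :=
  (∫ t in Set.Icc 0 T, ∫ p, f t p.1 (mbar t) p.2 ∂(m t)) + ∫ p, g p.1 p.2 μbar ∂μ

/-- `(μ⋆, m⋆)` is an LP MFG Nash equilibrium: `(μ⋆, m⋆) ∈ R[m⋆]` and it maximizes
`Γ[μ⋆, m⋆]` over `R[m⋆]`. -/
def IsLPNash (T : ℝ) (O A : Set ℝ)
    (b σ f : ℝ → ℝ → Measure (ℝ × ℝ) → ℝ → ℝ) (g : ℝ → ℝ → Measure (ℝ × ℝ) → ℝ)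
    (m0 : Measure ℝ)
    (μs : Measure (ℝ × ℝ)) (ms : ℝ → Measure (ℝ × ℝ)) : Prop :=
  MemRm T O A b σ m0 ms μs ms ∧
  ∀ (μ : Measure (ℝ × ℝ)) (m : ℝ → Measure (ℝ × ℝ)), MemRm T O A b σ m0 ms μ m →
    GammaMF T f g μs ms μ m ≤ GammaMF T f g μs ms μs ms

/-- The additional assumption (5)(a) or (5)(c): either `b` and `σ` do not depend on
the measure argument, or `O` is an open interval, `σ` does not depend on the control
argument and is uniformly bounded below by a positive constant. -/
def MeasIndepOrInterval (O : Set ℝ)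
    (b σ : ℝ → ℝ → Measure (ℝ × ℝ) → ℝ → ℝ) : Prop :=
  (∀ t x (ν ν' : Measure (ℝ × ℝ)) a, b t x ν a = b t x ν' a ∧ σ t x ν a = σ t x ν' a) ∨
  ((∃ c1 c2 : ℝ, c1 < c2 ∧ O = Set.Ioo c1 c2) ∧
   (∀ t x (ν : Measure (ℝ × ℝ)) a a', σ t x ν a = σ t x ν a') ∧
   (∃ cσ : ℝ, 0 < cσ ∧ ∀ t x (ν : Measure (ℝ × ℝ)) a, cσ ≤ σ t x ν a))

section

/-- bounded measurable functions with bounded support -/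
structure BM (u : ℝ × ℝ → ℝ) : Prop where
  meas : Measurable u
  bdd : ∃ C : ℝ, ∀ z, |u z| ≤ C
  supp : ∃ R : ℝ, ∀ z, u z ≠ 0 → ‖z‖ ≤ R

lemma BM.add {u v : ℝ × ℝ → ℝ} (hu : BM u) (hv : BM v) : BM (fun z => u z + v z) := by
  obtain ⟨C, hC⟩ := hu.bdd
  obtain ⟨D, hD⟩ := hv.bdd
  obtain ⟨R, hR⟩ := hu.supp
  obtain ⟨S, hS⟩ := hv.supp
  refine ⟨hu.meas.add hv.meas, ⟨C + D, fun z => (abs_add_le _ _).trans (add_le_add (hC z) (hD z))⟩,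
    ⟨max R S, fun z hz => ?_⟩⟩
  by_cases h : u z = 0
  · exact (hS z (by intro h'; exact hz (by simp [h, h']))).trans (le_max_right _ _)
  · exact (hR z h).trans (le_max_left _ _)

lemma BM.bmul {u a : ℝ × ℝ → ℝ} (hu : BM u) (ha : Measurable a) (hb : ∃ C : ℝ, ∀ z, |a z| ≤ C) :
    BM (fun z => a z * u z) := by
  obtain ⟨C, hC⟩ := hu.bdd
  obtain ⟨D, hD⟩ := hb
  obtain ⟨R, hR⟩ := hu.supp
  refine ⟨ha.mul hu.meas, ⟨D * C, fun z => ?_⟩, ⟨R, fun z hz => hR z (right_ne_zero_of_mul hz)⟩⟩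
  rw [abs_mul]
  exact mul_le_mul (hD z) (hC z) (abs_nonneg _) ((abs_nonneg _).trans (hD z))

lemma BM.mul {u v : ℝ × ℝ → ℝ} (hu : BM u) (hv : BM v) : BM (fun z => u z * v z) :=
  hv.bmul hu.meas hu.bdd

lemma BM.cmul {u : ℝ × ℝ → ℝ} (hu : BM u) (c : ℝ) : BM (fun z => c * u z) :=
  hu.bmul measurable_const ⟨|c|, fun _ => le_rfl⟩

lemma BM.neg {u : ℝ × ℝ → ℝ} (hu : BM u) : BM (fun z => - u z) := by
  simpa using hu.cmul (-1)

lemma BM.sub {u v : ℝ × ℝ → ℝ} (hu : BM u) (hv : BM v) : BM (fun z => u z - v z) := by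
  simpa [sub_eq_add_neg] using hu.add hv.neg

lemma BM.divc {u : ℝ × ℝ → ℝ} (hu : BM u) (c : ℝ) : BM (fun z => u z / c) := by
  simpa [div_eq_inv_mul] using hu.cmul c⁻¹

lemma BM.shift {u : ℝ × ℝ → ℝ} (hu : BM u) (v : ℝ × ℝ) : BM (fun z => u (z + v)) := by
  obtain ⟨C, hC⟩ := hu.bdd
  obtain ⟨R, hR⟩ := hu.supp
  refine ⟨hu.meas.comp (measurable_id.add_const v), ⟨C, fun z => hC _⟩, ⟨R + ‖v‖, fun z hz => ?_⟩⟩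
  have := hR _ hz
  calc ‖z‖ = ‖(z + v) - v‖ := by simp
    _ ≤ _ := (norm_sub_le _ _).trans (by linarith)

lemma BM.shift' {u : ℝ × ℝ → ℝ} (hu : BM u) (v : ℝ × ℝ) : BM (fun z => u (z - v)) := by
  simpa [sub_eq_add_neg] using hu.shift (-v)

lemma BM.integrable {u : ℝ × ℝ → ℝ} (hu : BM u) : Integrable u := by
  obtain ⟨C, hC⟩ := hu.bdd
  obtain ⟨R, hR⟩ := hu.supp
  have h1 : IntegrableOn u (Metric.closedBall 0 R) := by
    refine Measure.integrableOn_of_bounded (M := C) ?_ hu.meas.aestronglyMeasurable ?_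
    · exact (isCompact_closedBall _ _).measure_lt_top.ne
    · exact Eventually.of_forall (fun z => hC z)
  rw [integrableOn_iff_integrable_of_support_subset] at h1
  · exact h1
  · intro z hz
    simpa using hR z hz

lemma BM.memLp {u : ℝ × ℝ → ℝ} (hu : BM u) : MemLp u 2 := by
  rw [memLp_two_iff_integrable_sq hu.meas.aestronglyMeasurable]
  have := (hu.mul hu).integrable
  simpa [sq] using this

/-- difference quotients -/
def Dt (h : ℝ) (u : ℝ × ℝ → ℝ) (z : ℝ × ℝ) : ℝ := (u (z + (h, 0)) - u z) / h
def Dx (h : ℝ) (u : ℝ × ℝ → ℝ) (z : ℝ × ℝ) : ℝ := (u (z + (0, h)) - u z) / h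
def Dxx (h : ℝ) (u : ℝ × ℝ → ℝ) (z : ℝ × ℝ) : ℝ :=
  (u (z + (0, h)) - 2 * u z + u (z - (0, h))) / h ^ 2
def DtS (h : ℝ) (u : ℝ × ℝ → ℝ) (z : ℝ × ℝ) : ℝ := (u (z - (h, 0)) - u z) / h
def DxS (h : ℝ) (u : ℝ × ℝ → ℝ) (z : ℝ × ℝ) : ℝ := (u (z - (0, h)) - u z) / h

lemma BM.dt {u : ℝ × ℝ → ℝ} (hu : BM u) (h : ℝ) : BM (Dt h u) := ((hu.shift _).sub hu).divc h
lemma BM.dx {u : ℝ × ℝ → ℝ} (hu : BM u) (h : ℝ) : BM (Dx h u) := ((hu.shift _).sub hu).divc h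
lemma BM.dtS {u : ℝ × ℝ → ℝ} (hu : BM u) (h : ℝ) : BM (DtS h u) := ((hu.shift' _).sub hu).divc h
lemma BM.dxS {u : ℝ × ℝ → ℝ} (hu : BM u) (h : ℝ) : BM (DxS h u) := ((hu.shift' _).sub hu).divc h
lemma BM.dxx {u : ℝ × ℝ → ℝ} (hu : BM u) (h : ℝ) : BM (Dxx h u) :=
  (((hu.shift _).sub (hu.cmul 2)).add (hu.shift' _)).divc (h ^ 2)

lemma shift_int (u w : ℝ × ℝ → ℝ) (v : ℝ × ℝ) :
    ∫ z, u (z + v) * w z = ∫ z, u z * w (z - v) := by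
  have := integral_add_right_eq_self (μ := (volume : Measure (ℝ × ℝ))) (fun z => u z * w (z - v)) v
  simpa using this

lemma shift_int' (u w : ℝ × ℝ → ℝ) (v : ℝ × ℝ) :
    ∫ z, u (z - v) * w z = ∫ z, u z * w (z + v) := by
  have := shift_int u w (-v)
  simpa [sub_eq_add_neg] using this

lemma ibp_t {u w : ℝ × ℝ → ℝ} (hu : BM u) (hw : BM w) (h : ℝ) :
    ∫ z, Dt h u z * w z = ∫ z, u z * DtS h w z := by
  have e1 : ∀ z, Dt h u z * w z = h⁻¹ * (u (z + (h, 0)) * w z) - h⁻¹ * (u z * w z) := by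
    intro z; simp only [Dt]; ring
  have e2 : ∀ z, u z * DtS h w z = h⁻¹ * (u z * w (z - (h, 0))) - h⁻¹ * (u z * w z) := by
    intro z; simp only [DtS]; ring
  simp_rw [e1, e2]
  rw [integral_sub (((hu.shift _).mul hw).cmul _).integrable ((hu.mul hw).cmul _).integrable,
    integral_sub ((hu.mul (hw.shift' _)).cmul _).integrable ((hu.mul hw).cmul _).integrable,
    integral_const_mul, integral_const_mul, integral_const_mul, shift_int]

lemma ibp_x {u w : ℝ × ℝ → ℝ} (hu : BM u) (hw : BM w) (h : ℝ) :
    ∫ z, Dx h u z * w z = ∫ z, u z * DxS h w z := by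
  have e1 : ∀ z, Dx h u z * w z = h⁻¹ * (u (z + (0, h)) * w z) - h⁻¹ * (u z * w z) := by
    intro z; simp only [Dx]; ring
  have e2 : ∀ z, u z * DxS h w z = h⁻¹ * (u z * w (z - (0, h))) - h⁻¹ * (u z * w z) := by
    intro z; simp only [DxS]; ring
  simp_rw [e1, e2]
  rw [integral_sub (((hu.shift _).mul hw).cmul _).integrable ((hu.mul hw).cmul _).integrable,
    integral_sub ((hu.mul (hw.shift' _)).cmul _).integrable ((hu.mul hw).cmul _).integrable,
    integral_const_mul, integral_const_mul, integral_const_mul, shift_int]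

lemma Dxx_eq (u : ℝ × ℝ → ℝ) (h : ℝ) (z : ℝ × ℝ) : Dxx h u z = - DxS h (Dx h u) z := by
  simp only [Dxx, DxS, Dx, sub_add_cancel]
  rcases eq_or_ne h 0 with rfl | hh
  · simp
  · field_simp
    ring

/-- summation by parts -/
lemma ibp_xx1 {u w : ℝ × ℝ → ℝ} (hu : BM u) (hw : BM w) (h : ℝ) :
    ∫ z, w z * Dxx h u z = - ∫ z, Dx h w z * Dx h u z := by
  rw [ibp_x hw (hu.dx h), ← integral_neg]
  refine integral_congr_ae (Eventually.of_forall fun z => ?_)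
  simp only [Dxx_eq]; ring

lemma ibp_xx {u w : ℝ × ℝ → ℝ} (hu : BM u) (hw : BM w) (h : ℝ) :
    ∫ z, Dxx h u z * w z = ∫ z, u z * Dxx h w z := by
  have h1 := ibp_xx1 hu hw h
  have h2 := ibp_xx1 hw hu h
  rw [h2]
  simp_rw [mul_comm (Dxx h u _)]
  rw [h1]
  simp_rw [mul_comm (Dx h w _)]

lemma dt_self {v : ℝ × ℝ → ℝ} (hv : BM v) {h : ℝ} (hh : 0 < h) : ∫ z, Dt h v z * v z ≤ 0 := by
  have e : ∀ z, Dt h v z * v z ≤ (2 * h)⁻¹ * (v (z + (h, 0)) * v (z + (h, 0))) - (2 * h)⁻¹ * (v z * v z) := by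
    intro z
    simp only [Dt]
    rw [← sub_nonneg]
    have : (2 * h)⁻¹ * (v (z + (h, 0)) * v (z + (h, 0))) - (2 * h)⁻¹ * (v z * v z) -
      (v (z + (h, 0)) - v z) / h * v z = (2 * h)⁻¹ * (v (z + (h, 0)) - v z) ^ 2 := by
      field_simp; ring
    rw [this]; positivity
  have i1 := (((hv.shift (h, 0)).mul (hv.shift (h, 0))).cmul (2 * h)⁻¹).integrable
  have i2 := ((hv.mul hv).cmul (2 * h)⁻¹).integrable
  calc _ ≤ ∫ z, ((2 * h)⁻¹ * (v (z + (h, 0)) * v (z + (h, 0))) - (2 * h)⁻¹ * (v z * v z)) :=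
        integral_mono ((hv.dt h).mul hv).integrable (i1.sub i2) e
    _ = 0 := by
      rw [integral_sub i1 i2, integral_const_mul, integral_const_mul, shift_int]
      simp

lemma Dt_Dx (u : ℝ × ℝ → ℝ) (h : ℝ) (z : ℝ × ℝ) : Dx h (Dt h u) z = Dt h (Dx h u) z := by
  simp only [Dx, Dt, add_right_comm z (0, h) (h, 0)]
  ring

lemma dt_dxx {u : ℝ × ℝ → ℝ} (hu : BM u) {h : ℝ} (hh : 0 < h) : 0 ≤ ∫ z, Dt h u z * Dxx h u z := by
  rw [ibp_xx1 hu (hu.dt h)]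
  simp_rw [Dt_Dx]
  have := dt_self (hu.dx h) hh
  linarith

/-- the discrete operator -/
def Aop (h lam : ℝ) (a b : ℝ × ℝ → ℝ) (u : ℝ × ℝ → ℝ) (z : ℝ × ℝ) : ℝ :=
  Dt h u z - lam * u z + b z * Dx h u z + a z * Dxx h u z

lemma BM.aop {u a b : ℝ × ℝ → ℝ} (hu : BM u) (h lam : ℝ) (ha : Measurable a) (hb : Measurable b)
    (hab : ∃ C : ℝ, ∀ z, |a z| ≤ C) (hbb : ∃ C : ℝ, ∀ z, |b z| ≤ C) : BM (Aop h lam a b u) :=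
  (((hu.dt h).sub (hu.cmul lam)).add ((hu.dx h).bmul hb hbb)).add ((hu.dxx h).bmul ha hab)

end

section

lemma riesz_abs {V H : Type*} [AddCommGroup V] [Module ℝ V] [NormedAddCommGroup H]
    [InnerProductSpace ℝ H] [CompleteSpace H] (A : V →ₗ[ℝ] H) (r : V →ₗ[ℝ] ℝ) (C : ℝ) (hC : 0 ≤ C)
    (h : ∀ u, |r u| ≤ C * ‖A u‖) : ∃ q : H, ‖q‖ ≤ C ∧ ∀ u, inner ℝ q (A u) = r u := by
  have hk : LinearMap.ker A ≤ LinearMap.ker r := by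
    intro u hu
    rw [LinearMap.mem_ker] at hu ⊢
    have := h u
    rw [hu] at this
    simpa using this
  let f0 : LinearMap.range A →ₗ[ℝ] ℝ :=
    ((LinearMap.ker A).liftQ r hk).comp (A.quotKerEquivRange.symm : LinearMap.range A →ₗ[ℝ] _)
  have hf0 : ∀ u, f0 ⟨A u, LinearMap.mem_range_self A u⟩ = r u := by
    intro u
    have : (⟨A u, LinearMap.mem_range_self A u⟩ : LinearMap.range A) =
        A.quotKerEquivRange ((LinearMap.ker A).mkQ u) := by
      ext; simp [LinearMap.quotKerEquivRange_apply_mk]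
    simp only [f0, LinearMap.comp_apply, this]
    simp
  let f : LinearMap.range A →L[ℝ] ℝ := f0.mkContinuous C (by
    rintro ⟨_, u, rfl⟩
    rw [hf0]
    simpa using h u)
  obtain ⟨g, hg1, hg2⟩ := exists_extension_norm_eq (LinearMap.range A) f
  refine ⟨(InnerProductSpace.toDual ℝ H).symm g, ?_, fun u => ?_⟩
  · rw [LinearIsometryEquiv.norm_map, hg2]
    exact LinearMap.mkContinuous_norm_le _ hC _
  · rw [InnerProductSpace.toDual_symm_apply, ← hf0 u]
    exact hg1 ⟨A u, LinearMap.mem_range_self A u⟩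

lemma energy_est {h c0 C B : ℝ} (hh : 0 < h) (hc0 : 0 < c0) {It Ix : Set ℝ}
    (hIt : MeasurableSet It) (hIx : MeasurableSet Ix)
    {a b u : ℝ × ℝ → ℝ} (ha : Measurable a) (hb : Measurable b)
    (ha1 : ∀ z, c0 ≤ a z) (ha2 : ∀ z, a z ≤ C) (hb1 : ∀ z, |b z| ≤ B)
    (hu : BM u) (hs : ∀ z, z ∉ It ×ˢ Ix → u z = 0) :
    (c0 / 2 * ∫ z in It ×ˢ Ix, Dxx h u z ^ 2) + ∫ z, Dx h u z ^ 2 ≤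
      (1 / c0) * ∫ z in It ×ˢ Ix, Aop h (B ^ 2 / c0 + 1) a b u z ^ 2 := by
  set lam := B ^ 2 / c0 + 1 with hlam
  set Q := It ×ˢ Ix with hQ
  have hQm : MeasurableSet Q := hIt.prod hIx
  have hab : ∃ C : ℝ, ∀ z, |a z| ≤ C := ⟨C, fun z => by
    rw [abs_of_nonneg (hc0.le.trans (ha1 z))]; exact ha2 z⟩
  have hA := hu.aop h lam ha hb hab ⟨B, hb1⟩
  have hxx := hu.dxx h
  have hx := hu.dx h
  have ht := hu.dt h
  have z1 : ∀ z, z ∉ Q → Dt h u z * Dxx h u z = 0 := by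
    rintro ⟨t, x⟩ hz
    by_cases hxx : x ∈ Ix
    · have ht : t ∉ It := fun h1 => hz ⟨h1, hxx⟩
      have e : ∀ y, u (t, y) = 0 := fun y => hs _ (fun h1 => ht h1.1)
      simp [Dxx, e]
    · have e : ∀ s, u (s, x) = 0 := fun y => hs _ (fun h1 => hxx h1.2)
      simp [Dt, e]
  have z2 : ∀ z, z ∉ Q → u z * Dxx h u z = 0 := by
    intro z hz; simp [hs z hz]
  have e1 : ∫ z in Q, Dt h u z * Dxx h u z = ∫ z, Dt h u z * Dxx h u z :=
    setIntegral_eq_integral_of_forall_compl_eq_zero z1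
  have e2 : ∫ z in Q, u z * Dxx h u z = ∫ z, u z * Dxx h u z :=
    setIntegral_eq_integral_of_forall_compl_eq_zero z2
  have hpt : ∀ z, (c0 / 2 * Dxx h u z ^ 2 + (Dt h u z * Dxx h u z - lam * (u z * Dxx h u z)))
      ≤ 1 / c0 * Aop h lam a b u z ^ 2 + B ^ 2 / c0 * Dx h u z ^ 2 := by
    intro z
    set X := Dxx h u z
    set Y := Dx h u z
    set F := Aop h lam a b u z with hF
    have hFe : F = Dt h u z - lam * u z + b z * Y + a z * X := rfl
    have h1 : F * X ≤ 1 / c0 * F ^ 2 + c0 / 4 * X ^ 2 := by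
      have : 1 / c0 * F ^ 2 + c0 / 4 * X ^ 2 - F * X = 1 / c0 * (F - c0 / 2 * X) ^ 2 := by
        field_simp; ring
      have h2 : 0 ≤ 1 / c0 * (F - c0 / 2 * X) ^ 2 := by positivity
      linarith
    have h2 : -(b z * Y * X) ≤ B ^ 2 / c0 * Y ^ 2 + c0 / 4 * X ^ 2 := by
      have h3 : b z ^ 2 ≤ B ^ 2 := sq_le_sq' (by linarith [abs_le.1 (hb1 z)]) (abs_le.1 (hb1 z)).2
      have : b z ^ 2 / c0 * Y ^ 2 + c0 / 4 * X ^ 2 + b z * Y * X = 1 / c0 * (b z * Y + c0 / 2 * X) ^ 2 := by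
        field_simp; ring
      have h4 : 0 ≤ 1 / c0 * (b z * Y + c0 / 2 * X) ^ 2 := by positivity
      have h5 : b z ^ 2 / c0 * Y ^ 2 ≤ B ^ 2 / c0 * Y ^ 2 := by gcongr
      linarith
    have h6 : c0 * X ^ 2 ≤ a z * X ^ 2 := mul_le_mul_of_nonneg_right (ha1 z) (sq_nonneg _)
    have h7 : F * X = (Dt h u z * X - lam * (u z * X)) + b z * Y * X + a z * X ^ 2 := by
      rw [hFe]; ring
    linarith
  have sqi : ∀ {v : ℝ × ℝ → ℝ}, BM v → Integrable (fun z => v z ^ 2) := by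
    intro v hv; simpa [sq] using (hv.mul hv).integrable
  have i1 := ((sqi hxx).const_mul (c0 / 2)).integrableOn (s := Q)
  have i2 := ((ht.mul hxx).integrable).integrableOn (s := Q)
  have i3 := ((hu.mul hxx).integrable.const_mul lam).integrableOn (s := Q)
  have i4 := ((sqi hA).const_mul (1 / c0)).integrableOn (s := Q)
  have i5 := ((sqi hx).const_mul (B ^ 2 / c0)).integrableOn (s := Q)
  have key := integral_mono (i1.add (i2.sub i3)) (i4.add i5) hpt
  rw [integral_add' i1 (i2.sub i3), integral_add' i4 i5, integral_sub' i2 i3] at key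
  simp only [integral_const_mul] at key
  rw [e1, e2, ibp_xx1 hu hu] at key
  have h8 : ∫ z in Q, Dx h u z ^ 2 ≤ ∫ z, Dx h u z ^ 2 :=
    setIntegral_le_integral (sqi hx) (Eventually.of_forall fun z => sq_nonneg _)
  have h9 := dt_dxx hu hh
  have h10 : ∫ z, Dx h u z * Dx h u z = ∫ z, Dx h u z ^ 2 := by simp_rw [sq]
  rw [h10] at key
  have h11 : B ^ 2 / c0 * ∫ z in Q, Dx h u z ^ 2 ≤ B ^ 2 / c0 * ∫ z, Dx h u z ^ 2 :=
    mul_le_mul_of_nonneg_left h8 (by positivity)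
  have h12 : lam * ∫ z, Dx h u z ^ 2 = B ^ 2 / c0 * (∫ z, Dx h u z ^ 2) + ∫ z, Dx h u z ^ 2 := by
    rw [hlam]; ring
  linarith

lemma energy_est0 {h c0 C B : ℝ} (hh : 0 < h) (hc0 : 0 < c0) {It Ix : Set ℝ}
    (hIt : MeasurableSet It) (hIx : MeasurableSet Ix)
    {a b u : ℝ × ℝ → ℝ} (ha : Measurable a) (hb : Measurable b)
    (ha1 : ∀ z, c0 ≤ a z) (ha2 : ∀ z, a z ≤ C) (hb1 : ∀ z, |b z| ≤ B)
    (hu : BM u) (hs : ∀ z, z ∉ It ×ˢ Ix → u z = 0) :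
    ∫ z, u z ^ 2 ≤
      3 * (1 + B ^ 2 / c0 + 2 * C ^ 2 / c0 ^ 2) *
        ∫ z in It ×ˢ Ix, Aop h (B ^ 2 / c0 + 1) a b u z ^ 2 := by
  have hen := energy_est hh hc0 hIt hIx ha hb ha1 ha2 hb1 hu hs
  set lam := B ^ 2 / c0 + 1 with hlam
  set Q := It ×ˢ Ix with hQ
  have hQm : MeasurableSet Q := hIt.prod hIx
  have hab : ∃ C : ℝ, ∀ z, |a z| ≤ C := ⟨C, fun z => by
    rw [abs_of_nonneg (hc0.le.trans (ha1 z))]; exact ha2 z⟩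
  have hA := hu.aop h lam ha hb hab ⟨B, hb1⟩
  have hxx := hu.dxx h
  have hx := hu.dx h
  have ht := hu.dt h
  have hlam1 : 1 ≤ lam := by rw [hlam]; have : 0 ≤ B ^ 2 / c0 := by positivity
                             linarith
  have z1 : ∀ z, z ∉ Q → Dt h u z * u z = 0 := by
    intro z hz; simp [hs z hz]
  have z2 : ∀ z, z ∉ Q → u z ^ 2 = 0 := by
    intro z hz; simp [hs z hz]
  have e1 : ∫ z in Q, Dt h u z * u z = ∫ z, Dt h u z * u z :=
    setIntegral_eq_integral_of_forall_compl_eq_zero z1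
  have e2 : ∫ z in Q, u z ^ 2 = ∫ z, u z ^ 2 :=
    setIntegral_eq_integral_of_forall_compl_eq_zero z2
  have hpt : ∀ z, 1 / 2 * u z ^ 2 - Dt h u z * u z ≤ 3 / 2 * Aop h lam a b u z ^ 2 +
      (3 / 2 * B ^ 2 * Dx h u z ^ 2 + 3 / 2 * C ^ 2 * Dxx h u z ^ 2) := by
    intro z
    set X := Dxx h u z
    set Y := Dx h u z
    set F := Aop h lam a b u z with hF
    have hFe : F = Dt h u z - lam * u z + b z * Y + a z * X := rfl
    have h3 : b z ^ 2 ≤ B ^ 2 := sq_le_sq' (by linarith [abs_le.1 (hb1 z)]) (abs_le.1 (hb1 z)).2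
    have h4 : a z ^ 2 ≤ C ^ 2 := sq_le_sq' (by linarith [ha1 z, ha2 z]) (ha2 z)
    have h5 : b z ^ 2 * Y ^ 2 ≤ B ^ 2 * Y ^ 2 := by gcongr
    have h6 : a z ^ 2 * X ^ 2 ≤ C ^ 2 * X ^ 2 := by gcongr
    have h7 : u z ^ 2 ≤ lam * u z ^ 2 := le_mul_of_one_le_left (sq_nonneg _) hlam1
    have h8 : Dt h u z * u z = F * u z + lam * u z ^ 2 - b z * Y * u z - a z * X * u z := by
      rw [hFe]; ring
    have h9 := sq_nonneg (u z / 3 + F)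
    have h10 := sq_nonneg (u z / 3 - b z * Y)
    have h11 := sq_nonneg (u z / 3 - a z * X)
    nlinarith
  have sqi : ∀ {v : ℝ × ℝ → ℝ}, BM v → Integrable (fun z => v z ^ 2) := by
    intro v hv; simpa [sq] using (hv.mul hv).integrable
  have i1 := ((sqi hu).const_mul (1 / 2)).integrableOn (s := Q)
  have i2 := ((ht.mul hu).integrable).integrableOn (s := Q)
  have i3 := ((sqi hA).const_mul (3 / 2)).integrableOn (s := Q)
  have i4 := ((sqi hx).const_mul (3 / 2 * B ^ 2)).integrableOn (s := Q)
  have i5 := ((sqi hxx).const_mul (3 / 2 * C ^ 2)).integrableOn (s := Q)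
  have key := integral_mono (i1.sub i2) (i3.add (i4.add i5)) hpt
  rw [integral_add' i3 (i4.add i5), integral_sub' i1 i2, integral_add' i4 i5] at key
  simp only [integral_const_mul] at key
  rw [e1, e2] at key
  have h8 : ∫ z in Q, Dx h u z ^ 2 ≤ ∫ z, Dx h u z ^ 2 :=
    setIntegral_le_integral (sqi hx) (Eventually.of_forall fun z => sq_nonneg _)
  have h9 := dt_self hu hh
  set Phi := ∫ z in Q, Aop h lam a b u z ^ 2
  have p1 : 0 ≤ ∫ z in Q, Dxx h u z ^ 2 := integral_nonneg fun z => sq_nonneg _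
  have p2 : 0 ≤ ∫ z, Dx h u z ^ 2 := integral_nonneg fun z => sq_nonneg _
  have q1 : ∫ z in Q, Dx h u z ^ 2 ≤ 1 / c0 * Phi := by
    have : 0 ≤ c0 / 2 * ∫ z in Q, Dxx h u z ^ 2 := by positivity
    linarith
  have q2 : ∫ z in Q, Dxx h u z ^ 2 ≤ 2 / c0 ^ 2 * Phi := by
    have : c0 / 2 * ∫ z in Q, Dxx h u z ^ 2 ≤ 1 / c0 * Phi := by linarith
    have h2 : 2 / c0 ^ 2 * Phi = 2 / c0 * (1 / c0 * Phi) := by field_simp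
    rw [h2]
    calc ∫ z in Q, Dxx h u z ^ 2 = 2 / c0 * (c0 / 2 * ∫ z in Q, Dxx h u z ^ 2) := by field_simp
      _ ≤ _ := by gcongr
  have q3 : 3 / 2 * B ^ 2 * ∫ z in Q, Dx h u z ^ 2 ≤ 3 / 2 * B ^ 2 * (1 / c0 * Phi) := by gcongr
  have q4 : 3 / 2 * C ^ 2 * ∫ z in Q, Dxx h u z ^ 2 ≤ 3 / 2 * C ^ 2 * (2 / c0 ^ 2 * Phi) := by gcongr
  have : 3 * (1 + B ^ 2 / c0 + 2 * C ^ 2 / c0 ^ 2) * Phi =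
    2 * (3 / 2 * Phi + (3 / 2 * B ^ 2 * (1 / c0 * Phi) + 3 / 2 * C ^ 2 * (2 / c0 ^ 2 * Phi))) := by
    ring
  rw [this]
  linarith

end

section

lemma toLp_inner {α : Type*} [MeasurableSpace α] {μ : Measure α} {f g : α → ℝ} (hf : MemLp f 2 μ)
    (hg : MemLp g 2 μ) : inner ℝ (hf.toLp f) (hg.toLp g) = ∫ z, f z * g z ∂μ := by
  rw [L2.inner_def]
  refine integral_congr_ae ?_
  filter_upwards [hf.coeFn_toLp, hg.coeFn_toLp] with z h1 h2
  rw [h1, h2]; simp [mul_comm]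

lemma toLp_norm_sq {α : Type*} [MeasurableSpace α] {μ : Measure α} {f : α → ℝ} (hf : MemLp f 2 μ) :
    ‖hf.toLp f‖ ^ 2 = ∫ z, f z ^ 2 ∂μ := by
  rw [← real_inner_self_eq_norm_sq, toLp_inner]
  simp_rw [sq]

lemma cs_int {α : Type*} [MeasurableSpace α] {μ : Measure α} {f g : α → ℝ} (hf : MemLp f 2 μ)
    (hg : MemLp g 2 μ) : |∫ z, f z * g z ∂μ| ≤ √(∫ z, f z ^ 2 ∂μ) * √(∫ z, g z ^ 2 ∂μ) := by
  rw [← toLp_inner hf hg, ← toLp_norm_sq hf, ← toLp_norm_sq hg, Real.sqrt_sq (norm_nonneg _),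
    Real.sqrt_sq (norm_nonneg _)]
  exact abs_real_inner_le_norm _ _

lemma mul_int {α : Type*} [MeasurableSpace α] {μ : Measure α} {f g : α → ℝ} (hf : MemLp f 2 μ)
    (hg : MemLp g 2 μ) : Integrable (fun z => f z * g z) μ :=
  hf.integrable_mul hg

lemma sq_int {α : Type*} [MeasurableSpace α] {μ : Measure α} {f : α → ℝ} (hf : MemLp f 2 μ) :
    Integrable (fun z => f z ^ 2) μ := hf.integrable_sq

/-- bounded measurable functions supported in a set -/
def VQ (Q : Set (ℝ × ℝ)) : Submodule ℝ (ℝ × ℝ → ℝ) where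
  carrier := {u | BM u ∧ ∀ z, z ∉ Q → u z = 0}
  add_mem' := by
    rintro u v ⟨h1, h2⟩ ⟨h3, h4⟩
    exact ⟨h1.add h3, fun z hz => by simp [h2 z hz, h4 z hz]⟩
  zero_mem' := ⟨⟨measurable_const, ⟨0, by simp⟩, ⟨0, by simp⟩⟩, by simp⟩
  smul_mem' := by
    rintro c u ⟨h1, h2⟩
    exact ⟨h1.cmul c, fun z hz => by simp [h2 z hz]⟩

lemma Aop_add (h lam : ℝ) (a b u v : ℝ × ℝ → ℝ) (z : ℝ × ℝ) :
    Aop h lam a b (u + v) z = Aop h lam a b u z + Aop h lam a b v z := by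
  simp only [Aop, Dt, Dx, Dxx, Pi.add_apply]; ring

lemma Aop_smul (h lam c : ℝ) (a b u : ℝ × ℝ → ℝ) (z : ℝ × ℝ) :
    Aop h lam a b (c • u) z = c * Aop h lam a b u z := by
  simp only [Aop, Dt, Dx, Dxx, Pi.smul_apply, smul_eq_mul]; ring

def K0st (c0 C B : ℝ) : ℝ := 3 * (1 + B ^ 2 / c0 + 2 * C ^ 2 / c0 ^ 2)
def Kst (c0 C B : ℝ) : ℝ :=
  3 * (2 / c0 ^ 2 + 1 / c0 + (B ^ 2 / c0 + 1) ^ 2 * K0st c0 C B)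

lemma Kst_pos {c0 C B : ℝ} (hc0 : 0 < c0) : 0 < Kst c0 C B := by
  unfold Kst K0st; positivity

lemma kato_pt {h c0 lam B : ℝ} (hh : 0 < h) (hhB : h * B ≤ c0) {a b v w P : ℝ × ℝ → ℝ}
    (ha1 : ∀ z, c0 ≤ a z) (hb1 : ∀ z, |b z| ≤ B) (hc0 : 0 < c0) (hv : ∀ z, 0 ≤ v z)
    (hw : ∀ z, w z = if 0 < P z then v z else 0) (z : ℝ × ℝ) :
    Aop h lam a b w z * P z ≤ Aop h lam a b v z * max (P z) 0 := by
  have hw0 : ∀ z, 0 ≤ w z := fun z => by rw [hw]; split_ifs; exacts [hv z, le_rfl]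
  have hwv : ∀ z, w z ≤ v z := fun z => by rw [hw]; split_ifs; exacts [le_rfl, hv z]
  have ex : ∀ u : ℝ × ℝ → ℝ, Aop h lam a b u z = 1 / h * u (z + (h, 0)) +
      (b z / h + a z / h ^ 2) * u (z + (0, h)) + a z / h ^ 2 * u (z - (0, h)) -
      (1 / h + lam + b z / h + 2 * a z / h ^ 2) * u z := by
    intro u; simp only [Aop, Dt, Dx, Dxx]; field_simp; ring
  have k1 : 0 ≤ 1 / h := by positivity
  have k3 : 0 ≤ a z / h ^ 2 := by have := hc0.le.trans (ha1 z); positivity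
  have k2 : 0 ≤ b z / h + a z / h ^ 2 := by
    have : b z / h + a z / h ^ 2 = (h * b z + a z) / h ^ 2 := by field_simp
    rw [this]
    have h1 := (abs_le.1 (hb1 z)).1
    have : h * (-B) ≤ h * b z := by gcongr
    have h3 := ha1 z
    apply div_nonneg _ (by positivity)
    linarith
  by_cases hP : 0 < P z
  · rw [max_eq_left hP.le]
    refine mul_le_mul_of_nonneg_right ?_ hP.le
    rw [ex w, ex v]
    have e : w z = v z := by rw [hw, if_pos hP]
    rw [e]
    have := mul_le_mul_of_nonneg_left (hwv (z + (h, 0))) k1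
    have := mul_le_mul_of_nonneg_left (hwv (z + (0, h))) k2
    have := mul_le_mul_of_nonneg_left (hwv (z - (0, h))) k3
    linarith
  · push Not at hP
    rw [max_eq_right hP, mul_zero]
    refine mul_nonpos_of_nonneg_of_nonpos ?_ hP
    rw [ex w]
    have e : w z = 0 := by rw [hw, if_neg (not_lt.2 hP)]
    rw [e]
    have := mul_nonneg k1 (hw0 (z + (h, 0)))
    have := mul_nonneg k2 (hw0 (z + (0, h)))
    have := mul_nonneg k3 (hw0 (z - (0, h)))
    linarith

lemma discrete_step {h c0 C B : ℝ} (hh : 0 < h) (hc0 : 0 < c0) (hhB : h * B ≤ c0) {It Ix : Set ℝ}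
    (hIt : MeasurableSet It) (hIx : MeasurableSet Ix) (hQb : ∃ R : ℝ, ∀ z ∈ It ×ˢ Ix, ‖z‖ ≤ R)
    {a b : ℝ × ℝ → ℝ} (ha : Measurable a) (hb : Measurable b)
    (ha1 : ∀ z, c0 ≤ a z) (ha2 : ∀ z, a z ≤ C) (hb1 : ∀ z, |b z| ≤ B)
    {f0 f0' f1 f2 g g0 : ℝ × ℝ → ℝ} (hf0 : BM f0) (hf0' : BM f0') (hf1 : BM f1) (hf2 : BM f2)
    (hg : BM g) (hg0 : BM g0)
    (zf0 : ∀ z, z ∉ It ×ˢ Ix → f0 z = 0) (zf0' : ∀ z, z ∉ It ×ˢ Ix → f0' z = 0)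
    (zf1 : ∀ z, z ∉ It ×ˢ Ix → f1 z = 0) (zf2 : ∀ z, z ∉ It ×ˢ Ix → f2 z = 0)
    (pf0 : ∀ z, 0 ≤ f0 z) (pg : ∀ z, 0 ≤ g z) (pg0 : ∀ z, 0 ≤ g0 z)
    (hid : ∀ z, g z = g0 z + DtS h f0 z - (B ^ 2 / c0 + 1) * f0' z + DxS h f1 z + Dxx h f2 z) :
    ∃ P : ℝ × ℝ → ℝ, Measurable P ∧ MemLp P 2 ∧ (∀ z, 0 ≤ P z) ∧ (∀ z, z ∉ It ×ˢ Ix → P z = 0) ∧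
      (∀ v, BM v → (∀ z, 0 ≤ v z) →
        0 ≤ (∫ z, Aop h (B ^ 2 / c0 + 1) a b v z * P z) + ∫ z, v z * g0 z) ∧
      ∫ z, (P z - f0 z) ^ 2 ≤ Kst c0 C B * ((∫ z, (f2 z - a z * f0 z) ^ 2) +
        (∫ z, (f1 z - b z * f0 z) ^ 2) + ∫ z, (f0 z - f0' z) ^ 2) := by
  have EN1 := fun u (hu : BM u) => energy_est hh hc0 hIt hIx ha hb ha1 ha2 hb1 (u := u) hu
  have EN0 := fun u (hu : BM u) => energy_est0 hh hc0 hIt hIx ha hb ha1 ha2 hb1 (u := u) hu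
  set lam := B ^ 2 / c0 + 1 with hlam
  set Q := It ×ˢ Ix with hQ
  have hlam0 : 0 ≤ lam := by positivity
  have hQm : MeasurableSet Q := hIt.prod hIx
  have hab : ∃ C : ℝ, ∀ z, |a z| ≤ C := ⟨C, fun z => by
    rw [abs_of_nonneg (hc0.le.trans (ha1 z))]; exact ha2 z⟩
  have hbb : ∃ C : ℝ, ∀ z, |b z| ≤ C := ⟨B, hb1⟩
  have hAB : ∀ u, BM u → BM (Aop h lam a b u) := fun u hu => hu.aop h lam ha hb hab hbb
  set F2 : ℝ × ℝ → ℝ := fun z => f2 z - a z * f0 z with hF2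
  set F1 : ℝ × ℝ → ℝ := fun z => f1 z - b z * f0 z with hF1
  set F0 : ℝ × ℝ → ℝ := fun z => f0 z - f0' z with hF0
  have bF2 : BM F2 := hf2.sub (hf0.bmul ha hab)
  have bF1 : BM F1 := hf1.sub (hf0.bmul hb hbb)
  have bF0 : BM F0 := hf0.sub hf0'
  have zF2 : ∀ z, z ∉ Q → F2 z = 0 := fun z hz => by simp [hF2, zf2 z hz, zf0 z hz]
  set μQ : Measure (ℝ × ℝ) := volume.restrict Q with hμQ
  -- the linear maps
  have mA : ∀ u : VQ Q, MemLp (Aop h lam a b u.1) 2 μQ := fun u => (hAB _ u.2.1).memLp.restrict Q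
  let A : VQ Q →ₗ[ℝ] Lp ℝ 2 μQ :=
    { toFun := fun u => (mA u).toLp _
      map_add' := by
        intro u v
        rw [← MemLp.toLp_add]
        congr 1
        ext z
        exact Aop_add _ _ _ _ _ _ z
      map_smul' := by
        intro c u
        rw [RingHom.id_apply, ← MemLp.toLp_const_smul]
        congr 1
        ext z
        exact Aop_smul _ _ _ _ _ _ z }
  have i2 : ∀ u, BM u → Integrable (fun z => Dxx h u z * F2 z) := fun u hu =>
    ((hu.dxx h).mul bF2).integrable
  have i1 : ∀ u, BM u → Integrable (fun z => Dx h u z * F1 z) := fun u hu =>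
    ((hu.dx h).mul bF1).integrable
  have i0 : ∀ u, BM u → Integrable (fun z => u z * F0 z) := fun u hu =>
    (hu.mul bF0).integrable
  let r : VQ Q →ₗ[ℝ] ℝ :=
    { toFun := fun u => (∫ z, Dxx h u.1 z * F2 z) + (∫ z, Dx h u.1 z * F1 z) + lam * ∫ z, u.1 z * F0 z
      map_add' := by
        intro u v
        have e2 : ∫ z, Dxx h (u.1 + v.1) z * F2 z = (∫ z, Dxx h u.1 z * F2 z) + ∫ z, Dxx h v.1 z * F2 z := by
          rw [← integral_add (i2 _ u.2.1) (i2 _ v.2.1)]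
          congr 1; ext z; simp only [Dxx, Pi.add_apply]; ring
        have e1 : ∫ z, Dx h (u.1 + v.1) z * F1 z = (∫ z, Dx h u.1 z * F1 z) + ∫ z, Dx h v.1 z * F1 z := by
          rw [← integral_add (i1 _ u.2.1) (i1 _ v.2.1)]
          congr 1; ext z; simp only [Dx, Pi.add_apply]; ring
        have e0 : ∫ z, (u.1 + v.1) z * F0 z = (∫ z, u.1 z * F0 z) + ∫ z, v.1 z * F0 z := by
          rw [← integral_add (i0 _ u.2.1) (i0 _ v.2.1)]
          congr 1; ext z; simp only [Pi.add_apply]; ring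
        simp only [Submodule.coe_add, e2, e1, e0]; ring
      map_smul' := by
        intro c u
        have e2 : ∫ z, Dxx h (c • u.1) z * F2 z = c * (∫ z, Dxx h u.1 z * F2 z) := by
          rw [← integral_const_mul]
          congr 1; ext z; simp only [Dxx, Pi.smul_apply, smul_eq_mul]; ring
        have e1 : ∫ z, Dx h (c • u.1) z * F1 z = c * (∫ z, Dx h u.1 z * F1 z) := by
          rw [← integral_const_mul]
          congr 1; ext z; simp only [Dx, Pi.smul_apply, smul_eq_mul]; ring
        have e0 : ∫ z, (c • u.1) z * F0 z = c * (∫ z, u.1 z * F0 z) := by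
          rw [← integral_const_mul]
          congr 1; ext z; simp only [Pi.smul_apply, smul_eq_mul]; ring
        simp only [Submodule.coe_smul, e2, e1, e0, RingHom.id_apply, smul_eq_mul]; ring }
  set N2 := ∫ z, F2 z ^ 2
  set N1 := ∫ z, F1 z ^ 2
  set N0 := ∫ z, F0 z ^ 2
  have pN2 : 0 ≤ N2 := integral_nonneg fun _ => sq_nonneg _
  have pN1 : 0 ≤ N1 := integral_nonneg fun _ => sq_nonneg _
  have pN0 : 0 ≤ N0 := integral_nonneg fun _ => sq_nonneg _
  set K0 := K0st c0 C B with hK0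
  have pK0 : 0 ≤ K0 := by rw [hK0, K0st]; positivity
  set M := √(2 / c0 ^ 2) * √N2 + √(1 / c0) * √N1 + lam * (√K0 * √N0) with hM
  have pM : 0 ≤ M := by positivity
  have hbound : ∀ u : VQ Q, |r u| ≤ M * ‖A u‖ := by
    intro u
    obtain ⟨hu, hs⟩ := u.2
    have h1 := EN1 u.1 hu hs
    have h0 := EN0 u.1 hu hs
    have hn : ∫ z in Q, Aop h lam a b u.1 z ^ 2 = ‖A u‖ ^ 2 := (toLp_norm_sq (mA u)).symm
    rw [hn] at h1 h0
    set n := ‖A u‖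
    have pn : 0 ≤ n := norm_nonneg _
    have p1 : 0 ≤ ∫ z in Q, Dxx h u.1 z ^ 2 := integral_nonneg fun z => sq_nonneg _
    have p2 : 0 ≤ ∫ z, Dx h u.1 z ^ 2 := integral_nonneg fun z => sq_nonneg _
    have q1 : ∫ z, Dx h u.1 z ^ 2 ≤ 1 / c0 * n ^ 2 := by
      have : 0 ≤ c0 / 2 * ∫ z in Q, Dxx h u.1 z ^ 2 := by positivity
      linarith
    have q2 : ∫ z in Q, Dxx h u.1 z ^ 2 ≤ 2 / c0 ^ 2 * n ^ 2 := by
      have : c0 / 2 * ∫ z in Q, Dxx h u.1 z ^ 2 ≤ 1 / c0 * n ^ 2 := by linarith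
      have h2 : 2 / c0 ^ 2 * n ^ 2 = 2 / c0 * (1 / c0 * n ^ 2) := by field_simp
      rw [h2]
      calc ∫ z in Q, Dxx h u.1 z ^ 2 = 2 / c0 * (c0 / 2 * ∫ z in Q, Dxx h u.1 z ^ 2) := by field_simp
        _ ≤ _ := by gcongr
    have s2 : |∫ z, Dxx h u.1 z * F2 z| ≤ √(2 / c0 ^ 2) * √N2 * n := by
      have e : ∫ z, Dxx h u.1 z * F2 z = ∫ z in Q, Dxx h u.1 z * F2 z :=
        (setIntegral_eq_integral_of_forall_compl_eq_zero (fun z hz => by simp [zF2 z hz])).symm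
      have e' : ∫ z in Q, F2 z ^ 2 = N2 :=
        setIntegral_eq_integral_of_forall_compl_eq_zero (fun z hz => by simp [zF2 z hz])
      rw [e]
      refine (cs_int ((hu.dxx h).memLp.restrict Q) (bF2.memLp.restrict Q)).trans ?_
      rw [e']
      have : √(∫ z in Q, Dxx h u.1 z ^ 2) ≤ √(2 / c0 ^ 2) * n := by
        rw [← Real.sqrt_sq pn, ← Real.sqrt_mul (by positivity)]
        exact Real.sqrt_le_sqrt (by simpa [Real.sqrt_sq pn] using q2)
      calc _ ≤ √(2 / c0 ^ 2) * n * √N2 := by gcongr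
        _ = _ := by ring
    have s1 : |∫ z, Dx h u.1 z * F1 z| ≤ √(1 / c0) * √N1 * n := by
      refine (cs_int ((hu.dx h).memLp) (bF1.memLp)).trans ?_
      have : √(∫ z, Dx h u.1 z ^ 2) ≤ √(1 / c0) * n := by
        rw [← Real.sqrt_sq pn, ← Real.sqrt_mul (by positivity)]
        exact Real.sqrt_le_sqrt (by simpa [Real.sqrt_sq pn] using q1)
      calc _ ≤ √(1 / c0) * n * √N1 := by gcongr
        _ = _ := by ring
    have s0 : |∫ z, u.1 z * F0 z| ≤ √K0 * √N0 * n := by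
      refine (cs_int (hu.memLp) (bF0.memLp)).trans ?_
      have : √(∫ z, u.1 z ^ 2) ≤ √K0 * n := by
        rw [← Real.sqrt_sq pn, ← Real.sqrt_mul pK0]
        exact Real.sqrt_le_sqrt (h0)
      calc _ ≤ √K0 * n * √N0 := by gcongr
        _ = _ := by ring
    change |(∫ z, Dxx h u.1 z * F2 z) + (∫ z, Dx h u.1 z * F1 z) + lam * ∫ z, u.1 z * F0 z| ≤ _
    refine (abs_add_le _ _).trans ?_
    refine (add_le_add (abs_add_le _ _) le_rfl).trans ?_
    rw [abs_mul, abs_of_nonneg hlam0]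
    have := mul_le_mul_of_nonneg_left s0 hlam0
    calc _ ≤ √(2 / c0 ^ 2) * √N2 * n + √(1 / c0) * √N1 * n + lam * (√K0 * √N0 * n) := by linarith
      _ = _ := by rw [hM]; ring
  obtain ⟨q, hq1, hq2⟩ := riesz_abs A r M pM hbound
  have hqm : MemLp (q : ℝ × ℝ → ℝ) 2 μQ := Lp.memLp q
  have hqM : Measurable (q : ℝ × ℝ → ℝ) := (Lp.stronglyMeasurable q).measurable
  set w : ℝ × ℝ → ℝ := Q.indicator q with hw
  have hwm : Measurable w := hqM.indicator hQm
  have hwL : MemLp w 2 := (memLp_indicator_iff_restrict hQm).2 hqm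
  have hw2 : ∫ z, w z ^ 2 = ‖q‖ ^ 2 := by
    have := toLp_norm_sq hqm
    rw [Lp.toLp_coeFn] at this
    rw [this]
    have e3 : ∫ z, (q : ℝ × ℝ → ℝ) z ^ 2 ∂μQ = ∫ z, Q.indicator (fun z => (q : ℝ × ℝ → ℝ) z ^ 2) z :=
      (integral_indicator hQm).symm
    rw [e3]
    congr 1; ext z
    by_cases hz : z ∈ Q <;> simp [hw, hz]
  set P : ℝ × ℝ → ℝ := fun z => f0 z + w z with hP
  have hPm : Measurable P := hf0.meas.add hwm
  have hPL : MemLp P 2 := hf0.memLp.add hwL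
  have zP : ∀ z, z ∉ Q → P z = 0 := fun z hz => by simp [hP, zf0 z hz, hw, hz]
  have key : ∀ u, BM u → (∀ z, z ∉ Q → u z = 0) →
      ∫ z, Aop h lam a b u z * P z = ∫ z, u z * (g z - g0 z) := by
    intro u hu hs
    have t1 : ∫ z, Aop h lam a b u z * w z = (∫ z, Dxx h u z * F2 z) + (∫ z, Dx h u z * F1 z)
        + lam * ∫ z, u z * F0 z := by
      have h1 := hq2 ⟨u, hu, hs⟩
      have h2 : inner ℝ q (A ⟨u, hu, hs⟩) = ∫ z in Q, q z * Aop h lam a b u z := by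
        have := toLp_inner hqm (mA ⟨u, hu, hs⟩)
        rw [Lp.toLp_coeFn] at this
        exact this
      rw [h2] at h1
      rw [← integral_indicator hQm] at h1
      refine Eq.trans ?_ h1
      congr 1; ext z
      by_cases hz : z ∈ Q <;> simp [hw, hz, mul_comm]
    have hAu := hAB u hu
    have t2 : ∫ z, Aop h lam a b u z * P z = (∫ z, Aop h lam a b u z * f0 z) +
        ∫ z, Aop h lam a b u z * w z := by
      rw [← integral_add (mul_int hAu.memLp hf0.memLp) (mul_int hAu.memLp hwL)]
      congr 1; ext z; simp only [hP]; ring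
    have j1 := ((hu.dt h).mul hf0).integrable
    have j2 := ((hu.mul hf0').integrable).const_mul lam
    have j3 := ((hu.dx h).mul hf1).integrable
    have j4 := ((hu.dxx h).mul hf2).integrable
    have t3 : ∫ z, Aop h lam a b u z * P z = (∫ z, Dt h u z * f0 z) - lam * (∫ z, u z * f0' z)
        + (∫ z, Dx h u z * f1 z) + ∫ z, Dxx h u z * f2 z := by
      rw [t2, t1, ← integral_const_mul, ← integral_const_mul, ← integral_sub' j1 j2,
        ← integral_add' (j1.sub j2) j3, ← integral_add' ((j1.sub j2).add j3) j4,
        ← integral_add' (i2 u hu) (i1 u hu), ← integral_add' ((i2 u hu).add (i1 u hu))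
          ((i0 u hu).const_mul lam), ← integral_add' (mul_int hAu.memLp hf0.memLp)
          (((i2 u hu).add (i1 u hu)).add ((i0 u hu).const_mul lam))]
      congr 1; ext z; simp only [Pi.sub_apply, Pi.add_apply, Aop, hF0, hF1, hF2]; ring
    have k1 := (hu.mul (hf0.dtS h)).integrable
    have k3 := (hu.mul (hf1.dxS h)).integrable
    have k4 := (hu.mul (hf2.dxx h)).integrable
    rw [t3, ibp_t hu hf0, ibp_x hu hf1, ibp_xx hu hf2, ← integral_const_mul, ← integral_sub' k1 j2,
      ← integral_add' (k1.sub j2) k3, ← integral_add' ((k1.sub j2).add k3) k4]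
    congr 1; ext z
    simp only [Pi.sub_apply, Pi.add_apply]
    rw [hid z]; ring
  refine ⟨fun z => max (P z) 0, hPm.max measurable_const, ?_, fun z => le_max_right _ _,
    fun z hz => by simp [zP z hz], ?_, ?_⟩
  · refine hPL.mono (hPm.max measurable_const).aestronglyMeasurable (Eventually.of_forall fun z => ?_)
    rw [Real.norm_eq_abs, Real.norm_eq_abs, abs_of_nonneg (le_max_right _ _)]
    exact max_le (le_abs_self _) (abs_nonneg _)
  · intro v hv hv0
    set u : ℝ × ℝ → ℝ := fun z => if 0 < P z then v z else 0 with hu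
    have hPs : MeasurableSet {z | 0 < P z} := measurableSet_lt measurable_const hPm
    have buu : BM u := by
      refine ⟨Measurable.ite hPs hv.meas measurable_const, ?_, ?_⟩
      · obtain ⟨D, hD⟩ := hv.bdd
        refine ⟨D, fun z => ?_⟩
        simp only [hu]; split_ifs
        · exact hD z
        · simpa using (abs_nonneg _).trans (hD z)
      · obtain ⟨R, hR⟩ := hv.supp
        refine ⟨R, fun z hz => hR z ?_⟩
        simp only [hu] at hz
        split_ifs at hz with h1
        · exact hz
        · exact absurd rfl hz
    have zu : ∀ z, z ∉ Q → u z = 0 := fun z hz => by simp [hu, zP z hz]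
    have hk := key u buu zu
    have hmaxL : MemLp (fun z => max (P z) 0) 2 := by
      refine hPL.mono (hPm.max measurable_const).aestronglyMeasurable (Eventually.of_forall fun z => ?_)
      rw [Real.norm_eq_abs, Real.norm_eq_abs, abs_of_nonneg (le_max_right _ _)]
      exact max_le (le_abs_self _) (abs_nonneg _)
    have m1 : ∫ z, Aop h lam a b u z * P z ≤ ∫ z, Aop h lam a b v z * max (P z) 0 :=
      integral_mono (mul_int (hAB u buu).memLp hPL) (mul_int (hAB v hv).memLp hmaxL)
        (fun z => kato_pt hh hhB ha1 hb1 hc0 hv0 (fun z => rfl) z)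
    have m2 : ∫ z, - (v z * g0 z) ≤ ∫ z, u z * (g z - g0 z) := by
      refine integral_mono (hv.mul hg0).integrable.neg (buu.mul (hg.sub hg0)).integrable (fun z => ?_)
      have u0 : 0 ≤ u z := by simp only [hu]; split_ifs; exacts [hv0 z, le_rfl]
      have u1 : u z ≤ v z := by simp only [hu]; split_ifs; exacts [le_rfl, hv0 z]
      have := mul_nonneg u0 (pg z)
      have := mul_le_mul_of_nonneg_right u1 (pg0 z)
      change - (v z * g0 z) ≤ u z * (g z - g0 z)
      linarith
    rw [integral_neg] at m2
    linarith
  · have hpt : ∀ z, (max (P z) 0 - f0 z) ^ 2 ≤ w z ^ 2 := by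
      intro z
      have h1 := pf0 z
      have h2 : P z = f0 z + w z := rfl
      apply sq_le_sq.2
      rcases le_total (P z) 0 with h | h
      · rw [max_eq_right h, zero_sub, abs_neg, abs_of_nonneg h1]
        have : w z ≤ - f0 z := by linarith
        rw [abs_of_nonpos (by linarith)]; linarith
      · rw [max_eq_left h, h2, add_sub_cancel_left]
    have hmaxL : MemLp (fun z => max (P z) 0) 2 := by
      refine hPL.mono (hPm.max measurable_const).aestronglyMeasurable (Eventually.of_forall fun z => ?_)
      rw [Real.norm_eq_abs, Real.norm_eq_abs, abs_of_nonneg (le_max_right _ _)]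
      exact max_le (le_abs_self _) (abs_nonneg _)
    have h1 : ∫ z, (max (P z) 0 - f0 z) ^ 2 ≤ ∫ z, w z ^ 2 :=
      integral_mono (sq_int (hmaxL.sub hf0.memLp)) (sq_int hwL) hpt
    have h2 : ‖q‖ ^ 2 ≤ M ^ 2 := pow_le_pow_left₀ (norm_nonneg _) hq1 2
    rw [hw2] at h1
    refine h1.trans (h2.trans ?_)
    have h3 : M ^ 2 ≤ 3 * ((√(2 / c0 ^ 2) * √N2) ^ 2 + (√(1 / c0) * √N1) ^ 2 + (lam * (√K0 * √N0)) ^ 2) := by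
      rw [hM]
      set x := √(2 / c0 ^ 2) * √N2
      set y := √(1 / c0) * √N1
      set z := lam * (√K0 * √N0)
      nlinarith [sq_nonneg (x - y), sq_nonneg (y - z), sq_nonneg (x - z)]
    refine h3.trans ?_
    rw [mul_pow, mul_pow, mul_pow, mul_pow, Real.sq_sqrt (by positivity), Real.sq_sqrt pN2,
      Real.sq_sqrt (by positivity), Real.sq_sqrt pN1, Real.sq_sqrt pK0, Real.sq_sqrt pN0]
    have c1 : 0 ≤ 2 / c0 ^ 2 := by positivity
    have c2 : 0 ≤ 1 / c0 := by positivity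
    have c3 : 0 ≤ lam ^ 2 * K0 := by positivity
    have : Kst c0 C B = 3 * (2 / c0 ^ 2 + 1 / c0 + lam ^ 2 * K0) := rfl
    rw [this]
    have := mul_nonneg c1 pN1
    have := mul_nonneg c1 pN0
    have := mul_nonneg c2 pN2
    have := mul_nonneg c2 pN0
    have := mul_nonneg c3 pN2
    have := mul_nonneg c3 pN1
    nlinarith

end

section

lemma weak_lim {H : Type*} [NormedAddCommGroup H] [InnerProductSpace ℝ H] [CompleteSpace H]
    (P : ℕ → H) (R : ℕ → ℝ) (R0 : ℝ) (hR : Tendsto R atTop (𝓝 R0)) (hP : ∀ j, ‖P j‖ ≤ R j) :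
    ∃ q : H, ‖q‖ ≤ R0 ∧ ∀ y : H, Tendsto (fun j => inner ℝ (P j) y) (hyperfilter ℕ)
      (𝓝 (inner ℝ q y)) := by
  have hR' : Tendsto R (hyperfilter ℕ) (𝓝 R0) := hR.mono_left Nat.hyperfilter_le_atTop
  obtain ⟨B, hB⟩ : ∃ B, ∀ j, R j ≤ B := by
    obtain ⟨B, hB⟩ := hR.bddAbove_range
    exact ⟨B, fun j => hB ⟨j, rfl⟩⟩
  have hlim : ∀ y : H, ∃ l : ℝ, Tendsto (fun j => inner ℝ (P j) y) (hyperfilter ℕ) (𝓝 l) := by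
    intro y
    have hc : IsCompact (Icc (-(B * ‖y‖)) (B * ‖y‖)) := isCompact_Icc
    have hmem : ∀ j, inner ℝ (P j) y ∈ Icc (-(B * ‖y‖)) (B * ‖y‖) := by
      intro j
      rw [mem_Icc, ← abs_le]
      exact (abs_real_inner_le_norm _ _).trans
        (mul_le_mul_of_nonneg_right ((hP j).trans (hB j)) (norm_nonneg _))
    obtain ⟨l, -, hl⟩ := hc.ultrafilter_le_nhds ((hyperfilter ℕ).map (fun j => inner ℝ (P j) y))
      (by
        rw [le_principal_iff]
        exact Ultrafilter.mem_map.2 (univ_mem' hmem))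
    exact ⟨l, hl⟩
  choose l hl using hlim
  have hlb : ∀ y, |l y| ≤ R0 * ‖y‖ := by
    intro y
    refine le_of_tendsto_of_tendsto ((hl y).abs) (hR'.mul_const ‖y‖) (Eventually.of_forall fun j => ?_)
    exact (abs_real_inner_le_norm _ _).trans (mul_le_mul_of_nonneg_right (hP j) (norm_nonneg _))
  have hR0 : 0 ≤ R0 := ge_of_tendsto' hR (fun j => (norm_nonneg _).trans (hP j))
  let f0 : H →ₗ[ℝ] ℝ :=
    { toFun := l
      map_add' := by
        intro x y
        refine tendsto_nhds_unique (hl (x + y)) ?_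
        simp_rw [inner_add_right]
        exact (hl x).add (hl y)
      map_smul' := by
        intro c x
        refine tendsto_nhds_unique (hl (c • x)) ?_
        simp_rw [inner_smul_right]
        exact (hl x).const_mul c }
  obtain ⟨q, hq1, hq2⟩ := riesz_abs (LinearMap.id : H →ₗ[ℝ] H) f0 R0 hR0 hlb
  refine ⟨q, hq1, fun y => ?_⟩
  have := hq2 y
  rw [LinearMap.id_apply] at this
  rw [this]
  exact hl y

lemma tendsto_toLp_iff {α ι : Type*} [MeasurableSpace α] {μ : Measure α} {l : Filter ι}
    {u : ι → α → ℝ} {U : α → ℝ} (hu : ∀ j, MemLp (u j) 2 μ) (hU : MemLp U 2 μ) :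
    Tendsto (fun j => (hu j).toLp (u j)) l (𝓝 (hU.toLp U)) ↔
      Tendsto (fun j => ∫ z, (u j z - U z) ^ 2 ∂μ) l (𝓝 0) := by
  rw [tendsto_iff_norm_sub_tendsto_zero]
  have : ∀ j, ∫ z, (u j z - U z) ^ 2 ∂μ = ‖(hu j).toLp (u j) - hU.toLp U‖ ^ 2 := by
    intro j
    rw [← MemLp.toLp_sub, toLp_norm_sq]
    rfl
  simp_rw [this]
  constructor
  · intro h; simpa using h.pow 2
  · intro h
    have := h.sqrt
    simpa [Real.sqrt_sq (norm_nonneg _)] using this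

lemma transl_cont {f : ℝ × ℝ → ℝ} (hf : MemLp f 2) (r : ℝ) (hr : 0 < r) :
    ∃ δ > 0, ∀ w : ℝ × ℝ, ‖w‖ ≤ δ → ∫ z, (f (z - w) - f z) ^ 2 ≤ r := by
  let g : ℝ × ℝ → C(ℝ × ℝ, ℝ × ℝ) := fun w => ⟨fun z => z - w, by fun_prop⟩
  have hg : Continuous g := by
    refine ContinuousMap.continuous_of_continuous_uncurry _ ?_
    change Continuous fun q : (ℝ × ℝ) × (ℝ × ℝ) => q.2 - q.1
    fun_prop
  have hm : ∀ w, MeasurePreserving (g w) volume volume := fun w =>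
    measurePreserving_sub_right volume w
  have h2 : (2 : ENNReal) ≠ ⊤ := by simp
  have hc := Continuous.compMeasurePreservingLp (f := fun _ : ℝ × ℝ => hf.toLp f)
    continuous_const hg hm h2
  have hm' : ∀ w : ℝ × ℝ, MemLp (fun z => f (z - w)) 2 := fun w =>
    hf.comp_measurePreserving (hm w)
  have e : ∀ w, Lp.compMeasurePreserving (g w) (hm w) (hf.toLp f) = (hm' w).toLp _ := by
    intro w
    rw [Lp.toLp_compMeasurePreserving]; rfl
  have ht : Tendsto (fun w => (hm' w).toLp _) (𝓝 0) (𝓝 (hf.toLp f)) := by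
    have := hc.tendsto 0
    simp_rw [e] at this
    convert this using 2
    congr 1; ext z; simp
  rw [tendsto_toLp_iff] at ht
  have := ht.eventually (gt_mem_nhds hr)
  obtain ⟨δ, hδ, H⟩ := Metric.eventually_nhds_iff.1 this
  refine ⟨δ / 2, by positivity, fun w hw => (H ?_).le⟩
  rw [dist_zero_right]; linarith

lemma conv_swap (k f : ℝ × ℝ → ℝ) (z : ℝ × ℝ) : ∫ w, k (z - w) * f w = ∫ w, k w * f (z - w) := by
  have := integral_sub_left_eq_self (fun w => k (z - w) * f w) (volume : Measure (ℝ × ℝ)) z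
  rw [← this]
  congr 1; ext w; simp

lemma conv_L2_aux {f k : ℝ × ℝ → ℝ} (hfm : Measurable f) (hf : MemLp f 2) (hk : BM k)
    (hk0 : ∀ w, 0 ≤ k w) (hk1 : ∫ w, k w = 1) {δ r : ℝ}
    (hδ : ∀ w : ℝ × ℝ, ‖w‖ ≤ δ → ∫ z, (f (z - w) - f z) ^ 2 ≤ r) (hs : ∀ w, k w ≠ 0 → ‖w‖ ≤ δ) :
    ∫ z, ((∫ w, k (z - w) * f w) - f z) ^ 2 ≤ r := by
  have hshift : ∀ z, MemLp (fun w => f (z - w)) 2 := fun z =>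
    hf.comp_measurePreserving (Measure.measurePreserving_sub_left volume z)
  have hsq : Integrable (fun z => f z ^ 2) := sq_int hf
  -- joint integrability
  have hJ : Integrable (fun q : (ℝ × ℝ) × (ℝ × ℝ) => k q.2 * (f (q.1 - q.2) - f q.1) ^ 2)
      (volume.prod volume) := by
    have j1 : Integrable (fun q : (ℝ × ℝ) × (ℝ × ℝ) => k q.2 * f (q.1 - q.2) ^ 2) (volume.prod volume) :=
      Integrable.convolution_integrand (ContinuousLinearMap.mul ℝ ℝ) hk.integrable hsq
    have j2 : Integrable (fun q : (ℝ × ℝ) × (ℝ × ℝ) => f q.1 ^ 2 * k q.2) (volume.prod volume) :=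
      hsq.mul_prod hk.integrable
    refine ((j1.const_mul 2).add (j2.const_mul 2)).mono' ?_ (Eventually.of_forall fun q => ?_)
    · refine Measurable.aestronglyMeasurable ?_
      have := hk.meas
      fun_prop
    · have h1 := hk0 q.2
      rw [Real.norm_eq_abs, abs_of_nonneg (by positivity)]
      simp only [Pi.add_apply]
      nlinarith [mul_nonneg h1 (sq_nonneg (f (q.1 - q.2) + f q.1))]
  have hpt : ∀ z, ((∫ w, k (z - w) * f w) - f z) ^ 2 ≤ ∫ w, k w * (f (z - w) - f z) ^ 2 := by
    intro z
    rw [conv_swap]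
    set s : ℝ × ℝ → ℝ := fun w => √(k w) with hsdef
    have hs2 : ∀ w, s w ^ 2 = k w := fun w => Real.sq_sqrt (hk0 w)
    have hsm : Measurable s := hk.meas.sqrt
    have hsb : ∃ C : ℝ, ∀ w, |s w| ≤ C := by
      obtain ⟨C, hC⟩ := hk.bdd
      refine ⟨√C, fun w => ?_⟩
      rw [abs_of_nonneg (Real.sqrt_nonneg _)]
      exact Real.sqrt_le_sqrt ((le_abs_self _).trans (hC w))
    have hsB : BM s := by
      refine ⟨hsm, hsb, ?_⟩
      obtain ⟨R, hR⟩ := hk.supp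
      refine ⟨R, fun w hw => hR w (fun h => hw ?_)⟩
      simp [hsdef, h]
    have hg : MemLp (fun w => s w * (f (z - w) - f z)) 2 := by
      have a1 : MemLp (fun w => s w * f (z - w)) 2 := by
        obtain ⟨C, hC⟩ := hsb
        refine ((hshift z).const_mul C).mono (hsm.mul (hfm.comp (by fun_prop))).aestronglyMeasurable
          (Eventually.of_forall fun w => ?_)
        rw [norm_mul, norm_mul]
        exact mul_le_mul_of_nonneg_right ((hC w).trans (le_abs_self _)) (norm_nonneg _)
      have a2 : MemLp (fun w => s w * f z) 2 := hsB.memLp.mul_const _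
      have := a1.sub a2
      refine this.congr_norm ?_ (Eventually.of_forall fun w => ?_)
      · exact (hsm.mul ((hfm.comp (by fun_prop)).sub_const _)).aestronglyMeasurable
      · simp only [Pi.sub_apply]; congr 1; ring
    have e : (∫ w, k w * f (z - w)) - f z = ∫ w, s w * (s w * (f (z - w) - f z)) := by
      have i1 : Integrable (fun w => k w * f (z - w)) := mul_int hk.memLp (hshift z)
      have i2 : Integrable (fun w => k w * f z) := hk.integrable.mul_const _
      have : f z = ∫ w, k w * f z := by rw [integral_mul_const, hk1, one_mul]
      nth_rewrite 1 [this]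
      rw [← integral_sub i1 i2]
      congr 1; ext w
      rw [← mul_assoc, ← sq, hs2]; ring
    have c := cs_int hsB.memLp hg
    rw [← e] at c
    have e1 : ∫ w, s w ^ 2 = 1 := by simp_rw [hs2, hk1]
    have e2 : ∫ w, (s w * (f (z - w) - f z)) ^ 2 = ∫ w, k w * (f (z - w) - f z) ^ 2 := by
      simp_rw [mul_pow, hs2]
    rw [e1, e2, Real.sqrt_one, one_mul] at c
    have hn : 0 ≤ ∫ w, k w * (f (z - w) - f z) ^ 2 :=
      integral_nonneg fun w => mul_nonneg (hk0 w) (sq_nonneg _)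
    rw [← sq_abs]
    calc _ ≤ (√(∫ w, k w * (f (z - w) - f z) ^ 2)) ^ 2 := by gcongr
      _ = _ := Real.sq_sqrt hn
  calc ∫ z, ((∫ w, k (z - w) * f w) - f z) ^ 2
      ≤ ∫ z, ∫ w, k w * (f (z - w) - f z) ^ 2 :=
        integral_mono_of_nonneg (Eventually.of_forall fun z => sq_nonneg _) hJ.integral_prod_left
          (Eventually.of_forall hpt)
    _ = ∫ w, ∫ z, k w * (f (z - w) - f z) ^ 2 := integral_integral_swap hJ
    _ ≤ ∫ w, k w * r := by
        refine integral_mono hJ.integral_prod_right (hk.integrable.mul_const _) (fun w => ?_)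
        change ∫ z, k w * (f (z - w) - f z) ^ 2 ≤ k w * r
        rw [integral_const_mul]
        by_cases hw : k w = 0
        · simp [hw]
        · exact mul_le_mul_of_nonneg_left (hδ w (hs w hw)) (hk0 w)
    _ = r := by rw [integral_mul_const, hk1, one_mul]

lemma conv_L2 {f : ℝ × ℝ → ℝ} (hfm : Measurable f) (hf : MemLp f 2) {k : ℕ → ℝ × ℝ → ℝ}
    (hk : ∀ j, BM (k j)) (hk0 : ∀ j w, 0 ≤ k j w) (hk1 : ∀ j, ∫ w, k j w = 1) {δ : ℕ → ℝ}
    (hδ : Tendsto δ atTop (𝓝 0)) (hs : ∀ j w, k j w ≠ 0 → ‖w‖ ≤ δ j) :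
    Tendsto (fun j => ∫ z, ((∫ w, k j (z - w) * f w) - f z) ^ 2) atTop (𝓝 0) := by
  rw [Metric.tendsto_atTop]
  intro r hr
  obtain ⟨d, hd, H⟩ := transl_cont hf (r / 2) (by positivity)
  obtain ⟨N, hN⟩ := eventually_atTop.1 (hδ.eventually (gt_mem_nhds hd))
  refine ⟨N, fun j hj => ?_⟩
  have := conv_L2_aux hfm hf (hk j) (hk0 j) (hk1 j) H (fun w hw => (hs j w hw).trans (hN j hj).le)
  rw [Real.dist_eq, sub_zero, abs_of_nonneg (integral_nonneg fun _ => sq_nonneg _)]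
  linarith

end

section

/-- a one-dimensional mollifier -/
structure Moll (l r : ℝ) (χ : ℝ → ℝ) : Prop where
  cont : Continuous χ
  nn : ∀ s, 0 ≤ χ s
  int : ∫ s, χ s = 1
  supp : ∀ s, χ s ≠ 0 → l ≤ s ∧ s ≤ r

lemma Moll.hcs {l r : ℝ} {χ : ℝ → ℝ} (h : Moll l r χ) : HasCompactSupport χ := by
  refine HasCompactSupport.intro (isCompact_Icc (a := l) (b := r)) (fun s hs => ?_)
  by_contra h0
  exact hs (h.supp s h0)

lemma Moll.integrable {l r : ℝ} {χ : ℝ → ℝ} (h : Moll l r χ) : Integrable χ :=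
  h.cont.integrable_of_hasCompactSupport h.hcs

lemma exists_moll {h : ℝ} (hh : 0 < h) : ∃ χ, Moll (-h) h χ := by
  let f : ContDiffBump (0 : ℝ) := ⟨h / 2, h, by positivity, by linarith⟩
  refine ⟨f.normed volume, f.continuous_normed, f.nonneg_normed, f.integral_normed, fun s hs => ?_⟩
  have : s ∈ Function.support (f.normed volume) := hs
  rw [f.support_normed_eq, Metric.mem_ball, dist_zero_right, Real.norm_eq_abs] at this
  exact abs_le.1 this.le

lemma moll_box {h l r : ℝ} (hh : 0 < h) {χ : ℝ → ℝ} (hχ : Moll l r χ) :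
    ∃ χ1, Moll l (r + h) χ1 ∧ ∀ s, HasDerivAt χ1 ((χ s - χ (s - h)) / h) s := by
  set χ1 : ℝ → ℝ := fun s => (∫ x in (s - h)..s, χ x) / h with hχ1
  have hd : ∀ s, HasDerivAt χ1 ((χ s - χ (s - h)) / h) s := by
    intro s
    have ii : ∀ a b, IntervalIntegrable χ volume a b := fun a b => hχ.cont.intervalIntegrable a b
    have e : χ1 = fun s => ((∫ x in (0:ℝ)..s, χ x) - ∫ x in (0:ℝ)..(s - h), χ x) / h := by
      ext s
      simp only [hχ1]
      rw [intervalIntegral.integral_interval_sub_left (ii _ _) (ii _ _)]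
    rw [e]
    have h1 : ∀ s, HasDerivAt (fun s => ∫ x in (0:ℝ)..s, χ x) (χ s) s := fun s =>
      intervalIntegral.integral_hasDerivAt_right (ii _ _)
        (hχ.cont.stronglyMeasurableAtFilter _ _) hχ.cont.continuousAt
    have h2 : HasDerivAt (fun s => ∫ x in (0:ℝ)..(s - h), χ x) (χ (s - h)) s := by
      have := HasDerivAt.comp_sub_const s h (h1 (s - h))
      exact this
    exact ((h1 s).sub h2).div_const h
  refine ⟨χ1, ⟨?_, ?_, ?_, ?_⟩, hd⟩
  · exact continuous_iff_continuousAt.2 fun s => (hd s).continuousAt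
  · intro s
    exact div_nonneg (intervalIntegral.integral_nonneg (by linarith) (fun _ _ => hχ.nn _)) hh.le
  · set f : ℝ → ℝ := (Ioc 0 h).indicator (fun _ => 1 / h) with hf
    have hfi : Integrable f := by
      rw [hf, integrable_indicator_iff measurableSet_Ioc]
      exact integrableOn_const (by simp)
    have hfi1 : ∫ x, f x = 1 := by
      rw [hf, integral_indicator measurableSet_Ioc]
      simp [hh.le]
      field_simp
    have e : ∀ s, χ1 s = convolution f χ (ContinuousLinearMap.mul ℝ ℝ) volume s := by
      intro s
      have e1 : ∫ x in (s - h)..s, χ x = ∫ x in (0:ℝ)..h, χ (s - x) := by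
        rw [intervalIntegral.integral_comp_sub_left]; simp
      simp only [hχ1, e1, convolution]
      rw [intervalIntegral.integral_of_le hh.le, ← integral_indicator measurableSet_Ioc,
        ← integral_div]
      congr 1; ext x
      by_cases hx : x ∈ Ioc 0 h <;> simp [hf, hx, div_eq_inv_mul]
    simp_rw [e]
    rw [integral_convolution _ hfi hχ.integrable]
    simp [hfi1, hχ.int]
  · intro s hs
    by_contra hc
    apply hs
    have : ∀ x ∈ Ioc (s - h) s, χ x = 0 ∨ x = s ∨ x = r := by
      intro x hx
      by_contra h0
      push Not at h0
      have := hχ.supp x h0.1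
      apply hc
      exact ⟨this.1.trans hx.2, by linarith [hx.1]⟩
    have h0 : ∫ x in (s - h)..s, χ x = 0 := by
      rw [intervalIntegral.integral_of_le (by linarith)]
      refine integral_eq_zero_of_ae ?_
      have : ∀ᵐ x ∂(volume.restrict (Ioc (s - h) s)), x ≠ s ∧ x ≠ r := by
        refine ae_restrict_of_ae ?_
        have a1 : ∀ᵐ x : ℝ, x ≠ s := by simp [ae_iff]
        have a2 : ∀ᵐ x : ℝ, x ≠ r := by simp [ae_iff]
        filter_upwards [a1, a2] with x h1 h2 using ⟨h1, h2⟩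
      filter_upwards [this, ae_restrict_mem measurableSet_Ioc] with x h1 h2
      rcases ‹∀ x ∈ Ioc (s - h) s, χ x = 0 ∨ x = s ∨ x = r› x h2 with h3 | h3 | h3
      · exact h3
      · exact absurd h3 h1.1
      · exact absurd h3 h1.2
    simp [hχ1, h0]

lemma Moll.mono {l r l' r' : ℝ} {χ : ℝ → ℝ} (h : Moll l r χ) (h1 : l' ≤ l) (h2 : r ≤ r') :
    Moll l' r' χ :=
  ⟨h.cont, h.nn, h.int, fun s hs => ⟨h1.trans (h.supp s hs).1, (h.supp s hs).2.trans h2⟩⟩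

/-- the family of kernels at scale `h` -/
structure Kers (h : ℝ) (η θ χ χ1 κ : ℝ → ℝ) : Prop where
  mη : Moll (-2 * h) (2 * h) η
  mθ : Moll (-2 * h) (2 * h) θ
  mχ : Moll (-2 * h) (2 * h) χ
  mχ1 : Moll (-2 * h) (2 * h) χ1
  mκ : Moll (-2 * h) (2 * h) κ
  dθ : ∀ s, HasDerivAt θ ((η s - η (s - h)) / h) s
  dκ : ∀ s, HasDerivAt κ ((χ1 s - χ1 (s - h)) / h) s
  ddκ : ∀ s, HasDerivAt (fun s => (χ1 s - χ1 (s - h)) / h)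
    ((χ (s + h) - 2 * χ s + χ (s - h)) / h ^ 2) s

lemma exists_kers {h : ℝ} (hh : 0 < h) : ∃ η θ χ χ1 κ, Kers h η θ χ χ1 κ := by
  obtain ⟨χ, hχ⟩ := exists_moll hh
  obtain ⟨θ, hθ, dθ⟩ := moll_box hh hχ
  set χ1 : ℝ → ℝ := fun s => θ (s + h) with hχ1
  have mχ1 : Moll (-h - h) h χ1 := by
    refine ⟨hθ.cont.comp (by fun_prop), fun s => hθ.nn _, ?_, fun s hs => ?_⟩
    · rw [hχ1, integral_add_right_eq_self (fun s => θ s) h]; exact hθ.int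
    · have := hθ.supp _ hs
      constructor <;> linarith [this.1, this.2]
  have dχ1 : ∀ s, HasDerivAt χ1 ((χ (s + h) - χ s) / h) s := by
    intro s
    have := HasDerivAt.comp_add_const s h (dθ (s + h))
    rw [add_sub_cancel_right] at this
    exact this
  obtain ⟨κ, hκ, dκ⟩ := moll_box hh mχ1
  refine ⟨χ, θ, χ, χ1, κ, hχ.mono (by linarith) (by linarith), hθ.mono (by linarith) (by linarith),
    hχ.mono (by linarith) (by linarith), mχ1.mono (by linarith) (by linarith),
    hκ.mono (by linarith) (by linarith), dθ, dκ, fun s => ?_⟩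
  have h1 := dχ1 s
  have h2 := HasDerivAt.comp_sub_const s h (dχ1 (s - h))
  rw [sub_add_cancel] at h2
  have := (h1.sub h2).div_const h
  have e : (χ (s + h) - 2 * χ s + χ (s - h)) / h ^ 2
      = ((χ (s + h) - χ s) / h - (χ s - χ (s - h)) / h) / h := by field_simp; ring
  rw [e]; exact this

lemma isCb12_of_global {T c1 c2 : ℝ} (hc : c1 < c2) {u ut ux uxx : ℝ → ℝ → ℝ}
    (hu : Continuous fun p : ℝ × ℝ => u p.1 p.2) (hut : Continuous fun p : ℝ × ℝ => ut p.1 p.2)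
    (hux : Continuous fun p : ℝ × ℝ => ux p.1 p.2) (huxx : Continuous fun p : ℝ × ℝ => uxx p.1 p.2)
    (h1 : ∀ t x, HasDerivAt (fun s => u s x) (ut t x) t)
    (h2 : ∀ t x, HasDerivAt (fun y => u t y) (ux t x) x)
    (h3 : ∀ t x, HasDerivAt (fun y => ux t y) (uxx t x) x) : IsCb12 T (Ioo c1 c2) u ut ux uxx := by
  refine ⟨hu.continuousOn, hut.continuousOn, hux.continuousOn, huxx.continuousOn,
    fun t _ x _ => (h1 t x).hasDerivWithinAt, fun t _ x _ => (h2 t x).hasDerivWithinAt,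
    fun t _ x _ => (h3 t x).hasDerivWithinAt, ?_⟩
  rw [closure_Ioo hc.ne]
  have hcp : IsCompact (Icc (0:ℝ) T ×ˢ Icc c1 c2) := isCompact_Icc.prod isCompact_Icc
  obtain ⟨C1, hC1⟩ := hcp.exists_bound_of_continuousOn hu.continuousOn
  obtain ⟨C2, hC2⟩ := hcp.exists_bound_of_continuousOn hut.continuousOn
  obtain ⟨C3, hC3⟩ := hcp.exists_bound_of_continuousOn hux.continuousOn
  obtain ⟨C4, hC4⟩ := hcp.exists_bound_of_continuousOn huxx.continuousOn
  refine ⟨max (max C1 C2) (max C3 C4), fun t ht x hx => ⟨?_, ?_, ?_, ?_⟩⟩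
  · exact (hC1 (t, x) ⟨ht, hx⟩).trans ((le_max_left _ _).trans (le_max_left _ _))
  · exact (hC2 (t, x) ⟨ht, hx⟩).trans ((le_max_right _ _).trans (le_max_left _ _))
  · exact (hC3 (t, x) ⟨ht, hx⟩).trans ((le_max_left _ _).trans (le_max_right _ _))
  · exact (hC4 (t, x) ⟨ht, hx⟩).trans ((le_max_right _ _).trans (le_max_right _ _))

/-- tensor kernel -/
def tk (η κ : ℝ → ℝ) (w : ℝ × ℝ) : ℝ := η w.1 * κ w.2

lemma tk_supp {h : ℝ} {η κ : ℝ → ℝ} (hη : Moll (-2 * h) (2 * h) η) (hκ : Moll (-2 * h) (2 * h) κ)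
    (w : ℝ × ℝ) (hw : tk η κ w ≠ 0) : ‖w‖ ≤ 2 * h := by
  have h1 := hη.supp _ (left_ne_zero_of_mul hw)
  have h2 := hκ.supp _ (right_ne_zero_of_mul hw)
  rw [Prod.norm_def, max_le_iff, Real.norm_eq_abs, Real.norm_eq_abs, abs_le, abs_le]
  refine ⟨⟨by linarith, h1.2⟩, ⟨by linarith, h2.2⟩⟩

lemma tk_cont {h : ℝ} {η κ : ℝ → ℝ} (hη : Moll (-2 * h) (2 * h) η) (hκ : Moll (-2 * h) (2 * h) κ) :
    Continuous (tk η κ) := (hη.cont.comp continuous_fst).mul (hκ.cont.comp continuous_snd)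

lemma tk_BM {h : ℝ} {η κ : ℝ → ℝ} (hη : Moll (-2 * h) (2 * h) η) (hκ : Moll (-2 * h) (2 * h) κ) :
    BM (tk η κ) := by
  refine ⟨(tk_cont hη hκ).measurable, ?_, ⟨_, tk_supp hη hκ⟩⟩
  have : HasCompactSupport (tk η κ) := by
    refine HasCompactSupport.intro (isCompact_closedBall 0 (2 * h)) (fun w hw => ?_)
    by_contra h0
    exact hw (by simpa using tk_supp hη hκ w h0)
  obtain ⟨C, hC⟩ := (tk_cont hη hκ).bounded_above_of_compact_support this
  exact ⟨C, hC⟩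

lemma tk_nn {h : ℝ} {η κ : ℝ → ℝ} (hη : Moll (-2 * h) (2 * h) η) (hκ : Moll (-2 * h) (2 * h) κ)
    (w : ℝ × ℝ) : 0 ≤ tk η κ w := mul_nonneg (hη.nn _) (hκ.nn _)

lemma tk_int {h : ℝ} {η κ : ℝ → ℝ} (hη : Moll (-2 * h) (2 * h) η) (hκ : Moll (-2 * h) (2 * h) κ) :
    ∫ w, tk η κ w = 1 := by
  have := integral_prod_mul (μ := (volume : Measure ℝ)) (ν := (volume : Measure ℝ)) η κ
  rw [hη.int, hκ.int, mul_one] at this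
  exact this

/-- enlarged box -/
def Qe (T c1 c2 e : ℝ) : Set (ℝ × ℝ) := Icc (-e) (T + e) ×ˢ Icc (c1 - e) (c2 + e)

lemma conv_BM {T c1 c2 r : ℝ} {k f : ℝ × ℝ → ℝ} (hk : BM k) (hs : ∀ w, k w ≠ 0 → ‖w‖ ≤ r)
    {N : Measure (ℝ × ℝ)} [SFinite N] (hfm : Measurable f) (hf : Integrable f N)
    (hQ : ∀ᵐ w ∂N, w ∈ Icc 0 T ×ˢ Icc c1 c2 ∨ f w = 0) :
    BM (fun z => ∫ w, k (z - w) * f w ∂N) ∧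
      ∀ z, z ∉ Qe T c1 c2 r → ∫ w, k (z - w) * f w ∂N = 0 := by
  have hz : ∀ z, z ∉ Qe T c1 c2 r → ∫ w, k (z - w) * f w ∂N = 0 := by
    intro z hz
    refine integral_eq_zero_of_ae ?_
    filter_upwards [hQ] with w hw
    rcases hw with hw | hw
    · have : k (z - w) = 0 := by
        by_contra h0
        have h1 := hs _ h0
        rw [Prod.norm_def, max_le_iff, Real.norm_eq_abs, Real.norm_eq_abs, abs_le, abs_le] at h1
        simp only [Prod.fst_sub, Prod.snd_sub] at h1
        obtain ⟨⟨a1, a2⟩, ⟨a3, a4⟩⟩ := hw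
        exact hz ⟨⟨by linarith, by linarith⟩, ⟨by linarith, by linarith⟩⟩
      simp [this]
    · simp [hw]
  refine ⟨⟨?_, ?_, ?_⟩, hz⟩
  · have hkm := hk.meas
    have : StronglyMeasurable (fun q : (ℝ × ℝ) × (ℝ × ℝ) => k (q.1 - q.2) * f q.2) :=
      (show Measurable _ by fun_prop).stronglyMeasurable
    exact (this.integral_prod_right' (ν := N)).measurable
  · obtain ⟨C, hC⟩ := hk.bdd
    refine ⟨∫ w, C * |f w| ∂N, fun z => ?_⟩
    refine (norm_integral_le_integral_norm (fun w => k (z - w) * f w)).trans ?_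
    refine integral_mono_of_nonneg (Eventually.of_forall fun _ => norm_nonneg _)
      (hf.abs.const_mul C) (Eventually.of_forall fun w => ?_)
    simp only [norm_mul, Real.norm_eq_abs]
    exact mul_le_mul_of_nonneg_right (hC _) (abs_nonneg _)
  · have hb : Bornology.IsBounded (Qe T c1 c2 r) :=
      ((Metric.isBounded_Icc _ _).prod (Metric.isBounded_Icc _ _))
    obtain ⟨R, hR⟩ := hb.exists_norm_le
    refine ⟨R, fun z h0 => hR z ?_⟩
    by_contra h1
    exact h0 (hz z h1)

end

section

/-- discounted Fokker-Planck constraint -/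
def FPd (T c1 c2 lam : ℝ) (N μ : Measure (ℝ × ℝ)) (p a b : ℝ × ℝ → ℝ) : Prop :=
  ∀ u ut ux uxx : ℝ → ℝ → ℝ, IsCb12 T (Ioo c1 c2) u ut ux uxx →
    ∫ z, u z.1 z.2 ∂μ = (∫ z, u z.1 z.2 ∂N) +
      ∫ z, (ut z.1 z.2 - lam * u z.1 z.2 + b z * ux z.1 z.2 + a z * uxx z.1 z.2) * p z

/-- convolution -/
def cv (k f : ℝ × ℝ → ℝ) (z : ℝ × ℝ) : ℝ := ∫ w, k (z - w) * f w

lemma BM.cv_integrable {k f : ℝ × ℝ → ℝ} (hk : BM k) {N : Measure (ℝ × ℝ)} (hf : Integrable f N)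
    (z : ℝ × ℝ) : Integrable (fun w => k (z - w) * f w) N := by
  obtain ⟨C, hC⟩ := hk.bdd
  refine hf.bdd_mul (c := C) ?_ (Eventually.of_forall fun w => hC _)
  exact (hk.meas.comp (measurable_const.sub measurable_id)).aestronglyMeasurable

lemma smooth_id {T c1 c2 lam h : ℝ} (hc : c1 < c2) (hh : 0 < h) {N μ : Measure (ℝ × ℝ)}
    {p a b : ℝ × ℝ → ℝ} (hp : Integrable p) (hap : Integrable (fun z => a z * p z))
    (hbp : Integrable (fun z => b z * p z)) (hFP : FPd T c1 c2 lam N μ p a b)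
    {η θ χ χ1 κ : ℝ → ℝ} (K : Kers h η θ χ χ1 κ) (z : ℝ × ℝ) :
    (∫ w, tk θ κ (z - w) * 1 ∂μ) = (∫ w, tk θ κ (z - w) * 1 ∂N) + DtS h (cv (tk η κ) p) z
      - lam * cv (tk θ κ) p z + DxS h (cv (tk θ χ1) (fun z => b z * p z)) z
      + Dxx h (cv (tk θ χ) (fun z => a z * p z)) z := by
  have := K.mη.cont
  have := K.mθ.cont
  have := K.mχ.cont
  have := K.mχ1.cont
  have := K.mκ.cont
  have key := hFP (fun t x => θ (z.1 - t) * κ (z.2 - x))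
    (fun t x => (η (z.1 - h - t) - η (z.1 - t)) / h * κ (z.2 - x))
    (fun t x => θ (z.1 - t) * ((χ1 (z.2 - h - x) - χ1 (z.2 - x)) / h))
    (fun t x => θ (z.1 - t) * ((χ (z.2 + h - x) - 2 * χ (z.2 - x) + χ (z.2 - h - x)) / h ^ 2)) ?_
  · simp only [tk, Prod.fst_sub, Prod.snd_sub, mul_one]
    rw [key, add_sub_assoc, add_assoc, add_assoc]
    congr 1
    have i1 := (tk_BM K.mη K.mκ).cv_integrable hp
    have i2 := (tk_BM K.mθ K.mκ).cv_integrable hp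
    have i3 := (tk_BM K.mθ K.mχ1).cv_integrable hbp
    have i4 := (tk_BM K.mθ K.mχ).cv_integrable hap
    have e1 : DtS h (cv (tk η κ) p) z =
        ∫ w, (tk η κ (z - (h, 0) - w) * p w - tk η κ (z - w) * p w) / h := by
      rw [integral_div, integral_sub (i1 _) (i1 _)]; rfl
    have e3 : DxS h (cv (tk θ χ1) (fun z => b z * p z)) z =
        ∫ w, (tk θ χ1 (z - (0, h) - w) * (b w * p w) - tk θ χ1 (z - w) * (b w * p w)) / h := by
      rw [integral_div, integral_sub (i3 _) (i3 _)]; rfl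
    have e4 : Dxx h (cv (tk θ χ) (fun z => a z * p z)) z =
        ∫ w, (tk θ χ (z + (0, h) - w) * (a w * p w) - 2 * (tk θ χ (z - w) * (a w * p w))
          + tk θ χ (z - (0, h) - w) * (a w * p w)) / h ^ 2 := by
      have := integral_add' (((i4 (z + (0, h))).sub ((i4 z).const_mul 2))) (i4 (z - (0, h)))
      rw [integral_sub' (i4 _) ((i4 _).const_mul 2), integral_const_mul] at this
      rw [integral_div]
      unfold Dxx cv
      rw [← this]; rfl
    have e2 : lam * cv (tk θ κ) p z = ∫ w, lam * (tk θ κ (z - w) * p w) := by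
      rw [integral_const_mul]; rfl
    have I1 := ((i1 (z - (h, 0))).sub (i1 z)).div_const h
    have I2 := (i2 z).const_mul lam
    have I3 := ((i3 (z - (0, h))).sub (i3 z)).div_const h
    have I4 := ((((i4 (z + (0, h))).sub ((i4 z).const_mul 2))).add (i4 (z - (0, h)))).div_const (h ^ 2)
    have E := integral_add' (I1.sub I2) (I3.add I4)
    rw [integral_sub' I1 I2, integral_add' I3 I4] at E
    rw [e1, e2, e3, e4]
    refine Eq.trans ?_ E
    · congr 1; ext w
      simp only [tk, Pi.add_apply, Pi.sub_apply, Prod.fst_sub, Prod.snd_sub, Prod.fst_add, Prod.snd_add, sub_zero, add_zero]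
      ring
  · refine isCb12_of_global hc (by fun_prop) (by fun_prop) (by fun_prop) (by fun_prop) ?_ ?_ ?_
    · intro t x
      have h1 := HasDerivAt.comp_const_sub z.1 t (K.dθ (z.1 - t))
      have := h1.mul_const (κ (z.2 - x))
      refine this.congr_deriv ?_
      rw [sub_right_comm]; ring
    · intro t x
      have h1 := HasDerivAt.comp_const_sub z.2 x (K.dκ (z.2 - x))
      have := h1.const_mul (θ (z.1 - t))
      refine this.congr_deriv ?_
      rw [sub_right_comm]; ring
    · intro t x
      have h1 := (HasDerivAt.comp_const_sub z.2 x (K.ddκ (z.2 - x))).neg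
      have := h1.const_mul (θ (z.1 - t))
      refine (this.congr_deriv ?_).congr_of_eventuallyEq (Eventually.of_forall fun y => ?_)
      · rw [sub_right_comm z.2 x h, sub_add_eq_add_sub]; ring
      · simp only [Pi.neg_apply]
        rw [sub_right_comm]; ring

lemma L2c_sub {α ι : Type*} [MeasurableSpace α] {μ : Measure α} {l : Filter ι}
    {u v : ι → α → ℝ} {U V : α → ℝ} (hu : ∀ j, MemLp (u j) 2 μ) (hU : MemLp U 2 μ)
    (hv : ∀ j, MemLp (v j) 2 μ) (hV : MemLp V 2 μ)
    (h1 : Tendsto (fun j => ∫ z, (u j z - U z) ^ 2 ∂μ) l (𝓝 0))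
    (h2 : Tendsto (fun j => ∫ z, (v j z - V z) ^ 2 ∂μ) l (𝓝 0)) :
    Tendsto (fun j => ∫ z, ((u j z - v j z) - (U z - V z)) ^ 2 ∂μ) l (𝓝 0) := by
  have e1 := (tendsto_toLp_iff hu hU).2 h1
  have e2 := (tendsto_toLp_iff hv hV).2 h2
  have := e1.sub e2
  simp_rw [← MemLp.toLp_sub] at this
  exact (tendsto_toLp_iff (fun j => (hu j).sub (hv j)) (hU.sub hV)).1 this

lemma L2c_sq {α ι : Type*} [MeasurableSpace α] {μ : Measure α} {l : Filter ι}
    {u : ι → α → ℝ} {U : α → ℝ} (hu : ∀ j, MemLp (u j) 2 μ) (hU : MemLp U 2 μ)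
    (h1 : Tendsto (fun j => ∫ z, (u j z - U z) ^ 2 ∂μ) l (𝓝 0)) :
    Tendsto (fun j => ∫ z, (u j z) ^ 2 ∂μ) l (𝓝 (∫ z, U z ^ 2 ∂μ)) := by
  have e1 := ((tendsto_toLp_iff hu hU).2 h1).norm.pow 2
  simpa only [toLp_norm_sq] using e1

lemma MemLp.bmul {α : Type*} [MeasurableSpace α] {μ : Measure α} {a u : α → ℝ} (hu : MemLp u 2 μ)
    (ha : Measurable a) {C : ℝ} (hC : ∀ z, |a z| ≤ C) : MemLp (fun z => a z * u z) 2 μ := by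
  refine MemLp.of_le_mul (c := C) hu (ha.aestronglyMeasurable.mul hu.1)
    (Eventually.of_forall fun z => ?_)
  rw [norm_mul]
  exact mul_le_mul_of_nonneg_right (hC z) (norm_nonneg _)

lemma L2c_bmul {α ι : Type*} [MeasurableSpace α] {μ : Measure α} {l : Filter ι}
    {u : ι → α → ℝ} {U a : α → ℝ} (hu : ∀ j, MemLp (u j) 2 μ) (hU : MemLp U 2 μ)
    (ha : Measurable a) {C : ℝ} (hC : ∀ z, |a z| ≤ C)
    (h1 : Tendsto (fun j => ∫ z, (u j z - U z) ^ 2 ∂μ) l (𝓝 0)) :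
    Tendsto (fun j => ∫ z, (a z * u j z - a z * U z) ^ 2 ∂μ) l (𝓝 0) := by
  have h2 := h1.const_mul (C ^ 2)
  rw [mul_zero] at h2
  refine squeeze_zero (fun j => integral_nonneg fun _ => sq_nonneg _) (fun j => ?_) h2
  rw [← integral_const_mul]
  refine integral_mono_of_nonneg (Eventually.of_forall fun _ => sq_nonneg _)
    ((sq_int ((hu j).sub hU)).const_mul _) (Eventually.of_forall fun z => ?_)
  simp only [Pi.sub_apply]
  rw [← mul_sub, mul_pow]
  refine mul_le_mul_of_nonneg_right ?_ (sq_nonneg _)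
  rw [← sq_abs]
  exact pow_le_pow_left₀ (abs_nonneg _) (hC z) 2

/-- data of the discrete approximations -/
structure Approx (T c1 c2 c0 B : ℝ) (N : Measure (ℝ × ℝ)) (a b p : ℝ × ℝ → ℝ) (R0 : ℝ)
    (h : ℕ → ℝ) (k P f0 : ℕ → ℝ × ℝ → ℝ) (R : ℕ → ℝ) : Prop where
  hpos : ∀ j, 0 < h j
  hlim : Tendsto h atTop (𝓝 0)
  kBM : ∀ j, BM (k j)
  knn : ∀ j w, 0 ≤ k j w
  kint : ∀ j, ∫ w, k j w = 1
  ksupp : ∀ j w, k j w ≠ 0 → ‖w‖ ≤ 2 * h j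
  Pm : ∀ j, Measurable (P j)
  PL : ∀ j, MemLp (P j) 2
  Pnn : ∀ j z, 0 ≤ P j z
  Psupp : ∀ j z, z ∉ Qe T c1 c2 (2 * h j) → P j z = 0
  pos : ∀ j v, BM v → (∀ z, 0 ≤ v z) →
    0 ≤ (∫ z, Aop (h j) (B ^ 2 / c0 + 1) a b v z * P j z) + ∫ z, v z * ∫ w, k j (z - w) * 1 ∂N
  fL : ∀ j, MemLp (f0 j) 2
  flim : Tendsto (fun j => ∫ z, (f0 j z - p z) ^ 2) atTop (𝓝 0)
  Rlim : Tendsto R atTop (𝓝 R0)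
  est : ∀ j, ∫ z, (P j z - f0 j z) ^ 2 ≤ R j

lemma exists_approx {T c1 c2 c0 C B : ℝ} (hc : c1 < c2) (hc0 : 0 < c0) {N μ : Measure (ℝ × ℝ)}
    [IsFiniteMeasure N] [IsFiniteMeasure μ] (hN : N (Icc 0 T ×ˢ Icc c1 c2)ᶜ = 0)
    (hμ : μ (Icc 0 T ×ˢ Icc c1 c2)ᶜ = 0)
    {p a b a' b' : ℝ × ℝ → ℝ} (hpm : Measurable p) (hpL : MemLp p 2) (hp0 : ∀ z, 0 ≤ p z)
    (hpQ : ∀ z, z ∉ Icc 0 T ×ˢ Icc c1 c2 → p z = 0)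
    (ha : Measurable a) (hb : Measurable b) (ha' : Measurable a') (hb' : Measurable b')
    (haC : ∀ z, |a z| ≤ C) (hbB : ∀ z, |b z| ≤ B)
    (ha1 : ∀ z, c0 ≤ a' z) (ha2 : ∀ z, a' z ≤ C) (hb1 : ∀ z, |b' z| ≤ B)
    (hFP : FPd T c1 c2 (B ^ 2 / c0 + 1) N μ p a b) :
    ∃ h k P f0 R, Approx T c1 c2 c0 B N a' b' p
      (Kst c0 C B * ((∫ z, ((a z - a' z) * p z) ^ 2) + ∫ z, ((b z - b' z) * p z) ^ 2))
      h k P f0 R := by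
  have hB : 0 ≤ B := (abs_nonneg _).trans (hbB 0)
  set h : ℕ → ℝ := fun j => c0 / (B + 1) / ((j : ℝ) + 1) with hh
  have hpos : ∀ j, 0 < h j := fun j => by positivity
  have hlim : Tendsto h atTop (𝓝 0) := by
    have := (tendsto_one_div_add_atTop_nhds_zero_nat (𝕜 := ℝ)).const_mul (c0 / (B + 1))
    simpa [hh, div_eq_mul_inv] using this
  have hhB : ∀ j, h j * B ≤ c0 := by
    intro j
    have h1 : h j ≤ c0 / (B + 1) := div_le_self (by positivity) (by linarith [Nat.cast_nonneg (α := ℝ) j])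
    have h2 : c0 / (B + 1) * (B + 1) = c0 := by field_simp
    nlinarith [hpos j]
  have hlim2 : Tendsto (fun j => 2 * h j) atTop (𝓝 0) := by simpa using hlim.const_mul 2
  choose η θ χ χ1 κ K using fun j => exists_kers (hpos j)
  have hpI : Integrable p := by
    have hf : volume (Icc (0:ℝ) T ×ˢ Icc c1 c2) ≠ ⊤ :=
      ((isCompact_Icc.prod isCompact_Icc).measure_lt_top).ne
    have h1 : IntegrableOn p (Icc (0:ℝ) T ×ˢ Icc c1 c2) := by
      haveI : IsFiniteMeasure (volume.restrict (Icc (0:ℝ) T ×ˢ Icc c1 c2)) :=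
        ⟨by simpa using hf.lt_top⟩
      exact (hpL.restrict _).integrable (by norm_num)
    refine h1.integrable_of_forall_notMem_eq_zero hpQ
  have hap : Integrable (fun z => a z * p z) :=
    hpI.bdd_mul (c := C) ha.aestronglyMeasurable (Eventually.of_forall haC)
  have hbp : Integrable (fun z => b z * p z) :=
    hpI.bdd_mul (c := B) hb.aestronglyMeasurable (Eventually.of_forall hbB)
  have hapL : MemLp (fun z => a z * p z) 2 := MemLp.bmul hpL ha haC
  have hbpL : MemLp (fun z => b z * p z) 2 := MemLp.bmul hpL hb hbB
  have hC' : ∀ z, |a' z| ≤ C := fun z => abs_le.2 ⟨by linarith [ha1 z, ha2 z], ha2 z⟩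
  have qb : ∀ (f : ℝ × ℝ → ℝ), (∀ z, z ∉ Icc 0 T ×ˢ Icc c1 c2 → f z = 0) →
      ∀ᵐ w, w ∈ Icc 0 T ×ˢ Icc c1 c2 ∨ f w = 0 := fun f hf => Eventually.of_forall fun w => by
    by_cases hw : w ∈ Icc 0 T ×ˢ Icc c1 c2
    · exact Or.inl hw
    · exact Or.inr (hf w hw)
  have F0 := fun j => conv_BM (T := T) (c1 := c1) (c2 := c2) (tk_BM (K j).mη (K j).mκ)
    (tk_supp (K j).mη (K j).mκ) hpm hpI (qb p hpQ)
  have F0' := fun j => conv_BM (T := T) (c1 := c1) (c2 := c2) (tk_BM (K j).mθ (K j).mκ)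
    (tk_supp (K j).mθ (K j).mκ) hpm hpI (qb p hpQ)
  have F1 := fun j => conv_BM (T := T) (c1 := c1) (c2 := c2) (tk_BM (K j).mθ (K j).mχ1)
    (tk_supp (K j).mθ (K j).mχ1) (hb.mul hpm) hbp (qb _ fun z hz => by simp [hpQ z hz])
  have F2 := fun j => conv_BM (T := T) (c1 := c1) (c2 := c2) (tk_BM (K j).mθ (K j).mχ)
    (tk_supp (K j).mθ (K j).mχ) (ha.mul hpm) hap (qb _ fun z hz => by simp [hpQ z hz])
  have G := fun j => conv_BM (T := T) (c1 := c1) (c2 := c2) (tk_BM (K j).mθ (K j).mκ)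
    (tk_supp (K j).mθ (K j).mκ) (measurable_const (a := (1:ℝ))) (integrable_const (μ := μ) (1:ℝ))
    ((measure_eq_zero_iff_ae_notMem.1 hμ).mono fun w hw => Or.inl (by simpa using hw))
  have G0 := fun j => conv_BM (T := T) (c1 := c1) (c2 := c2) (tk_BM (K j).mθ (K j).mκ)
    (tk_supp (K j).mθ (K j).mκ) (measurable_const (a := (1:ℝ))) (integrable_const (μ := N) (1:ℝ))
    ((measure_eq_zero_iff_ae_notMem.1 hN).mono fun w hw => Or.inl (by simpa using hw))
  have hst := fun j => discrete_step (hpos j) hc0 (hhB j) measurableSet_Icc measurableSet_Icc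
    (It := Icc (-(2 * h j)) (T + 2 * h j)) (Ix := Icc (c1 - 2 * h j) (c2 + 2 * h j))
    (((Metric.isBounded_Icc _ _).prod (Metric.isBounded_Icc _ _)).exists_norm_le)
    ha' hb' ha1 ha2 hb1 (F0 j).1 (F0' j).1 (F1 j).1 (F2 j).1 (G j).1 (G0 j).1
    (F0 j).2 (F0' j).2 (F1 j).2 (F2 j).2
    (fun z => integral_nonneg fun w => mul_nonneg (tk_nn (K j).mη (K j).mκ _) (hp0 w))
    (fun z => integral_nonneg fun w => mul_nonneg (tk_nn (K j).mθ (K j).mκ _) zero_le_one)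
    (fun z => integral_nonneg fun w => mul_nonneg (tk_nn (K j).mθ (K j).mκ _) zero_le_one)
    (fun z => smooth_id hc (hpos j) hpI hap hbp hFP (K j) z)
  choose P hP1 hP2 hP3 hP4 hP5 hP6 using hst
  have c_f0 := conv_L2 hpm hpL (fun j => tk_BM (K j).mη (K j).mκ) (fun j => tk_nn (K j).mη (K j).mκ)
    (fun j => tk_int (K j).mη (K j).mκ) hlim2 (fun j => tk_supp (K j).mη (K j).mκ)
  have c_f0' := conv_L2 hpm hpL (fun j => tk_BM (K j).mθ (K j).mκ) (fun j => tk_nn (K j).mθ (K j).mκ)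
    (fun j => tk_int (K j).mθ (K j).mκ) hlim2 (fun j => tk_supp (K j).mθ (K j).mκ)
  have c_f1 := conv_L2 (hb.mul hpm) hbpL (fun j => tk_BM (K j).mθ (K j).mχ1)
    (fun j => tk_nn (K j).mθ (K j).mχ1)
    (fun j => tk_int (K j).mθ (K j).mχ1) hlim2 (fun j => tk_supp (K j).mθ (K j).mχ1)
  have c_f2 := conv_L2 (ha.mul hpm) hapL (fun j => tk_BM (K j).mθ (K j).mχ)
    (fun j => tk_nn (K j).mθ (K j).mχ)
    (fun j => tk_int (K j).mθ (K j).mχ) hlim2 (fun j => tk_supp (K j).mθ (K j).mχ)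
  refine ⟨h, fun j => tk (θ j) (κ j), P, fun j => cv (tk (η j) (κ j)) p, _, hpos, hlim,
    fun j => tk_BM (K j).mθ (K j).mκ, fun j => tk_nn (K j).mθ (K j).mκ,
    fun j => tk_int (K j).mθ (K j).mκ, fun j => tk_supp (K j).mθ (K j).mκ, hP1, hP2, hP3, hP4, hP5,
    fun j => (F0 j).1.memLp, c_f0, ?_, hP6⟩
  have L0 := fun j => (F0 j).1.memLp
  have L0' := fun j => (F0' j).1.memLp
  have L1 := fun j => (F1 j).1.memLp
  have L2 := fun j => (F2 j).1.memLp
  have t1 := L2c_sq (fun j => (L2 j).sub (MemLp.bmul (L0 j) ha' hC')) (hapL.sub (MemLp.bmul hpL ha' hC'))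
    (L2c_sub L2 hapL (fun j => MemLp.bmul (L0 j) ha' hC') (MemLp.bmul hpL ha' hC') c_f2
      (L2c_bmul L0 hpL ha' hC' c_f0))
  have t2 := L2c_sq (fun j => (L1 j).sub (MemLp.bmul (L0 j) hb' hb1)) (hbpL.sub (MemLp.bmul hpL hb' hb1))
    (L2c_sub L1 hbpL (fun j => MemLp.bmul (L0 j) hb' hb1) (MemLp.bmul hpL hb' hb1) c_f1
      (L2c_bmul L0 hpL hb' hb1 c_f0))
  have t3 := L2c_sq (fun j => (L0 j).sub (L0' j)) (hpL.sub hpL) (L2c_sub L0 hpL L0' hpL c_f0 c_f0')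
  have := ((t1.add t2).add t3).const_mul (Kst c0 C B)
  convert this using 2
  all_goals simp [sub_mul]

end

section

lemma Qe_mono {T c1 c2 e e' : ℝ} (h : e ≤ e') : Qe T c1 c2 e ⊆ Qe T c1 c2 e' := by
  rintro z ⟨⟨h1, h2⟩, h3, h4⟩
  exact ⟨⟨by linarith, by linarith⟩, by linarith, by linarith⟩

lemma Qe_zero (T c1 c2 : ℝ) : Qe T c1 c2 0 = Icc 0 T ×ˢ Icc c1 c2 := by simp [Qe]

lemma Qe_meas (T c1 c2 e : ℝ) : MeasurableSet (Qe T c1 c2 e) :=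
  measurableSet_Icc.prod measurableSet_Icc

lemma notMem_Qe {T c1 c2 : ℝ} {z : ℝ × ℝ} (hz : z ∉ Icc 0 T ×ˢ Icc c1 c2) :
    ∃ e > 0, z ∉ Qe T c1 c2 e := by
  by_contra hc
  push Not at hc
  apply hz
  rw [← Qe_zero]
  refine ⟨⟨?_, ?_⟩, ?_, ?_⟩
  · refine le_of_forall_pos_le_add fun e he => ?_
    have := (hc e he).1.1; linarith
  · refine le_of_forall_pos_le_add fun e he => ?_
    have := (hc e he).1.2; linarith
  · refine le_of_forall_pos_le_add fun e he => ?_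
    have := (hc e he).2.1; linarith
  · refine le_of_forall_pos_le_add fun e he => ?_
    have := (hc e he).2.2; linarith

/-- data for weak limits -/
structure WL (T c1 c2 : ℝ) (p : ℝ × ℝ → ℝ) (R0 : ℝ)
    (h : ℕ → ℝ) (P f0 : ℕ → ℝ × ℝ → ℝ) (R : ℕ → ℝ) : Prop where
  hlim : Tendsto h atTop (𝓝 0)
  PL : ∀ j, MemLp (P j) 2
  Pnn : ∀ j z, 0 ≤ P j z
  Psupp : ∀ j z, z ∉ Qe T c1 c2 (2 * h j) → P j z = 0
  fL : ∀ j, MemLp (f0 j) 2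
  flim : Tendsto (fun j => ∫ z, (f0 j z - p z) ^ 2) atTop (𝓝 0)
  Rlim : Tendsto R atTop (𝓝 R0)
  est : ∀ j, ∫ z, (P j z - f0 j z) ^ 2 ≤ R j

lemma Approx.toWL {T c1 c2 c0 B : ℝ} {N : Measure (ℝ × ℝ)} {a b p : ℝ × ℝ → ℝ} {R0 : ℝ}
    {h : ℕ → ℝ} {k P f0 : ℕ → ℝ × ℝ → ℝ} {R : ℕ → ℝ}
    (H : Approx T c1 c2 c0 B N a b p R0 h k P f0 R) : WL T c1 c2 p R0 h P f0 R :=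
  ⟨H.hlim, H.PL, H.Pnn, H.Psupp, H.fL, H.flim, H.Rlim, H.est⟩

lemma approx_limit {T c1 c2 : ℝ} {p : ℝ × ℝ → ℝ} {R0 : ℝ}
    {h : ℕ → ℝ} {P f0 : ℕ → ℝ × ℝ → ℝ} {R : ℕ → ℝ} (hpL : MemLp p 2)
    (H : WL T c1 c2 p R0 h P f0 R) :
    ∃ p' : ℝ × ℝ → ℝ, Measurable p' ∧ MemLp p' 2 ∧ (∀ z, 0 ≤ p' z) ∧
      (∀ z, z ∉ Icc 0 T ×ˢ Icc c1 c2 → p' z = 0) ∧ ∫ z, (p' z - p z) ^ 2 ≤ R0 ∧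
      ∀ (Y : ℕ → ℝ × ℝ → ℝ) (y : ℝ × ℝ → ℝ), (∀ j, MemLp (Y j) 2) → MemLp y 2 →
        Tendsto (fun j => ∫ z, (Y j z - y z) ^ 2) atTop (𝓝 0) →
        Tendsto (fun j => ∫ z, Y j z * P j z) (hyperfilter ℕ) (𝓝 (∫ z, y z * p' z)) := by
  obtain ⟨d, hd1, hd2⟩ := weak_lim (fun j => (H.PL j).toLp (P j) - (H.fL j).toLp (f0 j))
    (fun j => √ (R j)) (√ R0) ((Real.continuous_sqrt.tendsto _).comp H.Rlim) (fun j => by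
      rw [← MemLp.toLp_sub]
      refine Real.le_sqrt_of_sq_le ?_
      rw [toLp_norm_sq]
      exact H.est j)
  have hf : Tendsto (fun j => (H.fL j).toLp (f0 j)) atTop (𝓝 (hpL.toLp p)) :=
    (tendsto_toLp_iff H.fL hpL).2 H.flim
  have hR0 : 0 ≤ R0 := ge_of_tendsto' H.Rlim fun j =>
    (integral_nonneg fun _ => sq_nonneg _).trans (H.est j)
  set q : Lp ℝ 2 (volume : Measure (ℝ × ℝ)) := hpL.toLp p + d with hq
  have hw : ∀ y, Tendsto (fun j => inner ℝ ((H.PL j).toLp (P j)) y) (hyperfilter ℕ) (𝓝 (inner ℝ q y)) := by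
    intro y
    have h1 := hd2 y
    have h2 : Tendsto (fun j => inner ℝ ((H.fL j).toLp (f0 j)) y) (hyperfilter ℕ)
        (𝓝 (inner ℝ (hpL.toLp p) y)) :=
      (Filter.Tendsto.inner hf tendsto_const_nhds).mono_left Nat.hyperfilter_le_atTop
    have := h2.add h1
    rw [← inner_add_left] at this
    refine this.congr fun j => ?_
    rw [← inner_add_left]; congr 1; abel
  have hqL := Lp.memLp q
  have hqe : hqL.toLp q = q := Lp.toLp_coeFn q hqL
  have hw' : ∀ y (hy : MemLp y 2), Tendsto (fun j => ∫ z, P j z * y z) (hyperfilter ℕ)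
      (𝓝 (∫ z, q z * y z)) := by
    intro y hy
    have := hw (hy.toLp y)
    rw [← hqe, toLp_inner] at this
    simp_rw [toLp_inner] at this
    exact this
  -- nonnegativity
  have hq0 : ∀ᵐ z, 0 ≤ q z := by
    have hyL : MemLp (fun z => max (- q z) 0) 2 := by
      have := hqL.neg.pos_part
      exact this
    have h1 : 0 ≤ ∫ z, q z * max (- q z) 0 := ge_of_tendsto' (hw' _ hyL) fun j =>
      integral_nonneg fun z => mul_nonneg (H.Pnn j z) (le_max_right _ _)
    have h2 : ∀ z, q z * max (- q z) 0 = - (max (- q z) 0) ^ 2 := by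
      intro z
      rcases le_total (- q z) 0 with h | h
      · simp [max_eq_right h]
      · rw [max_eq_left h]; ring
    simp_rw [h2] at h1
    rw [integral_neg] at h1
    have h3 : ∫ z, (max (- q z) 0) ^ 2 = 0 :=
      le_antisymm (by linarith) (integral_nonneg fun _ => sq_nonneg _)
    rw [integral_eq_zero_iff_of_nonneg (fun _ => sq_nonneg _) (sq_int hyL)] at h3
    filter_upwards [h3] with z hz
    have : max (- q z) 0 = 0 := by simpa using hz
    have := le_max_left (- q z) 0
    linarith
  have hqQ : ∀ᵐ z, z ∉ Icc 0 T ×ˢ Icc c1 c2 → q z = 0 := by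
    have h1 : ∀ n : ℕ, ∀ᵐ z, z ∉ Qe T c1 c2 (1 / ((n:ℝ) + 1)) → q z = 0 := by
      intro n
      set S := (Qe T c1 c2 (1 / ((n:ℝ) + 1)))ᶜ with hS
      have hSm : MeasurableSet S := (Qe_meas _ _ _ _).compl
      have hyL : MemLp (S.indicator q) 2 := hqL.indicator hSm
      have t1 := hw' _ hyL
      have t2 : Tendsto (fun j => ∫ z, P j z * S.indicator q z) (hyperfilter ℕ) (𝓝 0) := by
        refine Tendsto.mono_left ?_ Nat.hyperfilter_le_atTop
        refine tendsto_const_nhds.congr' ?_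
        have : ∀ᶠ j in atTop, h j < 1 / ((n:ℝ) + 1) / 2 :=
          H.hlim.eventually (gt_mem_nhds (by positivity))
        filter_upwards [this] with j hj
        symm
        refine integral_eq_zero_of_ae (Eventually.of_forall fun z => ?_)
        by_cases hz : z ∈ S
        · have : P j z = 0 := H.Psupp j z fun hz' => hz (Qe_mono (by linarith) hz')
          simp [this]
        · simp [hz]
      have t3 := tendsto_nhds_unique t1 t2
      have e : ∀ z, q z * S.indicator q z = (S.indicator q z) ^ 2 := by
        intro z; by_cases hz : z ∈ S <;> simp [hz, sq]
      simp_rw [e] at t3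
      rw [integral_eq_zero_iff_of_nonneg (fun _ => sq_nonneg _) (sq_int hyL)] at t3
      filter_upwards [t3] with z hz hzS
      have hzS' : z ∈ S := hzS
      simpa [hzS'] using hz
    filter_upwards [ae_all_iff.2 h1] with z hz hzQ
    obtain ⟨e, he, hze⟩ := notMem_Qe hzQ
    obtain ⟨n, hn⟩ := exists_nat_one_div_lt he
    exact hz n fun h' => hze (Qe_mono hn.le h')
  set Q : Set (ℝ × ℝ) := Icc 0 T ×ˢ Icc c1 c2 with hQ
  have hQm : MeasurableSet Q := measurableSet_Icc.prod measurableSet_Icc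
  have hqm : Measurable q := (Lp.stronglyMeasurable q).measurable
  set p' : ℝ × ℝ → ℝ := Q.indicator fun z => max (q z) 0 with hp'
  have hae : p' =ᵐ[volume] q := by
    filter_upwards [hq0, hqQ] with z h1 h2
    by_cases hz : z ∈ Q
    · simp [hp', hz, h1]
    · simp [hp', hz, h2 hz]
  refine ⟨p', (hqm.max measurable_const).indicator hQm, hqL.ae_eq hae.symm, fun z => ?_, fun z hz => ?_,
    ?_, ?_⟩
  · exact indicator_nonneg (fun _ _ => le_max_right _ _) z
  · simp [hp', hz]
  · have hp'L : MemLp p' 2 := hqL.ae_eq hae.symm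
    have e1 : hp'L.toLp p' = q := by
      rw [← hqe]; exact MemLp.toLp_congr _ _ hae
    have := toLp_norm_sq (hp'L.sub hpL)
    rw [MemLp.toLp_sub hp'L hpL, e1, hq, add_sub_cancel_left] at this
    rw [show ∫ z, (p' z - p z) ^ 2 = ‖d‖ ^ 2 from this.symm, ← Real.sq_sqrt hR0]
    exact pow_le_pow_left₀ (norm_nonneg _) hd1 2
  · intro Y y hY hy hYy
    have s1 : Tendsto (fun j => (hY j).toLp (Y j)) atTop (𝓝 (hy.toLp y)) :=
      (tendsto_toLp_iff hY hy).2 hYy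
    obtain ⟨D, hD⟩ : ∃ D, ∀ j, ‖(H.PL j).toLp (P j)‖ ≤ D := by
      obtain ⟨D1, hD1⟩ := (((Real.continuous_sqrt.tendsto _).comp H.Rlim)).bddAbove_range
      obtain ⟨D2, hD2⟩ := hf.norm.bddAbove_range
      refine ⟨D1 + D2, fun j => ?_⟩
      have h1 : ‖(H.PL j).toLp (P j) - (H.fL j).toLp (f0 j)‖ ≤ D1 := by
        refine le_trans ?_ (hD1 ⟨j, rfl⟩)
        rw [← MemLp.toLp_sub]
        refine Real.le_sqrt_of_sq_le ?_
        rw [toLp_norm_sq]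
        exact H.est j
      have h2 := hD2 ⟨j, rfl⟩
      have h3 := norm_add_le ((H.PL j).toLp (P j) - (H.fL j).toLp (f0 j)) ((H.fL j).toLp (f0 j))
      rw [sub_add_cancel] at h3
      simp only at h2
      linarith
    have s2 : Tendsto (fun j => inner ℝ ((H.PL j).toLp (P j)) ((hY j).toLp (Y j) - hy.toLp y))
        atTop (𝓝 0) := by
      have s3 : Tendsto (fun j => D * ‖(hY j).toLp (Y j) - hy.toLp y‖) atTop (𝓝 0) := by
        have := (tendsto_iff_norm_sub_tendsto_zero.1 s1).const_mul D
        simpa using this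
      refine squeeze_zero_norm (fun j => ?_) s3
      exact (norm_inner_le_norm _ _).trans (mul_le_mul_of_nonneg_right (hD j) (norm_nonneg _))
    have s4 := (s2.mono_left Nat.hyperfilter_le_atTop).add (hw (hy.toLp y))
    simp_rw [← inner_add_right, sub_add_cancel, zero_add] at s4
    rw [← hqe, toLp_inner] at s4
    simp_rw [toLp_inner] at s4
    have e : ∫ z, y z * p' z = ∫ z, q z * y z := integral_congr_ae (by
      filter_upwards [hae] with z hz; rw [hz, mul_comm])
    rw [e]
    refine s4.congr fun j => ?_
    simp_rw [mul_comm]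

end

section

lemma mvt1 {l r : ℝ} {g g' : ℝ → ℝ} (hg : ∀ x ∈ Icc l r, HasDerivWithinAt g (g' x) (Icc l r) x)
    {x δ : ℝ} (hδ : 0 < δ) (h1 : x ∈ Icc l r) (h2 : x + δ ∈ Icc l r) :
    ∃ ξ ∈ Icc x (x + δ), g (x + δ) - g x = δ * g' ξ := by
  have hsub : Icc x (x + δ) ⊆ Icc l r := Icc_subset_Icc h1.1 h2.2
  have hsub' : Ioo x (x + δ) ⊆ Ioo l r := Ioo_subset_Ioo h1.1 h2.2
  obtain ⟨c, hc, e⟩ := exists_hasDerivAt_eq_slope g g' (by linarith : x < x + δ)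
    (fun y hy => ((hg y (hsub hy)).continuousWithinAt).mono hsub)
    (fun y hy => (hg y (hsub (Ioo_subset_Icc_self hy))).hasDerivAt
      (Icc_mem_nhds (hsub' hy).1 (hsub' hy).2))
  refine ⟨c, Ioo_subset_Icc_self hc, ?_⟩
  rw [e, add_sub_cancel_left]
  field_simp

lemma mvt2 {l r : ℝ} {g g' g'' : ℝ → ℝ} (hg : ∀ x ∈ Icc l r, HasDerivWithinAt g (g' x) (Icc l r) x)
    (hg' : ∀ x ∈ Icc l r, HasDerivWithinAt g' (g'' x) (Icc l r) x)
    {x δ : ℝ} (hδ : 0 < δ) (h1 : x - δ ∈ Icc l r) (h2 : x + δ ∈ Icc l r) :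
    ∃ ξ ∈ Icc (x - δ) (x + δ), g (x + δ) - 2 * g x + g (x - δ) = δ ^ 2 * g'' ξ := by
  have hgc : ContinuousOn g (Icc l r) := fun y hy => (hg y hy).continuousWithinAt
  have mp : ∀ s ∈ Icc 0 δ, x + s ∈ Icc l r := fun s hs =>
    ⟨by linarith [h1.1, hs.1], by linarith [h2.2, hs.2]⟩
  have mm : ∀ s ∈ Icc 0 δ, x - s ∈ Icc l r := fun s hs =>
    ⟨by linarith [h1.1, hs.2], by linarith [h2.2, hs.1]⟩
  obtain ⟨c, hc, e⟩ := exists_ratio_hasDerivAt_eq_ratio_slope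
    (fun s => g (x + s) + g (x - s)) (fun s => g' (x + s) - g' (x - s)) hδ
    ((hgc.comp (by fun_prop) mp).add (hgc.comp (by fun_prop) mm))
    (fun s hs => by
      have d1 : HasDerivAt g (g' (x + s)) (x + s) := (hg _ (mp s (Ioo_subset_Icc_self hs))).hasDerivAt
        (Icc_mem_nhds (by linarith [h1.1, hs.1]) (by linarith [h2.2, hs.2]))
      have d2 : HasDerivAt g (g' (x - s)) (x - s) := (hg _ (mm s (Ioo_subset_Icc_self hs))).hasDerivAt
        (Icc_mem_nhds (by linarith [h1.1, hs.2]) (by linarith [h2.2, hs.1]))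
      have d1' := HasDerivAt.comp_const_add x s d1
      have d2' := HasDerivAt.comp_const_sub x s d2
      exact d1'.add d2')
    (fun s => s ^ 2) (fun s => 2 * s) (by fun_prop)
    (fun s hs => by simpa using hasDerivAt_pow 2 s)
  have hc2 : x - c + 2 * c = x + c := by ring
  obtain ⟨ξ, hξ, e2⟩ := mvt1 hg' (x := x - c) (δ := 2 * c) (by linarith [hc.1])
    (mm c (Ioo_subset_Icc_self hc)) (by rw [hc2]; exact mp c (Ioo_subset_Icc_self hc))
  rw [hc2] at e2 hξ
  refine ⟨ξ, ⟨by linarith [hξ.1, hc.2], by linarith [hξ.2, hc.2]⟩, ?_⟩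
  rw [e2] at e
  have hc0 : 2 * c ≠ 0 := by linarith [hc.1]
  have e3 : (2 * c) * (g (x + δ) - 2 * g x + g (x - δ)) = (2 * c) * (δ ^ 2 * g'' ξ) := by
    simp only [add_zero, sub_zero] at e
    linear_combination (-1) * e
  exact mul_left_cancel₀ hc0 e3

/-- affine contraction -/
def aff (L l h x : ℝ) : ℝ := l + (x - l + 3 * h) * (L / (L + 6 * h))

lemma aff_mem {L l h x : ℝ} (hL : 0 < L) (hh : 0 < h) (hx : x ∈ Icc (l - 3 * h) (l + L + 3 * h)) :
    aff L l h x ∈ Icc l (l + L) ∧ |aff L l h x - x| ≤ 3 * h := by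
  have h0 : 0 < L + 6 * h := by positivity
  have hs0 : 0 < L / (L + 6 * h) := by positivity
  have hs : (L + 6 * h) * (L / (L + 6 * h)) = L := by field_simp
  have hs1 : L / (L + 6 * h) ≤ 1 := by rw [div_le_one h0]; linarith
  have y0 : 0 ≤ x - l + 3 * h := by linarith [hx.1]
  have y1 : x - l + 3 * h ≤ L + 6 * h := by linarith [hx.2]
  unfold aff
  set s := L / (L + 6 * h)
  refine ⟨⟨by nlinarith, by nlinarith⟩, ?_⟩
  rw [abs_le]
  constructor <;> nlinarith

lemma aff_add {L l h x y : ℝ} : aff L l h (x + y) = aff L l h x + L / (L + 6 * h) * y := by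
  unfold aff; ring

/-- clamp projection -/
def pr (T c1 c2 : ℝ) (z : ℝ × ℝ) : ℝ × ℝ := (max 0 (min T z.1), max c1 (min c2 z.2))

lemma pr_cont (T c1 c2 : ℝ) : Continuous (pr T c1 c2) := by unfold pr; fun_prop

lemma pr_mem {T c1 c2 : ℝ} (hT : 0 ≤ T) (hc : c1 ≤ c2) (z : ℝ × ℝ) :
    pr T c1 c2 z ∈ Icc 0 T ×ˢ Icc c1 c2 :=
  ⟨⟨le_max_left _ _, max_le hT (min_le_left _ _)⟩, le_max_left _ _, max_le hc (min_le_left _ _)⟩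

lemma pr_id {T c1 c2 : ℝ} {z : ℝ × ℝ} (hz : z ∈ Icc 0 T ×ˢ Icc c1 c2) : pr T c1 c2 z = z := by
  obtain ⟨⟨h1, h2⟩, h3, h4⟩ := hz
  ext
  · simp [pr, min_eq_right h2, max_eq_right h1]
  · simp [pr, min_eq_right h4, max_eq_right h3]

/-- contraction of the enlarged box -/
def al (T c1 c2 h : ℝ) (z : ℝ × ℝ) : ℝ × ℝ := (aff T 0 h z.1, aff (c2 - c1) c1 h z.2)

lemma al_cont (T c1 c2 h : ℝ) : Continuous (al T c1 c2 h) := by unfold al aff; fun_prop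

lemma al_mem {T c1 c2 h : ℝ} (hT : 0 < T) (hc : c1 < c2) (hh : 0 < h) {z : ℝ × ℝ}
    (hz : z ∈ Qe T c1 c2 (3 * h)) :
    al T c1 c2 h z ∈ Icc 0 T ×ˢ Icc c1 c2 ∧ ‖al T c1 c2 h z - z‖ ≤ 3 * h := by
  obtain ⟨h1, h2⟩ := hz
  have a1 := aff_mem (L := T) (l := 0) (x := z.1) hT hh (by simpa using h1)
  have a2 := aff_mem (L := c2 - c1) (l := c1) (x := z.2) (by linarith) hh (by simpa using h2)
  simp only [zero_add, add_sub_cancel] at a1 a2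
  exact ⟨⟨a1.1, a2.1⟩, by
    rw [Prod.norm_def, max_le_iff]; exact ⟨a1.2, a2.2⟩⟩

/-- extended test function -/
def ue (T c1 c2 h : ℝ) (u : ℝ → ℝ → ℝ) (z : ℝ × ℝ) : ℝ :=
  u (pr T c1 c2 (al T c1 c2 h z)).1 (pr T c1 c2 (al T c1 c2 h z)).2

lemma ue_eq {T c1 c2 h : ℝ} (hT : 0 < T) (hc : c1 < c2) (hh : 0 < h) (u : ℝ → ℝ → ℝ) {z : ℝ × ℝ}
    (hz : z ∈ Qe T c1 c2 (3 * h)) :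
    ue T c1 c2 h u z = u (aff T 0 h z.1) (aff (c2 - c1) c1 h z.2) := by
  unfold ue
  rw [pr_id (al_mem hT hc hh hz).1]; rfl

lemma quots {T c1 c2 h : ℝ} (hT : 0 < T) (hc : c1 < c2) (hh : 0 < h) {u ut ux uxx : ℝ → ℝ → ℝ}
    (hu : IsCb12 T (Ioo c1 c2) u ut ux uxx) {z : ℝ × ℝ} (hz : z ∈ Qe T c1 c2 (2 * h)) :
    (∃ w ∈ Icc 0 T ×ˢ Icc c1 c2, ‖w - z‖ ≤ 4 * h ∧
      Dt h (ue T c1 c2 h u) z = T / (T + 6 * h) * ut w.1 w.2) ∧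
    (∃ w ∈ Icc 0 T ×ˢ Icc c1 c2, ‖w - z‖ ≤ 4 * h ∧
      Dx h (ue T c1 c2 h u) z = (c2 - c1) / (c2 - c1 + 6 * h) * ux w.1 w.2) ∧
    (∃ w ∈ Icc 0 T ×ˢ Icc c1 c2, ‖w - z‖ ≤ 4 * h ∧
      Dxx h (ue T c1 c2 h u) z = ((c2 - c1) / (c2 - c1 + 6 * h)) ^ 2 * uxx w.1 w.2) := by
  have hz3 : z ∈ Qe T c1 c2 (3 * h) := Qe_mono (by linarith) hz
  obtain ⟨⟨z1, z2⟩, z3, z4⟩ := hz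
  have hzt : z + (h, 0) ∈ Qe T c1 c2 (3 * h) :=
    ⟨⟨by simp; linarith, by simp; linarith⟩, by simp; linarith, by simp; linarith⟩
  have hzx : z + (0, h) ∈ Qe T c1 c2 (3 * h) :=
    ⟨⟨by simp; linarith, by simp; linarith⟩, by simp; linarith, by simp; linarith⟩
  have hzx' : z - (0, h) ∈ Qe T c1 c2 (3 * h) :=
    ⟨⟨by simp; linarith, by simp; linarith⟩, by simp; linarith, by simp; linarith⟩
  have hL : 0 < c2 - c1 := by linarith
  set st := T / (T + 6 * h) with hst
  set sx := (c2 - c1) / (c2 - c1 + 6 * h) with hsx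
  have st0 : 0 < st := by positivity
  have sx0 : 0 < sx := by positivity
  have st1 : st ≤ 1 := by rw [hst, div_le_one (by positivity)]; linarith
  have sx1 : sx ≤ 1 := by rw [hsx, div_le_one (by positivity)]; linarith
  have ez := ue_eq hT hc hh u hz3
  have ezt := ue_eq hT hc hh u hzt
  have ezx := ue_eq hT hc hh u hzx
  have ezx' := ue_eq hT hc hh u hzx'
  have mz := al_mem hT hc hh hz3
  have mzt := al_mem hT hc hh hzt
  have mzx := al_mem hT hc hh hzx
  have mzx' := al_mem hT hc hh hzx'
  have ax' : aff (c2 - c1) c1 h (z.2 - h) = aff (c2 - c1) c1 h z.2 - sx * h := by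
    rw [hsx]; unfold aff; ring
  simp only [al, Prod.fst_add, Prod.snd_add, Prod.fst_sub, Prod.snd_sub, add_zero, sub_zero, aff_add, ax',
    ← hst, ← hsx] at ez ezt ezx ezx' mz mzt mzx mzx'
  obtain ⟨⟨mz1, mz2⟩, nz⟩ := mz
  rw [Prod.norm_def, max_le_iff] at nz
  simp only [Prod.fst_sub, Prod.snd_sub, Real.norm_eq_abs, abs_le] at nz
  obtain ⟨⟨n1, n2⟩, n3, n4⟩ := nz
  have hd1 := hu.deriv_t
  have hd2 := hu.deriv_x
  have hd3 := hu.deriv_xx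
  rw [closure_Ioo hc.ne] at hd1 hd2 hd3
  set X := aff (c2 - c1) c1 h z.2
  set S := aff T 0 h z.1
  have sth : st * h ≤ h := by nlinarith
  have sxh : sx * h ≤ h := by nlinarith
  refine ⟨?_, ?_, ?_⟩
  · obtain ⟨ξ, hξ, e⟩ := mvt1 (g := fun s => u s X) (g' := fun s => ut s X)
      (fun s hs => hd1 s hs X mz2) (x := S) (δ := st * h) (by positivity) mz1 mzt.1.1
    refine ⟨(ξ, X), ⟨⟨mz1.1.trans hξ.1, hξ.2.trans mzt.1.1.2⟩, mz2⟩, ?_, ?_⟩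
    · rw [Prod.norm_def, max_le_iff]
      simp only [Prod.fst_sub, Prod.snd_sub, Real.norm_eq_abs, abs_le]
      exact ⟨⟨by linarith [hξ.1], by linarith [hξ.2]⟩, by linarith, by linarith⟩
    · unfold Dt
      rw [ez, ezt, e]; field_simp
  · obtain ⟨ξ, hξ, e⟩ := mvt1 (g := fun s => u S s) (g' := fun s => ux S s)
      (fun s hs => hd2 S mz1 s hs) (x := X) (δ := sx * h) (by positivity) mz2 mzx.1.2
    refine ⟨(S, ξ), ⟨mz1, ⟨mz2.1.trans hξ.1, hξ.2.trans mzx.1.2.2⟩⟩, ?_, ?_⟩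
    · rw [Prod.norm_def, max_le_iff]
      simp only [Prod.fst_sub, Prod.snd_sub, Real.norm_eq_abs, abs_le]
      exact ⟨⟨by linarith, by linarith⟩, by linarith [hξ.1], by linarith [hξ.2]⟩
    · unfold Dx
      rw [ez, ezx, e]; field_simp
  · obtain ⟨ξ, hξ, e⟩ := mvt2 (g := fun s => u S s) (g' := fun s => ux S s) (g'' := fun s => uxx S s)
      (fun s hs => hd2 S mz1 s hs) (fun s hs => hd3 S mz1 s hs) (x := X) (δ := sx * h) (by positivity)
      mzx'.1.2 mzx.1.2
    refine ⟨(S, ξ), ⟨mz1, ⟨mzx'.1.2.1.trans hξ.1, hξ.2.trans mzx.1.2.2⟩⟩, ?_, ?_⟩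
    · rw [Prod.norm_def, max_le_iff]
      simp only [Prod.fst_sub, Prod.snd_sub, Real.norm_eq_abs, abs_le]
      exact ⟨⟨by linarith, by linarith⟩, by linarith [hξ.1], by linarith [hξ.2]⟩
    · unfold Dxx
      rw [ez, ezx, ezx', e]; field_simp

end

section

open scoped CompactlySupported in
lemma rmk_lim {T c1 c2 D : ℝ} (hT : 0 < T) (hc : c1 < c2) (Ln : ℕ → (ℝ × ℝ → ℝ) → ℝ)
    (hadd : ∀ j v w, Continuous v → Continuous w → Ln j (v + w) = Ln j v + Ln j w)
    (hsmul : ∀ j (c : ℝ) w, Continuous w → Ln j (c • w) = c * Ln j w)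
    (hpos : ∀ j w, Continuous w → (∀ z, 0 ≤ w z) → 0 ≤ Ln j w)
    (hbd : ∀ j w (ε : ℝ), Continuous w → (∀ z, |w z| ≤ ε) → |Ln j w| ≤ D * ε) :
    ∃ μ : Measure (ℝ × ℝ), IsFiniteMeasure μ ∧ μ (Icc 0 T ×ˢ Icc c1 c2)ᶜ = 0 ∧
      ∀ f : ℝ × ℝ → ℝ, ContinuousOn f (Icc 0 T ×ˢ Icc c1 c2) →
        Tendsto (fun j => Ln j (fun z => f (pr T c1 c2 z))) (hyperfilter ℕ) (𝓝 (∫ z, f z ∂μ)) := by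
  set Q : Set (ℝ × ℝ) := Icc 0 T ×ˢ Icc c1 c2 with hQ
  have hQc : IsCompact Q := isCompact_Icc.prod isCompact_Icc
  haveI : CompactSpace Q := isCompact_iff_compactSpace.mp hQc
  let π : ℝ × ℝ → Q := fun z => ⟨pr T c1 c2 z, pr_mem hT.le hc.le z⟩
  have hπ : Continuous π := (pr_cont T c1 c2).subtype_mk _
  have hlim : ∀ f : C_c(Q, ℝ), ∃ l : ℝ, Tendsto (fun j => Ln j (fun z => f (π z))) (hyperfilter ℕ) (𝓝 l) := by
    intro f
    obtain ⟨M, hM⟩ : ∃ M : ℝ, ∀ x, |f x| ≤ M := by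
      obtain ⟨M, hM⟩ := isCompact_univ.exists_bound_of_continuousOn (f.continuous.continuousOn (s := univ))
      exact ⟨M, fun x => hM x trivial⟩
    have hcp : IsCompact (Icc (-(D * M)) (D * M)) := isCompact_Icc
    have hmem : ∀ j, Ln j (fun z => f (π z)) ∈ Icc (-(D * M)) (D * M) := fun j =>
      abs_le.1 (hbd j _ M (f.continuous.comp hπ) fun z => hM _)
    obtain ⟨l, _, hl⟩ := hcp.ultrafilter_le_nhds
      ((hyperfilter ℕ : Ultrafilter ℕ).map fun j => Ln j (fun z => f (π z)))
      (by
        rw [le_principal_iff]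
        exact Eventually.of_forall (f := (hyperfilter ℕ : Filter ℕ)) hmem)
    exact ⟨l, hl⟩
  choose Lam hLam using hlim
  let Λ : C_c(Q, ℝ) →ₚ[ℝ] ℝ :=
  { toFun := Lam
    map_add' := fun f g => tendsto_nhds_unique (hLam (f + g)) (by
      refine ((hLam f).add (hLam g)).congr fun j => ?_
      exact (hadd j _ _ (f.continuous.comp hπ) (g.continuous.comp hπ)).symm)
    map_smul' := fun c f => tendsto_nhds_unique (hLam (c • f)) (by
      refine ((hLam f).const_mul c).congr fun j => ?_
      exact (hsmul j c _ (f.continuous.comp hπ)).symm)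
    monotone' := fun f g hfg => by
      refine le_of_tendsto_of_tendsto' (hLam f) (hLam g) fun j => ?_
      have h1 := hpos j (fun z => g (π z) - f (π z)) ((g.continuous.comp hπ).sub (f.continuous.comp hπ))
        (fun z => sub_nonneg.2 (hfg _))
      have h2 := hadd j (fun z => g (π z) - f (π z)) (fun z => f (π z))
        ((g.continuous.comp hπ).sub (f.continuous.comp hπ)) (f.continuous.comp hπ)
      have e : ((fun z => g (π z) - f (π z)) + fun z => f (π z)) = fun z => g (π z) := by
        ext z; simp
      rw [e] at h2
      linarith }
  refine ⟨(RealRMK.rieszMeasure Λ).map Subtype.val, inferInstance, ?_, fun f hf => ?_⟩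
  · rw [Measure.map_apply measurable_subtype_coe hQc.measurableSet.compl]
    convert measure_empty (μ := RealRMK.rieszMeasure Λ)
    ext x; simp
  · let F : C_c(Q, ℝ) := ⟨⟨fun x => f x.1, hf.restrict⟩, HasCompactSupport.of_compactSpace _⟩
    have h1 := RealRMK.integral_rieszMeasure Λ F
    have h2 : ∫ z, f z ∂((RealRMK.rieszMeasure Λ).map Subtype.val) = Λ F := by
      rw [← h1, (MeasurableEmbedding.subtype_coe hQc.measurableSet).integral_map]
      rfl
    rw [h2]
    exact hLam F

lemma ind_BM {T c1 c2 e : ℝ} {w : ℝ × ℝ → ℝ} (hw : Continuous w) : BM ((Qe T c1 c2 e).indicator w) := by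
  have hcp : IsCompact (Qe T c1 c2 e) := isCompact_Icc.prod isCompact_Icc
  obtain ⟨M, hM⟩ := hcp.exists_bound_of_continuousOn hw.continuousOn
  obtain ⟨R, hR⟩ := hcp.isBounded.exists_norm_le
  refine ⟨hw.measurable.indicator (Qe_meas _ _ _ _), ⟨max M 0, fun z => ?_⟩, ⟨R, fun z hz => ?_⟩⟩
  · by_cases h : z ∈ Qe T c1 c2 e
    · simp only [h, indicator_of_mem]; exact (hM z h).trans (le_max_left _ _)
    · simp [h]
  · by_contra h
    apply hz
    have : z ∉ Qe T c1 c2 e := fun h' => h (hR z h')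
    simp [this]

/-- the discrete functional -/
def nu (T c1 c2 lam : ℝ) (a b : ℝ × ℝ → ℝ) (h : ℝ) (P g0 : ℝ × ℝ → ℝ) (w : ℝ × ℝ → ℝ) : ℝ :=
  (∫ z, Aop h lam a b ((Qe T c1 c2 (3 * h)).indicator w) z * P z) +
    ∫ z, (Qe T c1 c2 (3 * h)).indicator w z * g0 z

section
variable {T c1 c2 lam h D : ℝ} {a b P g0 : ℝ × ℝ → ℝ}

lemma nu_add (ha : Measurable a) (hb : Measurable b)
    (hab : ∃ C : ℝ, ∀ z, |a z| ≤ C) (hbb : ∃ C : ℝ, ∀ z, |b z| ≤ C) (hP : MemLp P 2) (hg : BM g0)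
    (v w : ℝ × ℝ → ℝ) (hv : Continuous v) (hw : Continuous w) :
    nu T c1 c2 lam a b h P g0 (v + w) = nu T c1 c2 lam a b h P g0 v + nu T c1 c2 lam a b h P g0 w := by
  unfold nu
  rw [indicator_add']
  have h1 := ((ind_BM (T := T) (c1 := c1) (c2 := c2) (e := 3 * h) hv).aop h lam ha hb hab hbb).memLp
  have h2 := ((ind_BM (T := T) (c1 := c1) (c2 := c2) (e := 3 * h) hw).aop h lam ha hb hab hbb).memLp
  have h3 := (ind_BM (T := T) (c1 := c1) (c2 := c2) (e := 3 * h) hv).memLp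
  have h4 := (ind_BM (T := T) (c1 := c1) (c2 := c2) (e := 3 * h) hw).memLp
  simp_rw [Aop_add, Pi.add_apply, add_mul]
  rw [integral_add (mul_int h1 hP) (mul_int h2 hP), integral_add (mul_int h3 hg.memLp) (mul_int h4 hg.memLp)]
  ring

lemma nu_smul (c : ℝ) (w : ℝ × ℝ → ℝ) :
    nu T c1 c2 lam a b h P g0 (c • w) = c * nu T c1 c2 lam a b h P g0 w := by
  unfold nu
  rw [show (Qe T c1 c2 (3 * h)).indicator (c • w) = c • (Qe T c1 c2 (3 * h)).indicator w from
    indicator_const_smul _ c w]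
  simp_rw [Aop_smul, Pi.smul_apply, smul_eq_mul, mul_assoc]
  rw [integral_const_mul, integral_const_mul]
  ring

lemma nu_one_le (hh : 0 < h) (hlam : 0 ≤ lam)
    (hP0 : ∀ z, 0 ≤ P z) (hPs : ∀ z, z ∉ Qe T c1 c2 (2 * h) → P z = 0)
    (hg : BM g0) (hg0 : ∀ z, 0 ≤ g0 z) (hD : ∫ z, g0 z ≤ D) :
    nu T c1 c2 lam a b h P g0 (fun _ => 1) ≤ D := by
  unfold nu
  have h1 : (∫ z, Aop h lam a b ((Qe T c1 c2 (3 * h)).indicator fun _ => 1) z * P z) ≤ 0 := by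
    refine integral_nonpos fun z => ?_
    by_cases hz : z ∈ Qe T c1 c2 (2 * h)
    · have hz3 : z ∈ Qe T c1 c2 (3 * h) := Qe_mono (by linarith) hz
      obtain ⟨⟨z1, z2⟩, z3, z4⟩ := hz
      have hzt : z + (h, 0) ∈ Qe T c1 c2 (3 * h) :=
        ⟨⟨by simp; linarith, by simp; linarith⟩, by simp; linarith, by simp; linarith⟩
      have hzx : z + (0, h) ∈ Qe T c1 c2 (3 * h) :=
        ⟨⟨by simp; linarith, by simp; linarith⟩, by simp; linarith, by simp; linarith⟩
      have hzx' : z - (0, h) ∈ Qe T c1 c2 (3 * h) :=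
        ⟨⟨by simp; linarith, by simp; linarith⟩, by simp; linarith, by simp; linarith⟩
      have : Aop h lam a b ((Qe T c1 c2 (3 * h)).indicator fun _ => 1) z = - lam := by
        simp only [Aop, Dt, Dx, Dxx, indicator_of_mem hz3, indicator_of_mem hzt, indicator_of_mem hzx,
          indicator_of_mem hzx']
        ring
      rw [this]
      have := mul_nonneg hlam (hP0 z)
      simp only [Pi.zero_apply]; linarith
    · simp [hPs z hz]
  have h2 : ∫ z, (Qe T c1 c2 (3 * h)).indicator (fun _ => (1:ℝ)) z * g0 z ≤ ∫ z, g0 z := by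
    refine integral_mono_of_nonneg (Eventually.of_forall fun z => ?_) hg.integrable
      (Eventually.of_forall fun z => ?_)
    · exact mul_nonneg (indicator_nonneg (fun _ _ => zero_le_one) _) (hg0 z)
    · by_cases hz : z ∈ Qe T c1 c2 (3 * h) <;> simp [hz, hg0 z]
  linarith

lemma nu_bound (hh : 0 < h) (hlam : 0 ≤ lam) (ha : Measurable a) (hb : Measurable b)
    (hab : ∃ C : ℝ, ∀ z, |a z| ≤ C) (hbb : ∃ C : ℝ, ∀ z, |b z| ≤ C) (hP : MemLp P 2)
    (hP0 : ∀ z, 0 ≤ P z) (hPs : ∀ z, z ∉ Qe T c1 c2 (2 * h) → P z = 0)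
    (hg : BM g0) (hg0 : ∀ z, 0 ≤ g0 z) (hD : ∫ z, g0 z ≤ D)
    (hpos : ∀ v, BM v → (∀ z, 0 ≤ v z) → 0 ≤ (∫ z, Aop h lam a b v z * P z) + ∫ z, v z * g0 z)
    (w : ℝ × ℝ → ℝ) (ε : ℝ) (hε : 0 ≤ ε) (hw : Continuous w) (hwε : ∀ z ∈ Qe T c1 c2 (3 * h), |w z| ≤ ε) :
    |nu T c1 c2 lam a b h P g0 w| ≤ D * ε := by
  have h1 := nu_one_le (a := a) (b := b) hh hlam hP0 hPs hg hg0 hD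
  have key : ∀ s : ℝ, |s| = 1 → 0 ≤ ε * nu T c1 c2 lam a b h P g0 (fun _ => 1) +
      s * nu T c1 c2 lam a b h P g0 w := by
    intro s hs
    rw [← nu_smul, ← nu_smul, ← nu_add ha hb hab hbb hP hg _ _ (by fun_prop) (by fun_prop)]
    refine hpos _ (ind_BM (by fun_prop)) fun z => ?_
    by_cases hz : z ∈ Qe T c1 c2 (3 * h)
    · simp only [hz, indicator_of_mem, Pi.add_apply, Pi.smul_apply, smul_eq_mul, mul_one]
      have : |s * w z| ≤ ε := by rw [abs_mul, hs, one_mul]; exact hwε z hz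
      linarith [(abs_le.1 this).1]
    · simp [hz]
  have k1 := key 1 (by simp)
  have k2 := key (-1) (by simp)
  have k3 := mul_le_mul_of_nonneg_left h1 hε
  rw [abs_le]
  constructor <;> linarith
end

end

section

lemma tendsto_on {Q : Set (ℝ × ℝ)} {f : ℝ × ℝ → ℝ} (hf : ContinuousOn f Q) {z : ℝ × ℝ} (hz : z ∈ Q)
    {w : ℕ → ℝ × ℝ} {h : ℕ → ℝ} (hh : Tendsto h atTop (𝓝 0)) (c : ℝ)
    (hw : ∀ j, w j ∈ Q) (hwz : ∀ j, ‖w j - z‖ ≤ c * h j) :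
    Tendsto (fun j => f (w j)) atTop (𝓝 (f z)) := by
  refine (hf z hz).tendsto.comp ?_
  refine tendsto_nhdsWithin_iff.2 ⟨?_, Eventually.of_forall hw⟩
  rw [tendsto_iff_norm_sub_tendsto_zero]
  refine squeeze_zero (fun _ => norm_nonneg _) hwz ?_
  simpa using hh.const_mul c

lemma pr_dist {T c1 c2 e : ℝ} (he : 0 ≤ e) {z : ℝ × ℝ} (hT : 0 ≤ T) (hc : c1 ≤ c2)
    (hz : z ∈ Qe T c1 c2 e) : ‖pr T c1 c2 z - z‖ ≤ e := by
  obtain ⟨⟨z1, z2⟩, z3, z4⟩ := hz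
  rw [Prod.norm_def, max_le_iff]
  simp only [Prod.fst_sub, Prod.snd_sub, Real.norm_eq_abs, abs_le, pr]
  refine ⟨⟨?_, ?_⟩, ?_, ?_⟩
  · have : z.1 - e ≤ min T z.1 := le_min (by linarith) (by linarith)
    linarith [le_max_right 0 (min T z.1)]
  · have : max 0 (min T z.1) ≤ z.1 + e := max_le (by linarith) ((min_le_right _ _).trans (by linarith))
    linarith
  · have : z.2 - e ≤ min c2 z.2 := le_min (by linarith) (by linarith)
    linarith [le_max_right c1 (min c2 z.2)]
  · have : max c1 (min c2 z.2) ≤ z.2 + e := max_le (by linarith) ((min_le_right _ _).trans (by linarith))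
    linarith

lemma conv_fubini {k v : ℝ × ℝ → ℝ} (hk : BM k) (hv : BM v) {N : Measure (ℝ × ℝ)} [IsFiniteMeasure N] :
    ∫ z, v z * (∫ w, k (z - w) * 1 ∂N) = ∫ w, (∫ z, v z * k (z - w)) ∂N := by
  obtain ⟨C, hC⟩ := hk.bdd
  have hkm := hk.meas
  have hvm := hv.meas
  have hi : Integrable (Function.uncurry fun z w => v z * k (z - w)) (volume.prod N) := by
    have h1 : Integrable (fun q : (ℝ × ℝ) × (ℝ × ℝ) => v q.1 * C) (volume.prod N) :=
      hv.integrable.mul_prod (integrable_const C)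
    refine h1.mono (Measurable.aestronglyMeasurable ?_) (Eventually.of_forall fun q => ?_)
    · change Measurable fun q : (ℝ × ℝ) × (ℝ × ℝ) => v q.1 * k (q.1 - q.2)
      fun_prop
    · simp only [Function.uncurry, norm_mul]
      exact mul_le_mul_of_nonneg_left ((hC _).trans (le_abs_self C)) (norm_nonneg _)
  rw [← integral_integral_swap hi]
  congr 1; ext z
  simp_rw [mul_one]
  rw [integral_const_mul]

/-- mollifying kernels -/
structure KP (h : ℕ → ℝ) (k : ℕ → ℝ × ℝ → ℝ) : Prop where
  hpos : ∀ j, 0 < h j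
  hlim : Tendsto h atTop (𝓝 0)
  kBM : ∀ j, BM (k j)
  knn : ∀ j w, 0 ≤ k j w
  kint : ∀ j, ∫ w, k j w = 1
  ksupp : ∀ j w, k j w ≠ 0 → ‖w‖ ≤ 2 * h j

lemma Approx.toKP {T c1 c2 c0 B : ℝ} {N : Measure (ℝ × ℝ)} {a b p : ℝ × ℝ → ℝ} {R0 : ℝ}
    {h : ℕ → ℝ} {k P f0 : ℕ → ℝ × ℝ → ℝ} {R : ℕ → ℝ}
    (H : Approx T c1 c2 c0 B N a b p R0 h k P f0 R) : KP h k :=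
  ⟨H.hpos, H.hlim, H.kBM, H.knn, H.kint, H.ksupp⟩

section
variable {T c1 c2 c0 C B : ℝ} {N : Measure (ℝ × ℝ)} {a b p : ℝ × ℝ → ℝ} {R0 : ℝ}
    {h : ℕ → ℝ} {k P f0 : ℕ → ℝ × ℝ → ℝ} {R : ℕ → ℝ}

lemma ue_cont {T c1 c2 h : ℝ} (hT : 0 < T) (hc : c1 < c2) {u : ℝ → ℝ → ℝ}
    (hu : ContinuousOn (fun z : ℝ × ℝ => u z.1 z.2) (Icc 0 T ×ˢ Icc c1 c2)) :
    Continuous (ue T c1 c2 h u) :=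
  hu.comp_continuous ((pr_cont T c1 c2).comp (al_cont T c1 c2 h)) fun z => pr_mem hT.le hc.le _

lemma g0_facts [IsFiniteMeasure N] (hN : N (Icc 0 T ×ˢ Icc c1 c2)ᶜ = 0)
    (H : KP h k) (j : ℕ) :
    BM (fun z => ∫ w, k j (z - w) * 1 ∂N) ∧ (∀ z, 0 ≤ ∫ w, k j (z - w) * 1 ∂N) ∧
      ∫ z, (∫ w, k j (z - w) * 1 ∂N) ≤ N.real univ := by
  have G0 := conv_BM (T := T) (c1 := c1) (c2 := c2) (H.kBM j)
    (H.ksupp j) (measurable_const (a := (1:ℝ))) (integrable_const (μ := N) (1:ℝ))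
    ((measure_eq_zero_iff_ae_notMem.1 hN).mono fun w hw => Or.inl (by simpa using hw))
  refine ⟨G0.1, fun z => integral_nonneg fun w => mul_nonneg (H.knn j _) zero_le_one, ?_⟩
  have e := conv_fubini (N := N) (H.kBM j) (ind_BM (T := T) (c1 := c1) (c2 := c2) (e := 2 * h j)
    (continuous_const (y := (1:ℝ))))
  have e1 : ∫ z, (∫ w, k j (z - w) * 1 ∂N) =
      ∫ z, (Qe T c1 c2 (2 * h j)).indicator (fun _ => (1:ℝ)) z * ∫ w, k j (z - w) * 1 ∂N := by
    congr 1; ext z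
    by_cases hz : z ∈ Qe T c1 c2 (2 * h j)
    · simp [hz]
    · rw [G0.2 z hz]; simp
  rw [e1, e]
  have : N.real univ = ∫ w, (1:ℝ) ∂N := by simp
  rw [this]
  refine integral_mono_of_nonneg (Eventually.of_forall fun w => integral_nonneg fun z => ?_)
    (integrable_const _) (Eventually.of_forall fun w => ?_)
  · exact mul_nonneg (indicator_nonneg (fun _ _ => zero_le_one) _) (H.knn j _)
  · have h1 : ∫ z, k j (z - w) = 1 := by
      rw [integral_sub_right_eq_self (k j) w]; exact H.kint j
    refine le_of_le_of_eq (integral_mono_of_nonneg (Eventually.of_forall fun z => ?_) ((H.kBM j).shift' w).integrable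
      (Eventually.of_forall fun z => ?_)) h1
    · exact mul_nonneg (indicator_nonneg (fun _ _ => zero_le_one) _) (H.knn j _)
    · by_cases hz : z ∈ Qe T c1 c2 (2 * h j) <;> simp [hz, H.knn j (z - w)]

lemma lim_N (hT : 0 < T) (hc : c1 < c2) [IsFiniteMeasure N] (hN : N (Icc 0 T ×ˢ Icc c1 c2)ᶜ = 0)
    (H : KP h k) {u : ℝ → ℝ → ℝ}
    (hu : ContinuousOn (fun z : ℝ × ℝ => u z.1 z.2) (Icc 0 T ×ˢ Icc c1 c2)) :
    Tendsto (fun j => ∫ z, (Qe T c1 c2 (3 * h j)).indicator (ue T c1 c2 (h j) u) z *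
      ∫ w, k j (z - w) * 1 ∂N) atTop (𝓝 (∫ z, u z.1 z.2 ∂N)) := by
  have hQc : IsCompact (Icc (0:ℝ) T ×ˢ Icc c1 c2) := isCompact_Icc.prod isCompact_Icc
  obtain ⟨M, hM⟩ := hQc.exists_bound_of_continuousOn hu
  have hM0 : 0 ≤ M := (norm_nonneg _).trans (hM (0, c1) ⟨⟨le_rfl, hT.le⟩, le_rfl, hc.le⟩)
  have hBM : ∀ j, BM ((Qe T c1 c2 (3 * h j)).indicator (ue T c1 c2 (h j) u)) := fun j =>
    ind_BM (ue_cont hT hc hu)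
  simp_rw [fun j => conv_fubini (N := N) (H.kBM j) (hBM j)]
  have hk1 : ∀ j w, ∫ z, k j (z - w) = 1 := fun j w => by
    rw [integral_sub_right_eq_self (k j) w]; exact H.kint j
  have hii : ∀ j w, Integrable (fun z => (Qe T c1 c2 (3 * h j)).indicator (ue T c1 c2 (h j) u) z * k j (z - w)) :=
    fun j w => ((hBM j).mul ((H.kBM j).shift' w)).integrable
  have hal : ∀ j z, z ∈ Qe T c1 c2 (3 * h j) →
      al T c1 c2 (h j) z ∈ Icc 0 T ×ˢ Icc c1 c2 ∧ ‖al T c1 c2 (h j) z - z‖ ≤ 3 * h j :=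
    fun j z hz => al_mem hT hc (H.hpos j) hz
  refine tendsto_integral_of_dominated_convergence (fun _ => M) (fun j => ?_) (integrable_const _)
    (fun j => Eventually.of_forall fun w => ?_) ?_
  · have hm1 := (hBM j).meas
    have hm2 := (H.kBM j).meas
    have : StronglyMeasurable (fun q : (ℝ × ℝ) × (ℝ × ℝ) =>
        (Qe T c1 c2 (3 * h j)).indicator (ue T c1 c2 (h j) u) q.2 * k j (q.2 - q.1)) :=
      (show Measurable _ by fun_prop).stronglyMeasurable
    exact (this.integral_prod_right' (ν := volume)).aestronglyMeasurable
  · have : M = ∫ z, M * k j (z - w) := by rw [integral_const_mul, hk1, mul_one]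
    rw [this]
    refine norm_integral_le_of_norm_le (((H.kBM j).shift' w).integrable.const_mul M)
      (Eventually.of_forall fun z => ?_)
    rw [norm_mul, Real.norm_eq_abs (k j _), abs_of_nonneg (H.knn j _)]
    refine mul_le_mul_of_nonneg_right ?_ (H.knn j _)
    by_cases hz : z ∈ Qe T c1 c2 (3 * h j)
    · rw [indicator_of_mem hz, ue_eq hT hc (H.hpos j) u hz]
      exact hM _ (hal j z hz).1
    · simp [hz, hM0]
  · filter_upwards [measure_eq_zero_iff_ae_notMem.1 hN] with w hw
    have hw : w ∈ Icc 0 T ×ˢ Icc c1 c2 := by simpa using hw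
    rw [Metric.tendsto_atTop]
    intro ε hε
    obtain ⟨δ, hδ, hδ2⟩ := Metric.continuousWithinAt_iff.1 (hu w hw) (ε / 2) (by positivity)
    obtain ⟨n, hn⟩ := eventually_atTop.1 (H.hlim.eventually (gt_mem_nhds (show 0 < δ / 6 by positivity)))
    refine ⟨n, fun j hj => ?_⟩
    have hjδ := hn j hj
    have e1 : ∫ z, (ε / 2) * k j (z - w) = ε / 2 := by rw [integral_const_mul, hk1, mul_one]
    have e2 : ∫ z, u w.1 w.2 * k j (z - w) = u w.1 w.2 := by rw [integral_const_mul, hk1, mul_one]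
    have hi2 : Integrable (fun z => u w.1 w.2 * k j (z - w)) :=
      ((H.kBM j).shift' w).integrable.const_mul _
    rw [dist_eq_norm, ← e2, ← integral_sub (hii j w) hi2]
    refine lt_of_le_of_lt ?_ (half_lt_self hε)
    rw [← e1]
    refine norm_integral_le_of_norm_le (((H.kBM j).shift' w).integrable.const_mul _)
      (Eventually.of_forall fun z => ?_)
    rw [← sub_mul, norm_mul, Real.norm_eq_abs (k j _), abs_of_nonneg (H.knn j _)]
    by_cases hkz : k j (z - w) = 0
    · simp [hkz]
    refine mul_le_mul_of_nonneg_right ?_ (H.knn j _)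
    have hzw := H.ksupp j _ hkz
    have hp := H.hpos j
    have hz : z ∈ Qe T c1 c2 (3 * h j) := by
      have h1 := hzw
      rw [Prod.norm_def, max_le_iff, Real.norm_eq_abs, Real.norm_eq_abs, abs_le, abs_le] at h1
      simp only [Prod.fst_sub, Prod.snd_sub] at h1
      obtain ⟨⟨a1, a2⟩, ⟨a3, a4⟩⟩ := hw
      exact ⟨⟨by linarith, by linarith⟩, ⟨by linarith, by linarith⟩⟩
    rw [indicator_of_mem hz, ue_eq hT hc hp u hz]
    have := hδ2 (hal j z hz).1 (by
      rw [dist_eq_norm]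
      have h3 := norm_add_le (al T c1 c2 (h j) z - z) (z - w)
      rw [sub_add_sub_cancel] at h3
      have := (hal j z hz).2
      linarith)
    rw [dist_eq_norm] at this
    exact this.le
end

end

section

section
variable {T c1 c2 c0 C B lam : ℝ} {N : Measure (ℝ × ℝ)} {a b p : ℝ × ℝ → ℝ} {R0 : ℝ}
    {h : ℕ → ℝ} {k P f0 : ℕ → ℝ × ℝ → ℝ} {R : ℕ → ℝ}

lemma ratio_lim {L : ℝ} (hL : 0 < L) {h : ℕ → ℝ} (hl : Tendsto h atTop (𝓝 0)) :
    Tendsto (fun j => L / (L + 6 * h j)) atTop (𝓝 1) := by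
  have h1 : Tendsto (fun j => L + 6 * h j) atTop (𝓝 L) := by
    simpa using tendsto_const_nhds.add (hl.const_mul 6)
  have := (tendsto_const_nhds (x := L)).div h1 hL.ne'
  rwa [div_self hL.ne'] at this

lemma ratio_le {L h : ℝ} (hL : 0 < L) (hh : 0 < h) : 0 ≤ L / (L + 6 * h) ∧ L / (L + 6 * h) ≤ 1 := by
  have : 0 < L + 6 * h := by linarith
  exact ⟨by positivity, (div_le_one this).2 (by linarith)⟩

lemma aop_ind {h : ℝ} (hh : 0 < h) (a b w : ℝ × ℝ → ℝ) {z : ℝ × ℝ} (hz : z ∈ Qe T c1 c2 (2 * h)) :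
    Aop h lam a b ((Qe T c1 c2 (3 * h)).indicator w) z = Aop h lam a b w z := by
  have hz3 : z ∈ Qe T c1 c2 (3 * h) := Qe_mono (by linarith) hz
  obtain ⟨⟨z1, z2⟩, z3, z4⟩ := hz
  have hzt : z + (h, 0) ∈ Qe T c1 c2 (3 * h) :=
    ⟨⟨by simp; linarith, by simp; linarith⟩, by simp; linarith, by simp; linarith⟩
  have hzx : z + (0, h) ∈ Qe T c1 c2 (3 * h) :=
    ⟨⟨by simp; linarith, by simp; linarith⟩, by simp; linarith, by simp; linarith⟩
  have hzx' : z - (0, h) ∈ Qe T c1 c2 (3 * h) :=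
    ⟨⟨by simp; linarith, by simp; linarith⟩, by simp; linarith, by simp; linarith⟩
  simp only [Aop, Dt, Dx, Dxx, indicator_of_mem hz3, indicator_of_mem hzt, indicator_of_mem hzx,
    indicator_of_mem hzx']

lemma Y_lim (hT : 0 < T) (hc : c1 < c2) (ha : Measurable a) (hb : Measurable b)
    (hab : ∀ z, |a z| ≤ C) (hbb : ∀ z, |b z| ≤ B) (hp : ∀ j, 0 < h j) (hl : Tendsto h atTop (𝓝 0))
    {u ut ux uxx : ℝ → ℝ → ℝ} (hu : IsCb12 T (Ioo c1 c2) u ut ux uxx) :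
    (∀ j, MemLp ((Qe T c1 c2 (2 * h j)).indicator
      (Aop (h j) lam a b ((Qe T c1 c2 (3 * h j)).indicator (ue T c1 c2 (h j) u)))) 2) ∧
    MemLp ((Icc 0 T ×ˢ Icc c1 c2).indicator fun z : ℝ × ℝ =>
      (ut z.1 z.2 - lam * u z.1 z.2 + b z * ux z.1 z.2 + a z * uxx z.1 z.2)) 2 ∧
    Tendsto (fun j => ∫ z, ((Qe T c1 c2 (2 * h j)).indicator
      (Aop (h j) lam a b ((Qe T c1 c2 (3 * h j)).indicator (ue T c1 c2 (h j) u))) z -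
      (Icc 0 T ×ˢ Icc c1 c2).indicator (fun z : ℝ × ℝ =>
      (ut z.1 z.2 - lam * u z.1 z.2 + b z * ux z.1 z.2 + a z * uxx z.1 z.2)) z) ^ 2) atTop (𝓝 0) := by
  have hcl : closure (Ioo c1 c2) = Icc c1 c2 := closure_Ioo hc.ne
  obtain ⟨M, hM⟩ := hu.bdd
  have k0 := hu.cont; have k1 := hu.cont_t; have k2 := hu.cont_x; have k3 := hu.cont_xx
  rw [hcl] at k0 k1 k2 k3 hM
  set Q : Set (ℝ × ℝ) := Icc 0 T ×ˢ Icc c1 c2 with hQ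
  set y : ℝ × ℝ → ℝ := fun z =>
      (ut z.1 z.2 - lam * u z.1 z.2 + b z * ux z.1 z.2 + a z * uxx z.1 z.2) with hy
  have hB0 : 0 ≤ B := (abs_nonneg _).trans (hbb 0)
  have hC0 : 0 ≤ C := (abs_nonneg _).trans (hab 0)
  have hM0 : 0 ≤ M := (abs_nonneg _).trans (hM 0 ⟨le_rfl, hT.le⟩ c1 ⟨le_rfl, hc.le⟩).1
  set M' := M + |lam| * M + B * M + C * M with hM'
  have hM'0 : 0 ≤ M' := by positivity
  have hbd : ∀ (z : ℝ × ℝ) (v1 v2 v3 v4 : ℝ), |v1| ≤ M → |v2| ≤ M → |v3| ≤ M → |v4| ≤ M →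
      |v1 - lam * v2 + b z * v3 + a z * v4| ≤ M' := by
    intro z v1 v2 v3 v4 h1 h2 h3 h4
    calc |v1 - lam * v2 + b z * v3 + a z * v4| ≤ |v1| + |lam| * |v2| + |b z| * |v3| + |a z| * |v4| := by
          rw [← abs_mul, ← abs_mul, ← abs_mul]
          refine (abs_add_le _ _).trans (add_le_add_left ?_ _)
          refine (abs_add_le _ _).trans (add_le_add_left ?_ _)
          exact abs_sub _ _
      _ ≤ M' := by
          have i1 := hbb z; have i2 := hab z
          rw [hM']
          gcongr
  have hrep : ∀ j (z : ℝ × ℝ), z ∈ Qe T c1 c2 (2 * h j) → ∃ w0 ∈ Q, ∃ w1 ∈ Q, ∃ w2 ∈ Q, ∃ w3 ∈ Q,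
      ‖w0 - z‖ ≤ 4 * h j ∧ ‖w1 - z‖ ≤ 4 * h j ∧ ‖w2 - z‖ ≤ 4 * h j ∧ ‖w3 - z‖ ≤ 4 * h j ∧
      Aop (h j) lam a b ((Qe T c1 c2 (3 * h j)).indicator (ue T c1 c2 (h j) u)) z =
        T / (T + 6 * h j) * ut w1.1 w1.2 - lam * u w0.1 w0.2 +
        b z * ((c2 - c1) / (c2 - c1 + 6 * h j) * ux w2.1 w2.2) +
        a z * (((c2 - c1) / (c2 - c1 + 6 * h j)) ^ 2 * uxx w3.1 w3.2) := by
    intro j z hz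
    obtain ⟨⟨w1, h1, d1, e1⟩, ⟨w2, h2, d2, e2⟩, ⟨w3, h3, d3, e3⟩⟩ := quots hT hc (hp j) hu hz
    have hz3 : z ∈ Qe T c1 c2 (3 * h j) := Qe_mono (by linarith [hp j]) hz
    obtain ⟨h0, d0⟩ := al_mem hT hc (hp j) hz3
    refine ⟨_, h0, w1, h1, w2, h2, w3, h3, by linarith [hp j], d1, d2, d3, ?_⟩
    rw [aop_ind (hp j) a b _ hz]
    unfold Aop
    rw [e1, e2, e3, ue_eq hT hc (hp j) u hz3]
    rfl
  obtain ⟨H, hH⟩ := hl.bddAbove_range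
  have hH : ∀ j, h j ≤ H := fun j => hH ⟨j, rfl⟩
  have hL : 0 < c2 - c1 := by linarith
  have hYb : ∀ j z, |(Qe T c1 c2 (2 * h j)).indicator
      (Aop (h j) lam a b ((Qe T c1 c2 (3 * h j)).indicator (ue T c1 c2 (h j) u))) z| ≤
      (Qe T c1 c2 (2 * H)).indicator (fun _ => M') z := by
    intro j z
    by_cases hz : z ∈ Qe T c1 c2 (2 * h j)
    · rw [indicator_of_mem hz, indicator_of_mem (Qe_mono (by linarith [hH j]) hz)]
      obtain ⟨w0, h0, w1, h1, w2, h2, w3, h3, -, -, -, -, e⟩ := hrep j z hz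
      rw [e]
      obtain ⟨r1, r2⟩ := ratio_le hT (hp j)
      obtain ⟨r3, r4⟩ := ratio_le hL (hp j)
      refine hbd z _ _ _ _ ?_ (hM _ h0.1 _ h0.2).1 ?_ ?_
      · rw [abs_mul, abs_of_nonneg r1]
        exact (mul_le_of_le_one_left (abs_nonneg _) r2).trans (hM _ h1.1 _ h1.2).2.1
      · rw [abs_mul, abs_of_nonneg r3]
        exact (mul_le_of_le_one_left (abs_nonneg _) r4).trans (hM _ h2.1 _ h2.2).2.2.1
      · rw [abs_mul, abs_of_nonneg (sq_nonneg _)]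
        exact (mul_le_of_le_one_left (abs_nonneg _) (pow_le_one₀ r3 r4)).trans (hM _ h3.1 _ h3.2).2.2.2
    · rw [indicator_of_notMem hz, abs_zero]
      exact indicator_nonneg (fun _ _ => hM'0) _
  have hH0 : 0 < H := (hp 0).trans_le (hH 0)
  have hyb : ∀ z, |Q.indicator y z| ≤ (Qe T c1 c2 (2 * H)).indicator (fun _ => M') z := by
    intro z
    by_cases hz : z ∈ Q
    · have hz' : z ∈ Qe T c1 c2 (2 * H) := Qe_mono (e := 0) (by linarith) (by rw [Qe_zero]; exact hz)
      rw [indicator_of_mem hz, indicator_of_mem hz']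
      obtain ⟨m1, m2, m3, m4⟩ := hM _ hz.1 _ hz.2
      exact hbd z _ _ _ _ m2 m1 m3 m4
    · rw [indicator_of_notMem hz, abs_zero]
      exact indicator_nonneg (fun _ _ => hM'0) _
  have hGB : BM ((Qe T c1 c2 (2 * H)).indicator fun _ => M') := ind_BM continuous_const
  have hYm : ∀ j, Measurable ((Qe T c1 c2 (2 * h j)).indicator
      (Aop (h j) lam a b ((Qe T c1 c2 (3 * h j)).indicator (ue T c1 c2 (h j) u)))) := fun j =>
    (((ind_BM (ue_cont hT hc k0)).aop (h j) lam ha hb ⟨C, hab⟩ ⟨B, hbb⟩).meas).indicator (Qe_meas _ _ _ _)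
  have hQm : MeasurableSet Q := measurableSet_Icc.prod measurableSet_Icc
  have hym : Measurable (Q.indicator y) := by
    have hg : ∀ {g : ℝ → ℝ → ℝ}, ContinuousOn (fun z : ℝ × ℝ => g z.1 z.2) Q →
        Measurable (fun z => g (pr T c1 c2 z).1 (pr T c1 c2 z).2) := fun hg =>
      (hg.comp_continuous (pr_cont T c1 c2) fun z => pr_mem hT.le hc.le z).measurable
    have : Q.indicator y = Q.indicator (fun z => ut (pr T c1 c2 z).1 (pr T c1 c2 z).2 -
        lam * u (pr T c1 c2 z).1 (pr T c1 c2 z).2 + b z * ux (pr T c1 c2 z).1 (pr T c1 c2 z).2 +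
        a z * uxx (pr T c1 c2 z).1 (pr T c1 c2 z).2) := by
      refine indicator_congr fun z hz => ?_
      rw [pr_id hz]
    rw [this]
    exact ((((hg k1).sub ((hg k0).const_mul lam)).add (hb.mul (hg k2))).add (ha.mul (hg k3))).indicator hQm
  refine ⟨fun j => hGB.memLp.mono (hYm j).aestronglyMeasurable (Eventually.of_forall fun z =>
      (hYb j z).trans (le_abs_self _)), hGB.memLp.mono hym.aestronglyMeasurable (Eventually.of_forall fun z =>
      (hyb z).trans (le_abs_self _)), ?_⟩
  have hlim := tendsto_integral_of_dominated_convergence (μ := volume)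
    (F := fun j z => ((Qe T c1 c2 (2 * h j)).indicator
      (Aop (h j) lam a b ((Qe T c1 c2 (3 * h j)).indicator (ue T c1 c2 (h j) u))) z -
      Q.indicator y z) ^ 2) (f := fun _ => 0)
    (fun z => (2 * (Qe T c1 c2 (2 * H)).indicator (fun _ => M') z) ^ 2) ?_ ?_ ?_ ?_
  · simpa using hlim
  · exact fun j => (((hYm j).sub hym).pow_const 2).aestronglyMeasurable
  · simp_rw [mul_pow]
    exact (sq_int hGB.memLp).const_mul _
  · refine fun j => Eventually.of_forall fun z => ?_
    rw [Real.norm_eq_abs, abs_of_nonneg (sq_nonneg _)]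
    refine sq_le_sq' ?_ ?_ <;> have := abs_le.1 (hYb j z) <;> have := abs_le.1 (hyb z) <;> linarith
  · refine Eventually.of_forall fun z => ?_
    have : Tendsto (fun j => (Qe T c1 c2 (2 * h j)).indicator
      (Aop (h j) lam a b ((Qe T c1 c2 (3 * h j)).indicator (ue T c1 c2 (h j) u))) z) atTop
        (𝓝 (Q.indicator y z)) := by
      by_cases hz : z ∈ Q
      · have hzj : ∀ j, z ∈ Qe T c1 c2 (2 * h j) := fun j => Qe_mono (e := 0) (by linarith [hp j]) (by rw [Qe_zero]; exact hz)
        choose w0 h0 w1 h1 w2 h2 w3 h3 d0 d1 d2 d3 e using fun j => hrep j z (hzj j)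
        rw [indicator_of_mem hz]
        refine Tendsto.congr (fun j => ((indicator_of_mem (hzj j) _).trans (e j)).symm) ?_
        have t0 := tendsto_on k0 hz hl 4 h0 d0
        have t1 := tendsto_on k1 hz hl 4 h1 d1
        have t2 := tendsto_on k2 hz hl 4 h2 d2
        have t3 := tendsto_on k3 hz hl 4 h3 d3
        have r1 := ratio_lim hT hl
        have r2 := ratio_lim hL hl
        have := (((r1.mul t1).sub (t0.const_mul lam)).add ((r2.mul t2).const_mul (b z))).add
          (((r2.pow 2).mul t3).const_mul (a z))
        simpa [hy] using this
      · rw [indicator_of_notMem hz]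
        obtain ⟨e, he, hze⟩ := notMem_Qe hz
        refine tendsto_const_nhds.congr' ?_
        have : ∀ᶠ j in atTop, h j < e / 2 := hl.eventually_lt_const (by linarith)
        filter_upwards [this] with j hj
        rw [indicator_of_notMem fun h' => hze (Qe_mono (by linarith) h')]
    have := (this.sub_const (Q.indicator y z)).pow 2
    simpa using this

lemma core0 (hT : 0 < T) (hc : c1 < c2) (hc0 : 0 < c0) {μ : Measure (ℝ × ℝ)}
    [IsFiniteMeasure N] [IsFiniteMeasure μ] (hN : N (Icc 0 T ×ˢ Icc c1 c2)ᶜ = 0)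
    (hμ : μ (Icc 0 T ×ˢ Icc c1 c2)ᶜ = 0)
    {p a b a' b' : ℝ × ℝ → ℝ} (hpm : Measurable p) (hpL : MemLp p 2) (hp0 : ∀ z, 0 ≤ p z)
    (hpQ : ∀ z, z ∉ Icc 0 T ×ˢ Icc c1 c2 → p z = 0)
    (ha : Measurable a) (hb : Measurable b) (ha' : Measurable a') (hb' : Measurable b')
    (haC : ∀ z, |a z| ≤ C) (hbB : ∀ z, |b z| ≤ B)
    (ha1 : ∀ z, c0 ≤ a' z) (ha2 : ∀ z, a' z ≤ C) (hb1 : ∀ z, |b' z| ≤ B)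
    (hFP : FPd T c1 c2 (B ^ 2 / c0 + 1) N μ p a b) :
    ∃ (p' : ℝ × ℝ → ℝ) (μ' : Measure (ℝ × ℝ)), Measurable p' ∧ MemLp p' 2 ∧ (∀ z, 0 ≤ p' z) ∧
      (∀ z, z ∉ Icc 0 T ×ˢ Icc c1 c2 → p' z = 0) ∧ IsFiniteMeasure μ' ∧
      μ' (Icc 0 T ×ˢ Icc c1 c2)ᶜ = 0 ∧ FPd T c1 c2 (B ^ 2 / c0 + 1) N μ' p' a' b' ∧
      ∫ z, (p' z - p z) ^ 2 ≤
        Kst c0 C B * ((∫ z, ((a z - a' z) * p z) ^ 2) + ∫ z, ((b z - b' z) * p z) ^ 2) := by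
  obtain ⟨h, k, P, f0, R, H⟩ := exists_approx hc hc0 hN hμ hpm hpL hp0 hpQ ha hb ha' hb' haC hbB
    ha1 ha2 hb1 hFP
  obtain ⟨p', q1, q2, q3, q4, q5, q6⟩ := approx_limit hpL H.toWL
  set lam := B ^ 2 / c0 + 1 with hlam
  have hlam0 : 0 ≤ lam := by positivity
  have ha'C : ∀ z, |a' z| ≤ C := fun z => abs_le.2 ⟨by linarith [ha1 z, ha2 z], ha2 z⟩
  have hbd : ∀ j w ε, 0 ≤ ε → Continuous w → (∀ z ∈ Qe T c1 c2 (3 * h j), |w z| ≤ ε) →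
      |nu T c1 c2 lam a' b' (h j) (P j) (fun z => ∫ w, k j (z - w) * 1 ∂N) w| ≤ N.real univ * ε := by
    intro j w ε hε hw hwε
    obtain ⟨g1, g2, g3⟩ := g0_facts hN H.toKP j
    exact nu_bound (H.hpos j) hlam0 ha' hb' ⟨C, ha'C⟩ ⟨B, hb1⟩ (H.PL j) (H.Pnn j) (H.Psupp j) g1 g2 g3
      (H.pos j) w ε hε hw hwε
  obtain ⟨μ', fin, hμ', hlim⟩ := rmk_lim hT hc (D := N.real univ)
    (fun j => nu T c1 c2 lam a' b' (h j) (P j) (fun z => ∫ w, k j (z - w) * 1 ∂N))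
    (fun j v w hv hw => nu_add ha' hb' ⟨C, ha'C⟩ ⟨B, hb1⟩ (H.PL j) (g0_facts hN H.toKP j).1 v w hv hw)
    (fun j c w _ => nu_smul c w)
    (fun j w hw hw0 => H.pos j _ (ind_BM hw) fun z => indicator_nonneg (fun z _ => hw0 z) z)
    (fun j w ε hw hwε => hbd j w ε ((abs_nonneg _).trans (hwε 0)) hw fun z _ => hwε z)
  refine ⟨p', μ', q1, q2, q3, q4, fin, hμ', ?_, q5⟩
  intro u ut ux uxx hu
  have hcl : closure (Ioo c1 c2) = Icc c1 c2 := closure_Ioo hc.ne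
  have k0 := hu.cont
  rw [hcl] at k0
  obtain ⟨y1, y2, y3⟩ := Y_lim (lam := lam) hT hc ha' hb' ha'C hb1 H.hpos H.hlim hu
  have l1 := q6 _ _ y1 y2 y3
  have l2 := (lim_N hT hc hN H.toKP k0).mono_left Nat.hyperfilter_le_atTop
  have l3 := hlim _ k0
  have l4 := l1.add l2
  have e1 : ∀ j, ∫ z, (Qe T c1 c2 (2 * h j)).indicator
      (Aop (h j) lam a' b' ((Qe T c1 c2 (3 * h j)).indicator (ue T c1 c2 (h j) u))) z * P j z =
      ∫ z, Aop (h j) lam a' b' ((Qe T c1 c2 (3 * h j)).indicator (ue T c1 c2 (h j) u)) z * P j z := by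
    intro j; congr 1; ext z
    by_cases hz : z ∈ Qe T c1 c2 (2 * h j)
    · rw [indicator_of_mem hz]
    · rw [H.Psupp j z hz]; simp
  have e2 : ∫ z, (Icc 0 T ×ˢ Icc c1 c2).indicator (fun z : ℝ × ℝ =>
      (ut z.1 z.2 - lam * u z.1 z.2 + b' z * ux z.1 z.2 + a' z * uxx z.1 z.2)) z * p' z =
      ∫ z : ℝ × ℝ, (ut z.1 z.2 - lam * u z.1 z.2 + b' z * ux z.1 z.2 + a' z * uxx z.1 z.2) * p' z := by
    congr 1; ext z
    by_cases hz : z ∈ Icc 0 T ×ˢ Icc c1 c2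
    · rw [indicator_of_mem hz]
    · rw [q4 z hz]; simp
  simp_rw [e1] at l4
  rw [e2] at l4
  have hd : Tendsto (fun j => nu T c1 c2 lam a' b' (h j) (P j) (fun z => ∫ w, k j (z - w) * 1 ∂N)
      (ue T c1 c2 (h j) u) - nu T c1 c2 lam a' b' (h j) (P j) (fun z => ∫ w, k j (z - w) * 1 ∂N)
      (fun z => u (pr T c1 c2 z).1 (pr T c1 c2 z).2)) atTop (𝓝 0) := by
    have hQc : IsCompact (Icc (0:ℝ) T ×ˢ Icc c1 c2) := isCompact_Icc.prod isCompact_Icc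
    have huc := hQc.uniformContinuousOn_of_continuous k0
    rw [Metric.uniformContinuousOn_iff] at huc
    have hcp : Continuous (fun z => u (pr T c1 c2 z).1 (pr T c1 c2 z).2) :=
      k0.comp_continuous (pr_cont T c1 c2) fun z => pr_mem hT.le hc.le z
    rw [Metric.tendsto_atTop]
    intro ε hε
    have hN0 : 0 ≤ N.real univ := measureReal_nonneg
    obtain ⟨δ, hδ, hδ'⟩ := huc (ε / (N.real univ + 1) ) (by positivity)
    obtain ⟨n, hn⟩ := eventually_atTop.1 (H.hlim.eventually_lt_const (show 0 < δ / 6 by positivity))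
    refine ⟨n, fun j hj => ?_⟩
    have hcu := ue_cont (h := h j) hT hc k0
    have e3 : nu T c1 c2 lam a' b' (h j) (P j) (fun z => ∫ w, k j (z - w) * 1 ∂N)
      (ue T c1 c2 (h j) u) - nu T c1 c2 lam a' b' (h j) (P j) (fun z => ∫ w, k j (z - w) * 1 ∂N)
      (fun z => u (pr T c1 c2 z).1 (pr T c1 c2 z).2) = nu T c1 c2 lam a' b' (h j) (P j)
        (fun z => ∫ w, k j (z - w) * 1 ∂N) (ue T c1 c2 (h j) u + (-1 : ℝ) • fun z => u (pr T c1 c2 z).1 (pr T c1 c2 z).2) := by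
      rw [nu_add ha' hb' ⟨C, ha'C⟩ ⟨B, hb1⟩ (H.PL j) (g0_facts hN H.toKP j).1 _ _ hcu (hcp.const_smul _), nu_smul]
      ring
    rw [dist_zero_right, Real.norm_eq_abs, e3]
    refine lt_of_le_of_lt (hbd j _ (ε / (N.real univ + 1)) (by positivity) (hcu.add (hcp.const_smul _)) fun z hz => ?_) ?_
    · obtain ⟨h0, d0⟩ := al_mem hT hc (H.hpos j) hz
      have d1 := pr_dist (by linarith [H.hpos j]) hT.le hc.le hz
      have := hδ' _ h0 _ (pr_mem hT.le hc.le z) (by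
        rw [dist_eq_norm]
        have : al T c1 c2 (h j) z - pr T c1 c2 z = (al T c1 c2 (h j) z - z) - (pr T c1 c2 z - z) := by abel
        rw [this]
        refine (norm_sub_le _ _).trans_lt ?_
        linarith [hn j hj])
      simp only [Pi.add_apply, Pi.smul_apply, smul_eq_mul, ue]
      rw [pr_id h0]
      rw [Real.dist_eq] at this
      rw [neg_one_mul, ← sub_eq_add_neg]
      exact this.le
    · rw [mul_div_assoc', div_lt_iff₀ (by positivity)]
      nlinarith
  have l5 := l4.sub (hd.mono_left Nat.hyperfilter_le_atTop)
  refine tendsto_nhds_unique l3 ?_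
  convert l5 using 2
  · simp only [nu]; ring
  · ring

end

end

section

section
variable {T c1 c2 c0 C B lam : ℝ} {N : Measure (ℝ × ℝ)} {a b p : ℝ × ℝ → ℝ}

lemma isCb12_exp (hc : c1 < c2) (s : ℝ) {u ut ux uxx : ℝ → ℝ → ℝ} (hT : 0 < T)
    (hu : IsCb12 T (Ioo c1 c2) u ut ux uxx) :
    IsCb12 T (Ioo c1 c2) (fun t x => Real.exp (-s * t) * u t x)
      (fun t x => Real.exp (-s * t) * (ut t x - s * u t x))
      (fun t x => Real.exp (-s * t) * ux t x) (fun t x => Real.exp (-s * t) * uxx t x) := by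
  have hE : ContinuousOn (fun z : ℝ × ℝ => Real.exp (-s * z.1)) (Icc 0 T ×ˢ closure (Ioo c1 c2)) := by
    fun_prop
  have c1' := hE.mul hu.cont
  have c2' := hE.mul (hu.cont_t.sub (continuousOn_const (c := s) |>.mul hu.cont))
  have c3' := hE.mul hu.cont_x
  have c4' := hE.mul hu.cont_xx
  refine ⟨c1', c2', c3', c4', ?_, ?_, ?_, ?_⟩
  · intro t ht x hx
    have h1 : HasDerivAt (fun t => Real.exp (-s * t)) (Real.exp (-s * t) * (-s)) t := by
      have := ((hasDerivAt_id t).const_mul (-s)).exp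
      simpa using this
    refine (h1.hasDerivWithinAt.mul (hu.deriv_t t ht x hx)).congr_deriv ?_
    ring
  · intro t ht x hx
    exact (hu.deriv_x t ht x hx).const_mul _
  · intro t ht x hx
    exact (hu.deriv_xx t ht x hx).const_mul _
  · have hQ : IsCompact (Icc 0 T ×ˢ closure (Ioo c1 c2)) := by
      rw [closure_Ioo hc.ne]; exact isCompact_Icc.prod isCompact_Icc
    obtain ⟨M1, m1⟩ := hQ.exists_bound_of_continuousOn c1'
    obtain ⟨M2, m2⟩ := hQ.exists_bound_of_continuousOn c2'
    obtain ⟨M3, m3⟩ := hQ.exists_bound_of_continuousOn c3'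
    obtain ⟨M4, m4⟩ := hQ.exists_bound_of_continuousOn c4'
    refine ⟨max (max M1 M2) (max M3 M4), fun t ht x hx => ⟨?_, ?_, ?_, ?_⟩⟩
    · exact (m1 (t, x) ⟨ht, hx⟩).trans ((le_max_left _ _).trans (le_max_left _ _))
    · exact (m2 (t, x) ⟨ht, hx⟩).trans ((le_max_right _ _).trans (le_max_left _ _))
    · exact (m3 (t, x) ⟨ht, hx⟩).trans ((le_max_left _ _).trans (le_max_right _ _))
    · exact (m4 (t, x) ⟨ht, hx⟩).trans ((le_max_right _ _).trans (le_max_right _ _))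

/-- discounted measure -/
def dm (s : ℝ) (μ : Measure (ℝ × ℝ)) : Measure (ℝ × ℝ) :=
  μ.withDensity fun z => ENNReal.ofReal (Real.exp (-s * z.1))

lemma dm_integral (s : ℝ) (μ : Measure (ℝ × ℝ)) (f : ℝ × ℝ → ℝ) :
    ∫ z, f z ∂(dm s μ) = ∫ z, Real.exp (-s * z.1) * f z ∂μ := by
  unfold dm
  rw [integral_withDensity_eq_integral_toReal_smul (by fun_prop) (by simp)]
  congr 1; ext z
  rw [ENNReal.toReal_ofReal (Real.exp_pos _).le, smul_eq_mul]

lemma dm_null (s : ℝ) {μ : Measure (ℝ × ℝ)} {S : Set (ℝ × ℝ)} (h : μ S = 0) : dm s μ S = 0 :=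
  withDensity_absolutelyContinuous _ _ h

lemma exp_bd {s t : ℝ} (ht : t ∈ Icc 0 T) : Real.exp (-s * t) ≤ Real.exp (|s| * T) := by
  refine Real.exp_le_exp.2 ((le_abs_self _).trans ?_)
  rw [abs_mul, abs_neg]
  refine mul_le_mul_of_nonneg_left ?_ (abs_nonneg _)
  rw [abs_of_nonneg ht.1]; exact ht.2

lemma dm_fin (s : ℝ) {μ : Measure (ℝ × ℝ)} [IsFiniteMeasure μ] (hμ : μ (Icc 0 T ×ˢ Icc c1 c2)ᶜ = 0) :
    IsFiniteMeasure (dm s μ) := by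
  refine isFiniteMeasure_withDensity_ofReal (Integrable.hasFiniteIntegral (μ := μ) ?_)
  refine Integrable.of_bound (by fun_prop) (Real.exp (|s| * T)) ?_
  filter_upwards [measure_eq_zero_iff_ae_notMem.1 hμ] with z hz
  have hz : z ∈ Icc 0 T ×ˢ Icc c1 c2 := by simpa using hz
  rw [Real.norm_eq_abs, abs_of_pos (Real.exp_pos _)]
  exact exp_bd hz.1

lemma FPd_shift (hT : 0 < T) (hc : c1 < c2) (s : ℝ) {μ : Measure (ℝ × ℝ)}
    (hN0 : ∀ᵐ z ∂N, z.1 = 0) (h : FPd T c1 c2 lam N μ p a b) :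
    FPd T c1 c2 (lam + s) N (dm s μ) (fun z => Real.exp (-s * z.1) * p z) a b := by
  intro u ut ux uxx hu
  rw [dm_integral, h _ _ _ _ (isCb12_exp hc s hT hu)]
  congr 1
  · refine integral_congr_ae ?_
    filter_upwards [hN0] with z hz
    simp [hz]
  · congr 1; ext z; ring

lemma core (hT : 0 < T) (hc : c1 < c2) (hc0 : 0 < c0) {μ : Measure (ℝ × ℝ)}
    [IsFiniteMeasure N] [IsFiniteMeasure μ] (hN : N (Icc 0 T ×ˢ Icc c1 c2)ᶜ = 0)
    (hN0 : ∀ᵐ z ∂N, z.1 = 0)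
    (hμ : μ (Icc 0 T ×ˢ Icc c1 c2)ᶜ = 0)
    {p a b a' b' : ℝ × ℝ → ℝ} (hpm : Measurable p) (hpL : MemLp p 2) (hp0 : ∀ z, 0 ≤ p z)
    (hpQ : ∀ z, z ∉ Icc 0 T ×ˢ Icc c1 c2 → p z = 0)
    (ha : Measurable a) (hb : Measurable b) (ha' : Measurable a') (hb' : Measurable b')
    (haC : ∀ z, |a z| ≤ C) (hbB : ∀ z, |b z| ≤ B)
    (ha1 : ∀ z, c0 ≤ a' z) (ha2 : ∀ z, a' z ≤ C) (hb1 : ∀ z, |b' z| ≤ B)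
    (hFP : FPd T c1 c2 0 N μ p a b) :
    ∃ (p' : ℝ × ℝ → ℝ) (μ' : Measure (ℝ × ℝ)), Measurable p' ∧ MemLp p' 2 ∧ (∀ z, 0 ≤ p' z) ∧
      (∀ z, z ∉ Icc 0 T ×ˢ Icc c1 c2 → p' z = 0) ∧ IsFiniteMeasure μ' ∧
      μ' (Icc 0 T ×ˢ Icc c1 c2)ᶜ = 0 ∧ FPd T c1 c2 0 N μ' p' a' b' ∧
      ∫ z, (p' z - p z) ^ 2 ≤ Real.exp ((B ^ 2 / c0 + 1) * T) ^ 2 *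
        (Kst c0 C B * ((∫ z, ((a z - a' z) * p z) ^ 2) + ∫ z, ((b z - b' z) * p z) ^ 2)) := by
  set lam := B ^ 2 / c0 + 1 with hlam
  have hlam0 : 0 ≤ lam := by positivity
  have hL : ∀ (s : ℝ) {q : ℝ × ℝ → ℝ}, Measurable q → MemLp q 2 → (∀ z, z ∉ Icc 0 T ×ˢ Icc c1 c2 → q z = 0) →
      MemLp (fun z : ℝ × ℝ => Real.exp (-s * z.1) * q z) 2 := by
    intro s q hq hqL hq0
    refine MemLp.mono (hqL.const_mul (Real.exp (|s| * T))) (by fun_prop) (Eventually.of_forall fun z => ?_)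
    by_cases hz : z ∈ Icc 0 T ×ˢ Icc c1 c2
    · rw [norm_mul, norm_mul, Real.norm_of_nonneg (Real.exp_pos (-s * z.1)).le,
        Real.norm_of_nonneg (Real.exp_pos (|s| * T)).le]
      exact mul_le_mul_of_nonneg_right (exp_bd hz.1) (norm_nonneg _)
    · simp [hq0 z hz]
  haveI := dm_fin lam hμ
  have h1 := FPd_shift hT hc lam hN0 hFP
  rw [zero_add] at h1
  obtain ⟨p', μ', q1, q2, q3, q4, q5, q6, q7, q8⟩ := core0 hT hc hc0 hN (dm_null lam hμ)
    (show Measurable (fun z : ℝ × ℝ => Real.exp (-lam * z.1) * p z) by fun_prop) (hL lam hpm hpL hpQ)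
    (fun z => mul_nonneg (Real.exp_pos _).le (hp0 z)) (fun z hz => by simp [hpQ z hz])
    ha hb ha' hb' haC hbB ha1 ha2 hb1 h1
  have h2 := FPd_shift hT hc (-lam) hN0 q7
  rw [← hlam, add_neg_cancel] at h2
  have hsm : ∀ {f f' : ℝ × ℝ → ℝ} {D : ℝ}, Measurable f → Measurable f' → (∀ z, |f z| ≤ D) → (∀ z, |f' z| ≤ D) →
      ∫ z, ((f z - f' z) * (Real.exp (-lam * z.1) * p z)) ^ 2 ≤ ∫ z, ((f z - f' z) * p z) ^ 2 := by
    intro f f' D hf hf' hD hD'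
    refine integral_mono_of_nonneg (Eventually.of_forall fun z => sq_nonneg _) ?_ (Eventually.of_forall fun z => ?_)
    · exact sq_int (MemLp.bmul hpL (hf.sub hf') (C := 2 * D) fun z => by
        have := abs_le.1 (hD z); have := abs_le.1 (hD' z)
        rw [abs_le]; constructor <;> linarith)
    · simp only
      by_cases hz : z ∈ Icc 0 T ×ˢ Icc c1 c2
      · have he : Real.exp (-lam * z.1) ≤ 1 := Real.exp_le_one_iff.2 (by nlinarith [hz.1.1])
        have he0 := (Real.exp_pos (-lam * z.1)).le
        have : ((f z - f' z) * (Real.exp (-lam * z.1) * p z)) ^ 2 =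
          Real.exp (-lam * z.1) ^ 2 * ((f z - f' z) * p z) ^ 2 := by ring
        rw [this]
        exact mul_le_of_le_one_left (sq_nonneg _) (pow_le_one₀ he0 he)
      · simp [hpQ z hz]
  have ha'C : ∀ z, |a' z| ≤ C := fun z => abs_le.2 ⟨by linarith [ha1 z, ha2 z], ha2 z⟩
  refine ⟨fun z => Real.exp (-(-lam) * z.1) * p' z, dm (-lam) μ', by fun_prop, hL (-lam) q1 q2 q4,
    fun z => mul_nonneg (Real.exp_pos _).le (q3 z), fun z hz => by simp [q4 z hz], dm_fin _ q6,
    dm_null _ q6, h2, ?_⟩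
  have e1 : ∫ z, (Real.exp (-(-lam) * z.1) * p' z - p z) ^ 2 ≤
      ∫ z, Real.exp (lam * T) ^ 2 * (p' z - Real.exp (-lam * z.1) * p z) ^ 2 := by
    refine integral_mono_of_nonneg (Eventually.of_forall fun z => sq_nonneg _)
      ((sq_int (q2.sub (hL lam hpm hpL hpQ))).const_mul _) (Eventually.of_forall fun z => ?_)
    simp only
    by_cases hz : z ∈ Icc 0 T ×ˢ Icc c1 c2
    · have he : Real.exp (-(-lam) * z.1) ≤ Real.exp (lam * T) := Real.exp_le_exp.2 (by nlinarith [hz.1.2])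
      have h0 : Real.exp (-(-lam) * z.1) * Real.exp (-lam * z.1) = 1 := by
        rw [← Real.exp_add]; simp
      have : (Real.exp (-(-lam) * z.1) * p' z - p z) = Real.exp (-(-lam) * z.1) *
          (p' z - Real.exp (-lam * z.1) * p z) := by
        rw [mul_sub, ← mul_assoc, h0, one_mul]
      rw [this, mul_pow]
      exact mul_le_mul_of_nonneg_right (pow_le_pow_left₀ (Real.exp_pos _).le he 2) (sq_nonneg _)
    · simp [q4 z hz, hpQ z hz]
  refine e1.trans ?_
  rw [integral_const_mul]
  refine mul_le_mul_of_nonneg_left (q8.trans ?_) (sq_nonneg _)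
  refine mul_le_mul_of_nonneg_left ?_ ?_
  · exact add_le_add (hsm ha ha' haC ha'C) (hsm hb hb' hbB hb1)
  · exact (Kst_pos hc0).le

end

end

section

/-- self convolved mollifiers -/
structure Auto (h : ℝ) (η ρ ρ' : ℝ → ℝ) : Prop where
  mη : Moll (-2 * h) (2 * h) η
  cρ : Continuous ρ
  cρ' : Continuous ρ'
  dρ : ∀ t, HasDerivAt ρ (ρ' t) t
  nn : ∀ t, 0 ≤ ρ t
  auto : ∀ s t, ∫ w, η (w - s) * η (w - t) = ρ (s - t)
  iρ : Integrable ρ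
  int : ∫ t, ρ t = 1
  even : ∀ t, ρ (-t) = ρ t
  odd : ∀ t, ρ' (-t) = - ρ' t

lemma exists_auto {h : ℝ} (hh : 0 < h) : ∃ η ρ ρ', Auto h η ρ ρ' := by
  let f : ContDiffBump (0 : ℝ) := ⟨h / 2, h, by positivity, by linarith⟩
  set η := f.normed volume with hη
  have hηe : ∀ s, η (-s) = η s := fun s => f.normed_neg s
  have hm : Moll (-2 * h) (2 * h) η := by
    refine ⟨f.continuous_normed, f.nonneg_normed, f.integral_normed, fun s hs => ?_⟩
    have : s ∈ Function.support (f.normed volume) := hs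
    rw [f.support_normed_eq, Metric.mem_ball, dist_zero_right, Real.norm_eq_abs] at this
    have := abs_le.1 this.le
    have h3 : f.rOut = h := rfl
    rw [h3] at this
    constructor <;> linarith [this.1, this.2]
  have hcd : ContDiff ℝ 1 η := f.contDiff_normed.of_le (by exact_mod_cast le_top)
  have hcs : HasCompactSupport η := hm.hcs
  set ρ : ℝ → ℝ := fun t => ∫ s, η s * η (t - s) with hρ
  have hρe : ρ = convolution η η (ContinuousLinearMap.lsmul ℝ ℝ) volume := rfl
  set ρ' : ℝ → ℝ := convolution η (deriv η) (ContinuousLinearMap.lsmul ℝ ℝ) volume with hρ'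
  have hli : LocallyIntegrable η := hm.integrable.locallyIntegrable
  have hd : ∀ t, HasDerivAt ρ (ρ' t) t := fun t => by
    rw [hρe]
    exact hcs.hasDerivAt_convolution_right _ hli hcd t
  have hev : ∀ t, ρ (-t) = ρ t := by
    intro t
    simp only [hρ]
    rw [← integral_neg_eq_self]
    congr 1; ext s
    rw [hηe, ← hηe (-t - -s)]; congr 2; ring
  refine ⟨η, ρ, ρ', hm, ?_, ?_, hd, ?_, ?_, ?_, ?_, hev, ?_⟩
  · exact continuous_iff_continuousAt.2 fun t => (hd t).continuousAt
  · exact hcs.deriv.continuous_convolution_right _ hli (hcd.continuous_deriv le_rfl)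
  · exact fun t => integral_nonneg fun s => mul_nonneg (hm.nn _) (hm.nn _)
  · intro s t
    rw [← hev, neg_sub]
    have := integral_sub_right_eq_self (μ := volume) (fun w => η w * η (t - s - w)) s
    rw [show ρ (t - s) = ∫ w, η w * η (t - s - w) from rfl, ← this]
    congr 1; ext w
    rw [← hηe (w - t)]; congr 2; ring
  · rw [hρe]; exact hm.integrable.integrable_convolution _ hm.integrable
  · rw [hρe, integral_convolution _ hm.integrable hm.integrable, hm.int]; simp
  · intro t
    have h1 : HasDerivAt (fun t => ρ (-t)) (ρ' (-t) * (-1)) t := (hd (-t)).comp t (hasDerivAt_neg t)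
    have h2 : (fun t => ρ (-t)) = ρ := funext hev
    rw [h2] at h1
    have := h1.unique (hd t)
    linarith

section
variable {T c1 c2 : ℝ} {M : Measure (ℝ × ℝ)} [IsFiniteMeasure M]

lemma restr_self {α : Type*} [MeasurableSpace α] {M : Measure α} {S : Set α} (hM : M Sᶜ = 0) :
    M.restrict S = M := Measure.restrict_eq_self_of_ae_mem (measure_eq_zero_iff_ae_notMem.1 hM |>.mono fun z hz => by simpa using hz)

lemma cont_int (hM : M (Icc 0 T ×ˢ Icc c1 c2)ᶜ = 0) {f : ℝ × ℝ → ℝ × ℝ → ℝ}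
    (hf : Continuous (Function.uncurry f)) : Continuous fun z => ∫ w, f z w ∂M := by
  have := continuous_parametric_integral_of_continuous (μ := M) hf
    (isCompact_Icc.prod isCompact_Icc : IsCompact (Icc (0:ℝ) T ×ˢ Icc c1 c2))
  rwa [restr_self hM] at this

lemma int_bd (hM : M (Icc 0 T ×ˢ Icc c1 c2)ᶜ = 0) {f : ℝ × ℝ → ℝ} (hf : Continuous f) : Integrable f M := by
  rw [← restr_self hM]
  exact hf.continuousOn.integrableOn_compact (isCompact_Icc.prod isCompact_Icc)

lemma deriv_int (hM : M (Icc 0 T ×ˢ Icc c1 c2)ᶜ = 0) {f f' : ℝ → ℝ × ℝ → ℝ}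
    (hf : Continuous (Function.uncurry f)) (hf' : Continuous (Function.uncurry f'))
    (hd : ∀ s w, HasDerivAt (fun s => f s w) (f' s w) s) (t : ℝ) :
    HasDerivAt (fun s => ∫ w, f s w ∂M) (∫ w, f' t w ∂M) t := by
  have hc : IsCompact (Icc (t - 1) (t + 1) ×ˢ (Icc (0:ℝ) T ×ˢ Icc c1 c2)) :=
    isCompact_Icc.prod (isCompact_Icc.prod isCompact_Icc)
  obtain ⟨D, hD⟩ := hc.exists_bound_of_continuousOn hf'.continuousOn
  have hfs : ∀ s, Continuous (f s) := fun s => hf.comp (by fun_prop : Continuous fun w => (s, w))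
  have hfs' : ∀ s, Continuous (f' s) := fun s => hf'.comp (by fun_prop : Continuous fun w => (s, w))
  refine (hasDerivAt_integral_of_dominated_loc_of_deriv_le (bound := fun _ => D)
    (Icc_mem_nhds (show t - 1 < t by linarith) (show t < t + 1 by linarith))
    (Eventually.of_forall fun s => (hfs s).aestronglyMeasurable) (int_bd hM (hfs t))
    (hfs' t).aestronglyMeasurable ?_ (integrable_const _)
    (Eventually.of_forall fun w s _ => hd s w)).2
  filter_upwards [measure_eq_zero_iff_ae_notMem.1 hM] with w hw s hs
  exact hD (s, w) ⟨hs, by simpa using hw⟩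
end

section
variable {T c1 c2 c0 B : ℝ} {N μ M : Measure (ℝ × ℝ)} [IsFiniteMeasure N] [IsFiniteMeasure M] [IsFiniteMeasure μ]
  {a b : ℝ × ℝ → ℝ}

/-- undiscounted Fokker-Planck equation with an occupation measure -/
def FPM (T c1 c2 : ℝ) (N μ M : Measure (ℝ × ℝ)) (a b : ℝ × ℝ → ℝ) : Prop :=
  ∀ u ut ux uxx : ℝ → ℝ → ℝ, IsCb12 T (Ioo c1 c2) u ut ux uxx →
    ∫ z, u z.1 z.2 ∂μ = (∫ z, u z.1 z.2 ∂N) +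
      ∫ z, (ut z.1 z.2 + (b z * ux z.1 z.2 + a z * uxx z.1 z.2)) ∂M

lemma energyM (hc : c1 < c2) (hc0 : 0 < c0) (hN : N (Icc 0 T ×ˢ Icc c1 c2)ᶜ = 0)
    (hμ : μ (Icc 0 T ×ˢ Icc c1 c2)ᶜ = 0) (hM : M (Icc 0 T ×ˢ Icc c1 c2)ᶜ = 0)
    (hmar : ∀ f : ℝ → ℝ, Continuous f → Integrable f → (∀ t, 0 ≤ f t) → ∫ z, f z.1 ∂M ≤ ∫ t, f t)
    (ha : Measurable a) (hb : Measurable b) {C : ℝ} (haC : ∀ z, a z ≤ C) (hac : ∀ z, c0 ≤ a z)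
    (hbB : ∀ z, |b z| ≤ B) (hFP : FPM T c1 c2 N μ M a b) {h : ℝ} {η ρ ρ' : ℝ → ℝ} (H : Auto h η ρ ρ') :
    ∫ z, (∫ w, tk η η (z - w) * 1 ∂M) ^ 2 ≤
      (2 * (c2 - c1) * N.real univ + B * M.real univ) / (2 * c0) := by
  set L := c2 - c1 with hL
  have hL0 : 0 < L := by linarith
  have cρ := H.cρ
  have cρ' := H.cρ'
  set G : ℝ → ℝ := fun x => 2 * ∫ y in (0:ℝ)..x, ρ y with hG
  have dG : ∀ x, HasDerivAt G (2 * ρ x) x := fun x =>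
    (intervalIntegral.integral_hasDerivAt_right (cρ.intervalIntegrable _ _)
      (cρ.stronglyMeasurableAtFilter _ _) cρ.continuousAt).const_mul 2
  have cG : Continuous G := continuous_iff_continuousAt.2 fun x => (dG x).continuousAt
  set κ : ℝ → ℝ := fun x => L - ∫ y in (0:ℝ)..x, G y with hκ
  have dκ : ∀ x, HasDerivAt κ (- G x) x := fun x =>
    (intervalIntegral.integral_hasDerivAt_right (cG.intervalIntegrable _ _)
      (cG.stronglyMeasurableAtFilter _ _) cG.continuousAt).const_sub L
  have cκ : Continuous κ := continuous_iff_continuousAt.2 fun x => (dκ x).continuousAt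
  have Godd : ∀ x, G (-x) = - G x := by
    intro x
    simp only [hG]
    have := intervalIntegral.integral_comp_neg (a := 0) (b := x) ρ
    simp only [H.even, neg_zero] at this
    rw [this, intervalIntegral.integral_symm]; ring
  have κev : ∀ x, κ (-x) = κ x := by
    intro x
    simp only [hκ]
    have := intervalIntegral.integral_comp_neg (a := 0) (b := x) G
    simp only [Godd, neg_zero] at this
    rw [intervalIntegral.integral_neg] at this
    rw [intervalIntegral.integral_symm, ← this]; ring
  have Gb0 : ∀ x, 0 ≤ x → 0 ≤ G x ∧ G x ≤ 1 := by
    intro x hx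
    have h1 : ∫ y in (-x)..x, ρ y = G x := by
      rw [← intervalIntegral.integral_add_adjacent_intervals (cρ.intervalIntegrable (-x) 0)
        (cρ.intervalIntegrable 0 x)]
      have := intervalIntegral.integral_comp_neg (a := 0) (b := x) ρ
      simp only [H.even, neg_zero] at this
      rw [← this]; simp only [hG]; ring
    refine ⟨?_, ?_⟩
    · exact mul_nonneg zero_le_two (intervalIntegral.integral_nonneg hx fun y _ => H.nn y)
    · rw [← h1, intervalIntegral.integral_of_le (by linarith), ← H.int]
      exact setIntegral_le_integral H.iρ (Eventually.of_forall H.nn)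
  have Gb : ∀ x, |G x| ≤ 1 := by
    intro x
    rcases le_total 0 x with hx | hx
    · rw [abs_of_nonneg (Gb0 x hx).1]; exact (Gb0 x hx).2
    · have := Gb0 (-x) (by linarith)
      rw [Godd] at this
      rw [abs_le]; constructor <;> linarith [this.1, this.2]
  have κb : ∀ x, |x| ≤ L → 0 ≤ κ x ∧ κ x ≤ 2 * L := by
    intro x hx
    have h1 : ‖∫ y in (0:ℝ)..x, G y‖ ≤ 1 * |x - 0| :=
      intervalIntegral.norm_integral_le_of_norm_le_const fun y _ => Gb y
    rw [sub_zero, one_mul, Real.norm_eq_abs] at h1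
    have := abs_le.1 (h1.trans hx)
    simp only [hκ]
    constructor <;> linarith [this.1, this.2]
  set u : ℝ → ℝ → ℝ := fun t x => ∫ w, ρ (t - w.1) * κ (x - w.2) ∂M with hu
  set ut : ℝ → ℝ → ℝ := fun t x => ∫ w, ρ' (t - w.1) * κ (x - w.2) ∂M with hut
  set ux : ℝ → ℝ → ℝ := fun t x => ∫ w, ρ (t - w.1) * (- G (x - w.2)) ∂M with hux
  set uxx : ℝ → ℝ → ℝ := fun t x => ∫ w, ρ (t - w.1) * (- (2 * ρ (x - w.2))) ∂M with huxx
  have ci : ∀ {f g : ℝ → ℝ}, Continuous f → Continuous g →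
      Continuous fun z : ℝ × ℝ => ∫ w, f (z.1 - w.1) * g (z.2 - w.2) ∂M := by
    intro f g hf hg
    exact cont_int hM (f := fun z w => f (z.1 - w.1) * g (z.2 - w.2))
      (by simp only [Function.uncurry_def]; fun_prop)
  have cu := ci cρ cκ
  have cut := ci cρ' cκ
  have cux := ci cρ cG.neg
  have cuxx := ci cρ (cρ.const_mul 2).neg
  have hcb : IsCb12 T (Ioo c1 c2) u ut ux uxx := by
    refine isCb12_of_global hc cu cut cux cuxx ?_ ?_ ?_
    · intro t x
      refine deriv_int hM (f := fun s w => ρ (s - w.1) * κ (x - w.2))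
        (f' := fun s w => ρ' (s - w.1) * κ (x - w.2)) ?_ ?_ ?_ t
      · simp only [Function.uncurry_def]; fun_prop
      · simp only [Function.uncurry_def]; fun_prop
      · intro s w
        exact ((H.dρ (s - w.1)).comp_sub_const s w.1).mul_const _
    · intro t x
      refine deriv_int hM (f := fun s w => ρ (t - w.1) * κ (s - w.2))
        (f' := fun s w => ρ (t - w.1) * (- G (s - w.2))) ?_ ?_ ?_ x
      · simp only [Function.uncurry_def]; fun_prop
      · simp only [Function.uncurry_def]; fun_prop
      · intro s w
        exact ((dκ (s - w.2)).comp_sub_const s w.2).const_mul _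
    · intro t x
      refine deriv_int hM (f := fun s w => ρ (t - w.1) * (- G (s - w.2)))
        (f' := fun s w => ρ (t - w.1) * (- (2 * ρ (s - w.2)))) ?_ ?_ ?_ x
      · simp only [Function.uncurry_def]; fun_prop
      · simp only [Function.uncurry_def]; fun_prop
      · intro s w
        exact ((dG (s - w.2)).comp_sub_const s w.2).neg.const_mul _
  have hmass : ∀ t, ∫ w, ρ (t - w.1) ∂M ≤ 1 := by
    intro t
    refine (hmar (fun s => ρ (t - s)) (by fun_prop) (H.iρ.comp_sub_left t) (fun s => H.nn _)).trans_eq ?_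
    rw [integral_sub_left_eq_self ρ volume t, H.int]
  have hMQ : ∀ᵐ z ∂M, z ∈ Icc 0 T ×ˢ Icc c1 c2 :=
    (measure_eq_zero_iff_ae_notMem.1 hM).mono fun z hz => by simpa using hz
  have hNQ : ∀ᵐ z ∂N, z ∈ Icc 0 T ×ˢ Icc c1 c2 :=
    (measure_eq_zero_iff_ae_notMem.1 hN).mono fun z hz => by simpa using hz
  have hμQ : ∀ᵐ z ∂μ, z ∈ Icc 0 T ×ˢ Icc c1 c2 :=
    (measure_eq_zero_iff_ae_notMem.1 hμ).mono fun z hz => by simpa using hz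
  have hdist : ∀ {x y : ℝ}, x ∈ Icc c1 c2 → y ∈ Icc c1 c2 → |x - y| ≤ L := by
    intro x y hx hy
    rw [abs_le]; constructor <;> linarith [hx.1, hx.2, hy.1, hy.2]
  have iρM : ∀ t, Integrable (fun w : ℝ × ℝ => ρ (t - w.1)) M := fun t => int_bd hM (by fun_prop)
  have u0 : ∀ z : ℝ × ℝ, z ∈ Icc 0 T ×ˢ Icc c1 c2 → 0 ≤ u z.1 z.2 ∧ u z.1 z.2 ≤ 2 * L := by
    intro z hz
    constructor
    · refine integral_nonneg_of_ae ?_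
      filter_upwards [hMQ] with w hw
      exact mul_nonneg (H.nn _) (κb _ (hdist hz.2 hw.2)).1
    · calc u z.1 z.2 ≤ ∫ w, ρ (z.1 - w.1) * (2 * L) ∂M := by
            refine integral_mono_ae (int_bd hM (by fun_prop)) ((iρM _).mul_const _) ?_
            filter_upwards [hMQ] with w hw
            exact mul_le_mul_of_nonneg_left (κb _ (hdist hz.2 hw.2)).2 (H.nn _)
        _ = (∫ w, ρ (z.1 - w.1) ∂M) * (2 * L) := integral_mul_const _ _
        _ ≤ 1 * (2 * L) := mul_le_mul_of_nonneg_right (hmass _) (by positivity)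
        _ = 2 * L := one_mul _
  have hux1 : ∀ z : ℝ × ℝ, |ux z.1 z.2| ≤ 1 := by
    intro z
    refine le_trans ?_ (hmass z.1)
    rw [← Real.norm_eq_abs]
    refine norm_integral_le_of_norm_le (iρM _) (Eventually.of_forall fun w => ?_)
    rw [norm_mul, Real.norm_of_nonneg (H.nn _), norm_neg]
    exact mul_le_of_le_one_right (H.nn _) (Gb _)
  have E := hFP u ut ux uxx hcb
  have E0 : 0 ≤ ∫ z, u z.1 z.2 ∂μ := integral_nonneg_of_ae (hμQ.mono fun z hz => (u0 z hz).1)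
  have E1 : ∫ z, u z.1 z.2 ∂N ≤ 2 * L * N.real univ := by
    calc ∫ z, u z.1 z.2 ∂N ≤ ∫ z, 2 * L ∂N :=
          integral_mono_ae (int_bd hN cu) (integrable_const _) (hNQ.mono fun z hz => (u0 z hz).2)
      _ = 2 * L * N.real univ := by simp [mul_comm]
  have hB0 : 0 ≤ B := (abs_nonneg _).trans (hbB 0)
  have iut : Integrable (fun z : ℝ × ℝ => ut z.1 z.2) M := int_bd hM cut
  have ibux : Integrable (fun z : ℝ × ℝ => b z * ux z.1 z.2) M :=
    Integrable.of_bound (hb.mul cux.measurable).aestronglyMeasurable (B * 1) (Eventually.of_forall fun z => by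
      rw [norm_mul]; exact mul_le_mul (hbB z) (hux1 z) (abs_nonneg _) hB0)
  have haC' : ∀ z, |a z| ≤ C := fun z => abs_le.2 ⟨by linarith [hac z, haC z], haC z⟩
  have iauxx : Integrable (fun z : ℝ × ℝ => a z * uxx z.1 z.2) M :=
    (int_bd hM cuxx).bdd_mul ha.aestronglyMeasurable (c := C) (Eventually.of_forall haC')
  have iab : Integrable (fun z : ℝ × ℝ => b z * ux z.1 z.2 + a z * uxx z.1 z.2) M := ibux.add iauxx
  rw [integral_add iut iab, integral_add ibux iauxx] at E
  -- time part
  have swp : ∀ {f g : ℝ → ℝ}, Continuous f → Continuous g →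
      ∫ z, (∫ w, f (z.1 - w.1) * g (z.2 - w.2) ∂M) ∂M = ∫ w, (∫ z, f (z.1 - w.1) * g (z.2 - w.2) ∂M) ∂M := by
    intro f g hf hg
    refine integral_integral_swap (f := fun z w : ℝ × ℝ => f (z.1 - w.1) * g (z.2 - w.2)) ?_
    have hcp : IsCompact ((Icc (0:ℝ) T ×ˢ Icc c1 c2) ×ˢ (Icc (0:ℝ) T ×ˢ Icc c1 c2)) :=
      (isCompact_Icc.prod isCompact_Icc).prod (isCompact_Icc.prod isCompact_Icc)
    have : (M.prod M).restrict ((Icc (0:ℝ) T ×ˢ Icc c1 c2) ×ˢ (Icc (0:ℝ) T ×ˢ Icc c1 c2)) = M.prod M := by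
      rw [← Measure.prod_restrict, restr_self hM]
    rw [← this]
    refine ContinuousOn.integrableOn_compact hcp (Continuous.continuousOn ?_)
    simp only [Function.uncurry_def]; fun_prop
  have Et : ∫ z, ut z.1 z.2 ∂M = 0 := by
    have h1 := swp cρ' cκ
    have h2 : ∀ w z : ℝ × ℝ, ρ' (z.1 - w.1) * κ (z.2 - w.2) = - (ρ' (w.1 - z.1) * κ (w.2 - z.2)) := by
      intro w z
      rw [← neg_sub w.1, ← neg_sub w.2, H.odd, κev]; ring
    have h3 : ∫ w, (∫ z, ρ' (z.1 - w.1) * κ (z.2 - w.2) ∂M) ∂M = - ∫ z, ut z.1 z.2 ∂M := by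
      rw [← integral_neg]
      congr 1; ext w
      simp only [hut]
      rw [← integral_neg]
      congr 1; ext z
      exact h2 w z
    have h4 : ∫ z, ut z.1 z.2 ∂M = - ∫ z, ut z.1 z.2 ∂M := h1.trans h3
    linarith
  have Ex : ∫ z, b z * ux z.1 z.2 ∂M ≤ B * M.real univ := by
    refine (le_abs_self _).trans ?_
    rw [← Real.norm_eq_abs]
    refine (norm_integral_le_of_norm_le (integrable_const B) (Eventually.of_forall fun z => ?_)).trans_eq
      (by simp [mul_comm])
    rw [norm_mul]; exact (mul_le_mul (hbB z) (hux1 z) (abs_nonneg _) hB0).trans_eq (mul_one _)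
  set S := ∫ z, (∫ w, ρ (z.1 - w.1) * ρ (z.2 - w.2) ∂M) ∂M with hS
  have Exx : ∫ z, a z * uxx z.1 z.2 ∂M ≤ - (2 * c0 * S) := by
    have : - (2 * c0 * S) = ∫ z, - (2 * c0 * (∫ w, ρ (z.1 - w.1) * ρ (z.2 - w.2) ∂M)) ∂M := by
      rw [integral_neg, integral_const_mul]
    rw [this]
    refine integral_mono iauxx (int_bd hM (((ci cρ cρ).const_mul _).neg)) fun z => ?_
    have e : uxx z.1 z.2 = - (2 * ∫ w, ρ (z.1 - w.1) * ρ (z.2 - w.2) ∂M) := by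
      simp only [huxx]
      rw [← integral_const_mul, ← integral_neg]
      congr 1; ext w; ring
    have e0 : 0 ≤ ∫ w, ρ (z.1 - w.1) * ρ (z.2 - w.2) ∂M :=
      integral_nonneg fun w => mul_nonneg (H.nn _) (H.nn _)
    simp only [e]
    nlinarith [hac z]
  have main : 2 * c0 * S ≤ 2 * L * N.real univ + B * M.real univ := by linarith
  have hSe : ∫ z, (∫ w, tk η η (z - w) * 1 ∂M) ^ 2 = S := by
    have kBM := tk_BM H.mη H.mη
    set k := tk η η with hk
    have KB : BM (fun z => ∫ w, k (z - w) * 1 ∂M) :=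
      (conv_BM (T := T) (c1 := c1) (c2 := c2) kBM (tk_supp H.mη H.mη) (measurable_const (a := (1:ℝ)))
        (integrable_const (μ := M) (1:ℝ)) (hMQ.mono fun w hw => Or.inl hw)).1
    have h1 := conv_fubini kBM KB (N := M)
    have h0 : ∫ z, (∫ w, k (z - w) * 1 ∂M) ^ 2 = ∫ z, (∫ w, k (z - w) * 1 ∂M) * (∫ w, k (z - w) * 1 ∂M) := by
      congr 1; ext z; ring
    rw [h0, h1, hS]
    congr 1; ext w
    have h2 := conv_fubini kBM (kBM.shift' w) (N := M)
    have h3 : ∫ z, (∫ w, k (z - w) * 1 ∂M) * k (z - w) = ∫ z, k (z - w) * (∫ w, k (z - w) * 1 ∂M) := by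
      congr 1; ext z; ring
    rw [h3, h2]
    congr 1; ext w'
    have h4 := integral_prod_mul (μ := (volume : Measure ℝ)) (ν := (volume : Measure ℝ))
      (fun s => η (s - w.1) * η (s - w'.1)) (fun s => η (s - w.2) * η (s - w'.2))
    rw [H.auto, H.auto] at h4
    rw [← h4, ← Measure.volume_eq_prod]
    congr 1; ext z
    simp only [hk, tk, Prod.fst_sub, Prod.snd_sub]; ring
  rw [hSe, le_div_iff₀ (by positivity)]
  linarith
end

end

section

lemma KP.lim_cs {h : ℕ → ℝ} {k : ℕ → ℝ × ℝ → ℝ} (H : KP h k) {M : Measure (ℝ × ℝ)} [IsFiniteMeasure M]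
    {g : ℝ × ℝ → ℝ} (hg : BM g) (hgu : UniformContinuous g) :
    Tendsto (fun j => ∫ z, g z * ∫ w, k j (z - w) * 1 ∂M) atTop (𝓝 (∫ z, g z ∂M)) := by
  have hgi : Integrable g M := by
    obtain ⟨C, hC⟩ := hg.bdd
    exact Integrable.of_bound hg.meas.aestronglyMeasurable C (Eventually.of_forall hC)
  have key : ∀ ε > 0, ∀ᶠ j in atTop, ‖(∫ z, g z * ∫ w, k j (z - w) * 1 ∂M) - ∫ z, g z ∂M‖ ≤ ε * M.real univ := by
    intro ε hε
    obtain ⟨δ, hδ, hd⟩ := Metric.uniformContinuous_iff.1 hgu ε hε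
    have h1 : ∀ᶠ j in atTop, h j < δ / 2 := H.hlim.eventually (gt_mem_nhds (by positivity))
    filter_upwards [h1] with j hj
    rw [conv_fubini (H.kBM j) hg]
    have kbs : ∀ w, BM (fun z => k j (z - w)) := fun w => (H.kBM j).shift' w
    have inn : ∀ w, ‖(∫ z, g z * k j (z - w)) - g w‖ ≤ ε := by
      intro w
      have e1 : ∫ z, k j (z - w) = 1 := by rw [integral_sub_right_eq_self (k j) w, H.kint]
      have e2 : (∫ z, g z * k j (z - w)) - g w = ∫ z, (g z - g w) * k j (z - w) := by
        have i1 : Integrable (fun z => g z * k j (z - w)) := (hg.mul (kbs w)).integrable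
        have i2 : Integrable (fun z => g w * k j (z - w)) := ((kbs w).cmul _).integrable
        have : ∫ z, (g z - g w) * k j (z - w) = ∫ z, (g z * k j (z - w) - g w * k j (z - w)) := by
          congr 1; ext z; ring
        rw [this, integral_sub i1 i2, integral_const_mul, e1, mul_one]
      rw [e2]
      refine (norm_integral_le_of_norm_le (g := fun z => ε * k j (z - w)) ((kbs w).integrable.const_mul ε)
        (Eventually.of_forall fun z => ?_)).trans_eq (by rw [integral_const_mul, e1, mul_one])
      rw [norm_mul, Real.norm_of_nonneg (H.knn j _)]
      by_cases hz : k j (z - w) = 0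
      · rw [hz]; simp
      · refine mul_le_mul_of_nonneg_right ?_ (H.knn j _)
        have := H.ksupp j _ hz
        have := hd (a := z) (b := w) (by rw [dist_eq_norm]; linarith)
        rw [dist_eq_norm] at this
        exact this.le
    have him : StronglyMeasurable (fun w => ∫ z, g z * k j (z - w)) := by
      refine StronglyMeasurable.integral_prod_right' (f := fun q : (ℝ × ℝ) × (ℝ × ℝ) => g q.2 * k j (q.2 - q.1)) ?_
      have := hg.meas
      have := (H.kBM j).meas
      exact Measurable.stronglyMeasurable (by fun_prop)
    have hii : Integrable (fun w => ∫ z, g z * k j (z - w)) M := by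
      have : Integrable (fun w => ((∫ z, g z * k j (z - w)) - g w) + g w) M :=
        (Integrable.of_bound (him.sub hg.meas.stronglyMeasurable).aestronglyMeasurable ε
          (Eventually.of_forall inn)).add hgi
      simpa using this
    rw [← integral_sub hii hgi]
    exact (norm_integral_le_of_norm_le (integrable_const ε) (Eventually.of_forall inn)).trans_eq
      (by simp [mul_comm])
  rw [Metric.tendsto_atTop]
  intro ε hε
  have h2 : 0 < M.real univ + 1 := by positivity
  obtain ⟨n, hn⟩ := eventually_atTop.1 (key (ε / (2 * (M.real univ + 1))) (by positivity))
  refine ⟨n, fun j hj => ?_⟩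
  rw [dist_eq_norm]
  refine (hn j hj).trans_lt ?_
  rw [div_mul_eq_mul_div, div_lt_iff₀ (by positivity)]
  have : 0 ≤ M.real univ := measureReal_nonneg
  nlinarith

section
variable {T c1 c2 c0 B : ℝ} {N μ M : Measure (ℝ × ℝ)} [IsFiniteMeasure N] [IsFiniteMeasure M] [IsFiniteMeasure μ]
  {a b : ℝ × ℝ → ℝ}

lemma density_exists (hc : c1 < c2) (hc0 : 0 < c0) (hN : N (Icc 0 T ×ˢ Icc c1 c2)ᶜ = 0)
    (hμ : μ (Icc 0 T ×ˢ Icc c1 c2)ᶜ = 0) (hM : M (Icc 0 T ×ˢ Icc c1 c2)ᶜ = 0)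
    (hmar : ∀ f : ℝ → ℝ, Continuous f → Integrable f → (∀ t, 0 ≤ f t) → ∫ z, f z.1 ∂M ≤ ∫ t, f t)
    (ha : Measurable a) (hb : Measurable b) {C : ℝ} (haC : ∀ z, a z ≤ C) (hac : ∀ z, c0 ≤ a z)
    (hbB : ∀ z, |b z| ≤ B) (hFP : FPM T c1 c2 N μ M a b) :
    ∃ p : ℝ × ℝ → ℝ, Measurable p ∧ MemLp p 2 ∧ (∀ z, 0 ≤ p z) ∧
      (∀ z, z ∉ Icc 0 T ×ˢ Icc c1 c2 → p z = 0) ∧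
      M = volume.withDensity (fun z => ENNReal.ofReal (p z)) := by
  set h : ℕ → ℝ := fun j => 1 / ((j : ℝ) + 1) with hh
  have hpos : ∀ j, 0 < h j := fun j => by positivity
  have hlim : Tendsto h atTop (𝓝 0) := tendsto_one_div_add_atTop_nhds_zero_nat
  choose η ρ ρ' HA using fun j => exists_auto (hpos j)
  set k : ℕ → ℝ × ℝ → ℝ := fun j => tk (η j) (η j) with hk
  have H : KP h k := ⟨hpos, hlim, fun j => tk_BM (HA j).mη (HA j).mη, fun j => tk_nn (HA j).mη (HA j).mη,
    fun j => tk_int (HA j).mη (HA j).mη, fun j => tk_supp (HA j).mη (HA j).mη⟩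
  have hMQ : ∀ᵐ z ∂M, z ∈ Icc 0 T ×ˢ Icc c1 c2 :=
    (measure_eq_zero_iff_ae_notMem.1 hM).mono fun z hz => by simpa using hz
  have cB := fun j => conv_BM (T := T) (c1 := c1) (c2 := c2) (H.kBM j) (H.ksupp j)
    (measurable_const (a := (1:ℝ)))
        (integrable_const (μ := M) (1:ℝ)) (hMQ.mono fun w hw => Or.inl hw)
  set P : ℕ → ℝ × ℝ → ℝ := fun j z => ∫ w, k j (z - w) * 1 ∂M with hP
  set D := (2 * (c2 - c1) * N.real univ + B * M.real univ) / (2 * c0) with hD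
  have W : WL T c1 c2 (fun _ => 0) D h P (fun _ _ => 0) (fun _ => D) := by
    refine ⟨hlim, fun j => (cB j).1.memLp, fun j z => integral_nonneg fun w => mul_nonneg (H.knn j _) zero_le_one,
      fun j => (cB j).2, fun j => MemLp.zero, by simp, tendsto_const_nhds, fun j => ?_⟩
    simp only [sub_zero]
    exact energyM hc hc0 hN hμ hM hmar ha hb haC hac hbB hFP (HA j)
  obtain ⟨p, hpm, hpL, hp0, hpQ, -, hlimp⟩ := approx_limit MemLp.zero W
  refine ⟨p, hpm, hpL, hp0, hpQ, ?_⟩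
  have hpi : Integrable p := by
    have h1 : IntegrableOn p (Icc 0 T ×ˢ Icc c1 c2) := by
      have hfin : volume (Icc (0:ℝ) T ×ˢ Icc c1 c2) ≠ ⊤ := (isCompact_Icc.prod isCompact_Icc).measure_lt_top.ne
      haveI : IsFiniteMeasure (volume.restrict (Icc (0:ℝ) T ×ˢ Icc c1 c2)) := ⟨by
        rw [Measure.restrict_apply_univ]; exact hfin.lt_top⟩
      exact (hpL.restrict _).integrable (by norm_num)
    refine (integrableOn_iff_integrable_of_support_subset ?_).1 h1
    intro z hz
    by_contra hn
    exact hz (hpQ z hn)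
  haveI : IsFiniteMeasure (volume.withDensity (fun z => ENNReal.ofReal (p z))) :=
    isFiniteMeasure_withDensity_ofReal hpi.2
  refine Measure.ext_of_integral_eq_on_compactlySupported fun g => ?_
  have hgB : BM g := by
    refine ⟨g.continuous.measurable, ?_, ?_⟩
    · obtain ⟨C, hC⟩ := g.hasCompactSupport.exists_bound_of_continuous g.continuous
      exact ⟨C, hC⟩
    · obtain ⟨R, hR⟩ := g.hasCompactSupport.isCompact.isBounded.exists_norm_le
      exact ⟨R, fun z hz => hR z (subset_tsupport _ hz)⟩
  have hgu : UniformContinuous g := g.hasCompactSupport.uniformContinuous_of_continuous g.continuous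
  have h1 := (H.lim_cs (M := M) hgB hgu).mono_left Nat.hyperfilter_le_atTop
  have h2 := hlimp (fun _ => g) g (fun _ => hgB.memLp) hgB.memLp (by simp)
  have h3 := tendsto_nhds_unique h1 h2
  rw [h3, integral_withDensity_eq_integral_toReal_smul (by fun_prop) (by simp)]
  congr 1; ext z
  rw [ENNReal.toReal_ofReal (hp0 z), smul_eq_mul, mul_comm]
end

end

section

/-- globally smooth test functions -/
structure Sm (u ut ux uxx : ℝ → ℝ → ℝ) : Prop where
  c0 : Continuous fun z : ℝ × ℝ => u z.1 z.2
  ct : Continuous fun z : ℝ × ℝ => ut z.1 z.2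
  cx : Continuous fun z : ℝ × ℝ => ux z.1 z.2
  cxx : Continuous fun z : ℝ × ℝ => uxx z.1 z.2
  dt : ∀ t x, HasDerivAt (fun s => u s x) (ut t x) t
  dx : ∀ t x, HasDerivAt (fun y => u t y) (ux t x) x
  dxx : ∀ t x, HasDerivAt (fun y => ux t y) (uxx t x) x

lemma Sm.cb {u ut ux uxx : ℝ → ℝ → ℝ} (H : Sm u ut ux uxx) {T c1 c2 : ℝ} (hc : c1 < c2) :
    IsCb12 T (Ioo c1 c2) u ut ux uxx :=
  isCb12_of_global hc H.c0 H.ct H.cx H.cxx H.dt H.dx H.dxx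

lemma sm_of_contDiff {v : ℝ × ℝ → ℝ} (hv : ContDiff ℝ 3 v) :
    ∃ ut ux uxx, Sm (fun t x => v (t, x)) ut ux uxx := by
  have d1 : ∀ {w : ℝ × ℝ → ℝ}, Differentiable ℝ w → ∀ t x,
      HasDerivAt (fun s => w (s, x)) (fderiv ℝ w (t, x) (1, 0)) t := by
    intro w hw t x
    exact (hw (t, x)).hasFDerivAt.comp_hasDerivAt t ((hasDerivAt_id t).prodMk (hasDerivAt_const t x))
  have d2 : ∀ {w : ℝ × ℝ → ℝ}, Differentiable ℝ w → ∀ t x,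
      HasDerivAt (fun y => w (t, y)) (fderiv ℝ w (t, x) (0, 1)) x := by
    intro w hw t x
    exact (hw (t, x)).hasFDerivAt.comp_hasDerivAt x ((hasDerivAt_const x t).prodMk (hasDerivAt_id x))
  have hv1 : Differentiable ℝ v := hv.differentiable (by norm_num)
  have hx : ContDiff ℝ 2 (fun z => fderiv ℝ v z (0, 1)) :=
    (hv.fderiv_right (m := 2) (by norm_num)).clm_apply contDiff_const
  have hx1 : Differentiable ℝ (fun z => fderiv ℝ v z (0, 1)) := hx.differentiable (by norm_num)
  refine ⟨fun t x => fderiv ℝ v (t, x) (1, 0), fun t x => fderiv ℝ v (t, x) (0, 1),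
    fun t x => fderiv ℝ (fun z => fderiv ℝ v z (0, 1)) (t, x) (0, 1), hv.continuous, ?_, hx.continuous, ?_,
    d1 hv1, d2 hv1, d2 hx1⟩
  · exact ((hv.fderiv_right (m := 2) (by norm_num)).clm_apply contDiff_const).continuous
  · exact ((hx.fderiv_right (m := 1) (by norm_num)).clm_apply contDiff_const).continuous

lemma smooth_approx {Q : Set (ℝ × ℝ)} (hQ : IsCompact Q) {f : ℝ × ℝ → ℝ} (hf : ContinuousOn f Q) {ε : ℝ}
    (hε : 0 < ε) : ∃ u ut ux uxx, Sm u ut ux uxx ∧ ∀ z ∈ Q, |u z.1 z.2 - f z| ≤ ε := by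
  haveI : CompactSpace Q := isCompact_iff_compactSpace.1 hQ
  let S : Subalgebra ℝ C(Q, ℝ) :=
    { carrier := {g | ∃ v : ℝ × ℝ → ℝ, ContDiff ℝ 3 v ∧ ∀ z : Q, g z = v z}
      mul_mem' := by
        rintro g g' ⟨v, hv, hg⟩ ⟨v', hv', hg'⟩
        exact ⟨fun z => v z * v' z, hv.mul hv', fun z => by simp [hg, hg']⟩
      add_mem' := by
        rintro g g' ⟨v, hv, hg⟩ ⟨v', hv', hg'⟩
        exact ⟨fun z => v z + v' z, hv.add hv', fun z => by simp [hg, hg']⟩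
      algebraMap_mem' := fun r => ⟨fun _ => r, contDiff_const, fun z => rfl⟩ }
  have hS : S.SeparatesPoints := by
    intro z w hzw
    have : (z : ℝ × ℝ) ≠ w := fun h => hzw (Subtype.ext h)
    by_cases h1 : (z : ℝ × ℝ).1 = (w : ℝ × ℝ).1
    · refine ⟨fun z : Q => (z : ℝ × ℝ).2, ⟨⟨fun z : Q => (z : ℝ × ℝ).2, by fun_prop⟩,
        ⟨fun z => z.2, contDiff_snd, fun z => rfl⟩, rfl⟩, fun h2 => this (Prod.ext h1 h2)⟩
    · exact ⟨fun z : Q => (z : ℝ × ℝ).1, ⟨⟨fun z : Q => (z : ℝ × ℝ).1, by fun_prop⟩,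
        ⟨fun z => z.1, contDiff_fst, fun z => rfl⟩, rfl⟩, h1⟩
  obtain ⟨⟨g, v, hv, hg⟩, h2⟩ := ContinuousMap.exists_mem_subalgebra_near_continuous_of_separatesPoints
    S hS (fun z : Q => f z) (continuousOn_iff_continuous_restrict.1 hf) ε hε
  obtain ⟨ut, ux, uxx, H⟩ := sm_of_contDiff hv
  refine ⟨_, ut, ux, uxx, H, fun z hz => ?_⟩
  have := h2 ⟨z, hz⟩
  simp only [hg, Real.norm_eq_abs] at this
  exact this.le

lemma strong_of_weak {T D C' : ℝ} (hT : 0 < T) {δ : ℕ → ℝ → ℝ} (hm : ∀ n, Measurable (δ n))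
    (hD : ∀ n t, |δ n t| ≤ D) (hC0 : 0 ≤ C')
    (hC : ∀ n (g : ℝ → ℝ), Continuous g → ∀ K, (∀ t ∈ Icc (0:ℝ) T, |∫ s in (0:ℝ)..t, g s| ≤ K) →
      ∫ t in Icc 0 T, g t * δ n t ≤ C' * K)
    (hw : ∀ g : ℝ → ℝ, Continuous g → Tendsto (fun n => ∫ t in Icc 0 T, g t * δ n t) atTop (𝓝 0)) :
    Tendsto (fun n => ∫ t in Icc 0 T, (δ n t) ^ 2) atTop (𝓝 0) := by
  have hD0 : 0 ≤ D := (abs_nonneg _).trans (hD 0 0)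
  set V := (volume : Measure ℝ).restrict (Icc 0 T) with hV
  have iδ : ∀ n, Integrable (δ n) V := fun n =>
    Integrable.of_bound (hm n).aestronglyMeasurable D (Eventually.of_forall (hD n))
  -- approximation by continuous functions
  have app : ∀ (f : ℝ → ℝ), Integrable f V → ∀ ε > 0, ∃ g : ℝ → ℝ, Continuous g ∧ Integrable g V ∧
      ∫ t, |f t - g t| ∂V ≤ ε := by
    intro f hf ε hε
    obtain ⟨g, -, h2, h3, h4⟩ := hf.exists_hasCompactSupport_integral_sub_le hε
    exact ⟨g, h3, h4, h2⟩
  have dif : ∀ (n : ℕ) (f g : ℝ → ℝ), Integrable f V → Integrable g V →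
      |(∫ t, f t * δ n t ∂V) - ∫ t, g t * δ n t ∂V| ≤ D * ∫ t, |f t - g t| ∂V := by
    intro n f g hf hg
    have i1 : Integrable (fun t => f t * δ n t) V := hf.mul_bdd (c := D) (hm n).aestronglyMeasurable
      (Eventually.of_forall (hD n))
    have i2 : Integrable (fun t => g t * δ n t) V := hg.mul_bdd (c := D) (hm n).aestronglyMeasurable
      (Eventually.of_forall (hD n))
    rw [← integral_sub i1 i2, ← integral_const_mul, ← Real.norm_eq_abs]
    refine norm_integral_le_of_norm_le ((hf.sub hg).abs.const_mul D) (Eventually.of_forall fun t => ?_)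
    rw [← sub_mul, norm_mul, mul_comm]
    exact mul_le_mul_of_nonneg_right (hD n t) (norm_nonneg _)
  -- weak convergence against integrable functions
  have hw' : ∀ f : ℝ → ℝ, Integrable f V → Tendsto (fun n => ∫ t, f t * δ n t ∂V) atTop (𝓝 0) := by
    intro f hf
    rw [Metric.tendsto_atTop]
    intro ε hε
    obtain ⟨g, hg, hgi, hgf⟩ := app f hf (ε / (2 * (D + 1))) (by positivity)
    obtain ⟨n0, hn0⟩ := Metric.tendsto_atTop.1 (hw g hg) (ε / 2) (by positivity)
    refine ⟨n0, fun n hn => ?_⟩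
    have h1 := hn0 n hn
    have h2 := dif n f g hf hgi
    rw [Real.dist_eq, sub_zero] at h1 ⊢
    have h3 : D * ∫ t, |f t - g t| ∂V ≤ ε / 2 := by
      calc D * ∫ t, |f t - g t| ∂V ≤ (D + 1) * (ε / (2 * (D + 1))) :=
            mul_le_mul (by linarith) hgf (integral_nonneg fun _ => abs_nonneg _) (by positivity)
        _ = ε / 2 := by field_simp
    have h4 := abs_sub_abs_le_abs_sub (∫ t, f t * δ n t ∂V) (∫ t, g t * δ n t ∂V)
    linarith
  set θ : ℕ → ℝ → ℝ := fun n t => ∫ s in (0:ℝ)..t, δ n s with hθ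
  have ivi : ∀ n x y, IntervalIntegrable (δ n) volume x y := fun n x y => by
    rw [intervalIntegrable_iff]
    haveI : IsFiniteMeasure ((volume : Measure ℝ).restrict (uIoc x y)) := ⟨by
      rw [Measure.restrict_apply_univ, uIoc]; exact measure_Ioc_lt_top⟩
    exact Integrable.of_bound (hm n).aestronglyMeasurable D (Eventually.of_forall (hD n))
  have θlip : ∀ n x y, |θ n x - θ n y| ≤ D * |x - y| := by
    intro n x y
    have : θ n x - θ n y = ∫ s in y..x, δ n s := intervalIntegral.integral_interval_sub_left (ivi _ _ _) (ivi _ _ _)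
    rw [this, ← Real.norm_eq_abs]
    exact intervalIntegral.norm_integral_le_of_norm_le_const fun s _ => hD n s
  have θlim : ∀ t ∈ Icc (0:ℝ) T, Tendsto (fun n => θ n t) atTop (𝓝 0) := by
    intro t ht
    have := hw' ((Ioc 0 t).indicator fun _ => 1) ((integrable_const (1:ℝ)).indicator measurableSet_Ioc)
    refine this.congr fun n => ?_
    have e : (fun s => (Ioc 0 t).indicator (fun _ => (1:ℝ)) s * δ n s) = (Ioc 0 t).indicator (δ n) := by
      ext s; by_cases hs : s ∈ Ioc 0 t <;> simp [hs]
    rw [e, integral_indicator measurableSet_Ioc, hV, Measure.restrict_restrict measurableSet_Ioc,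
      inter_eq_left.2 (show Ioc 0 t ⊆ Icc 0 T from fun s hs => ⟨hs.1.le, hs.2.trans ht.2⟩), hθ]
    exact (intervalIntegral.integral_of_le ht.1).symm
  have θu : ∀ ε > 0, ∀ᶠ n in atTop, ∀ t ∈ Icc (0:ℝ) T, |θ n t| ≤ ε := by
    intro ε hε
    obtain ⟨F, hF, hFf, hcov⟩ := (isCompact_Icc (a := (0:ℝ)) (b := T)).finite_cover_balls
      (e := ε / (2 * (D + 1))) (by positivity)
    have h1 : ∀ᶠ n in atTop, ∀ x ∈ F, |θ n x| < ε / 2 := by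
      rw [eventually_all_finite hFf]
      intro x hx
      have := (θlim x (hF hx)).abs
      rw [abs_zero] at this
      exact this.eventually (gt_mem_nhds (by positivity))
    filter_upwards [h1] with n hn t ht
    obtain ⟨x, hx, hxt⟩ := mem_iUnion₂.1 (hcov ht)
    have h2 := hn x hx
    have h3 := θlip n t x
    rw [Metric.mem_ball, Real.dist_eq] at hxt
    have h5 : D * |t - x| ≤ ε / 2 := by
      calc D * |t - x| ≤ (D + 1) * (ε / (2 * (D + 1))) :=
            mul_le_mul (by linarith) hxt.le (abs_nonneg _) (by positivity)
        _ = ε / 2 := by field_simp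
    have h4 := abs_sub_abs_le_abs_sub (θ n t) (θ n x)
    linarith
  -- square estimate
  have sq : ∀ n K, (∀ t ∈ Icc (0:ℝ) T, |θ n t| ≤ K) → ∫ t, (δ n t) ^ 2 ∂V ≤ C' * K := by
    intro n K hK
    refine le_of_forall_pos_le_add fun ε hε => ?_
    obtain ⟨g, hg, hgi, hgf⟩ := app (δ n) (iδ n) (ε / (D + C' + 1)) (by positivity)
    have h1 := hC n g hg (K + ε / (D + C' + 1)) (by
      intro t ht
      have e : (∫ s in (0:ℝ)..t, g s) = θ n t - ∫ s in (0:ℝ)..t, (δ n s - g s) := by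
        rw [intervalIntegral.integral_sub (ivi _ _ _) (hg.intervalIntegrable _ _)]; ring
      have h2 : |∫ s in (0:ℝ)..t, (δ n s - g s)| ≤ ε / (D + C' + 1) := by
        refine le_trans ?_ hgf
        rw [intervalIntegral.integral_of_le ht.1]
        refine (abs_integral_le_integral_abs).trans ?_
        refine setIntegral_mono_set (((iδ n).sub hgi).abs) (Eventually.of_forall fun _ => abs_nonneg _) ?_
        exact (show Ioc 0 t ⊆ Icc 0 T from fun s hs => ⟨hs.1.le, hs.2.trans ht.2⟩).eventuallyLE
      rw [e]
      exact (abs_sub _ _).trans (add_le_add (hK t ht) h2))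
    have h3 := abs_le.1 (dif n (δ n) g (iδ n) hgi)
    have e : ∫ t, (δ n t) ^ 2 ∂V = ∫ t, δ n t * δ n t ∂V := by congr 1; ext t; ring
    rw [e]
    have h4 : D * ∫ t, |δ n t - g t| ∂V ≤ D * (ε / (D + C' + 1)) := mul_le_mul_of_nonneg_left hgf hD0
    have h5 : D * (ε / (D + C' + 1)) + C' * (ε / (D + C' + 1)) ≤ ε := by
      rw [← add_mul, mul_div_assoc', div_le_iff₀ (by positivity)]
      nlinarith
    nlinarith [h3.2]
  rw [Metric.tendsto_atTop]
  intro ε hε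
  obtain ⟨n0, hn0⟩ := eventually_atTop.1 (θu (ε / (2 * (C' + 1))) (by positivity))
  refine ⟨n0, fun n hn => ?_⟩
  rw [Real.dist_eq, sub_zero, abs_of_nonneg (integral_nonneg fun _ => sq_nonneg _)]
  refine (sq n _ (hn0 n hn)).trans_lt ?_
  rw [mul_div_assoc', div_lt_iff₀ (by positivity)]
  nlinarith

end

section
open ProbabilityTheory

lemma mass_le {T : ℝ} {S : Set ℝ} {μ : Measure (ℝ × ℝ)} [IsProbabilityMeasure μ]
    (hμ : μ (Icc 0 T ×ˢ S)ᶜ = 0) {ma : ℝ → ℝ}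
    (hi : IntegrableOn ma (Icc 0 T))
    (h : ∀ g : ℝ → ℝ, Continuous g → ∫ z, (∫ s in (0:ℝ)..z.1, g s) ∂μ = ∫ t in Icc 0 T, g t * ma t) :
    ∀ᵐ t ∂(volume.restrict (Icc 0 T)), ma t ≤ 1 := by
  set V := (volume : Measure ℝ).restrict (Icc 0 T) with hV
  set F : ℝ → ℝ := fun s => ∫ z, (if s < z.1 then (1:ℝ) else 0) ∂μ with hF
  have hm : Measurable fun q : ℝ × (ℝ × ℝ) => (if q.1 < q.2.1 then (1:ℝ) else 0) :=
    Measurable.ite (measurableSet_lt measurable_fst (by fun_prop)) measurable_const measurable_const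
  have hFm : StronglyMeasurable F := StronglyMeasurable.integral_prod_right'
    (f := fun q : ℝ × (ℝ × ℝ) => (if q.1 < q.2.1 then (1:ℝ) else 0)) hm.stronglyMeasurable
  have h01 : ∀ s x : ℝ, ‖(if s < x then (1:ℝ) else 0)‖ ≤ 1 := by
    intro s x; split_ifs <;> simp
  have hF1 : ∀ s, ‖F s‖ ≤ 1 := by
    intro s
    refine (norm_integral_le_of_norm_le (integrable_const (1:ℝ)) (Eventually.of_forall fun z => h01 _ _)).trans_eq ?_
    simp
  have hFi : Integrable F V := Integrable.of_bound hFm.aestronglyMeasurable 1 (Eventually.of_forall hF1)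
  have key : ∀ g : ℝ → ℝ, Continuous g → ∫ t, g t * ma t ∂V = ∫ t, g t * F t ∂V := by
    intro g hg
    rw [← h g hg]
    have e1 : ∀ᵐ z ∂μ, (∫ s in (0:ℝ)..z.1, g s) = ∫ s, g s * (if s < z.1 then (1:ℝ) else 0) ∂V := by
      filter_upwards [measure_eq_zero_iff_ae_notMem.1 hμ] with z hz
      have hz : z ∈ Icc 0 T ×ˢ S := notMem_compl_iff.1 hz
      have e : (fun s => g s * (if s < z.1 then (1:ℝ) else 0)) = (Iio z.1).indicator g := by
        ext s; by_cases hs : s < z.1 <;> simp [hs]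
      rw [e, integral_indicator measurableSet_Iio, hV, Measure.restrict_restrict measurableSet_Iio,
        intervalIntegral.integral_of_le hz.1.1, integral_Ioc_eq_integral_Ioo,
        ← integral_Ico_eq_integral_Ioo]
      congr 2
      ext s; simp only [mem_Ico, mem_inter_iff, mem_Iio, mem_Icc]
      constructor
      · exact fun hs => ⟨hs.2, hs.1, hs.2.le.trans hz.1.2⟩
      · exact fun hs => ⟨hs.2.1, hs.1⟩
    rw [integral_congr_ae e1]
    have gi : Integrable g V := hg.continuousOn.integrableOn_compact isCompact_Icc
    have : Integrable (Function.uncurry fun (z : ℝ × ℝ) s => g s * (if s < z.1 then (1:ℝ) else 0)) (μ.prod V) := by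
      have h1 : Integrable (fun q : (ℝ × ℝ) × ℝ => (1:ℝ) * g q.2) (μ.prod V) :=
        (integrable_const (1:ℝ)).mul_prod gi
      refine h1.mono ?_ (Eventually.of_forall fun q => ?_)
      · have hm' : Measurable fun q : (ℝ × ℝ) × ℝ => (if q.2 < q.1.1 then (1:ℝ) else 0) :=
          hm.comp measurable_swap
        exact ((hg.measurable.comp measurable_snd).mul hm').aestronglyMeasurable
      · simp only [Function.uncurry, norm_mul, norm_one, one_mul]
        exact mul_le_of_le_one_right (norm_nonneg _) (h01 _ _)
    rw [integral_integral_swap this]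
    congr 1; ext s
    rw [integral_const_mul]
  have hd : Integrable (fun t => ma t - F t) V := Integrable.sub hi hFi
  have h0 := ae_eq_zero_of_integral_contDiff_smul_eq_zero (μ := V) (f := fun t => ma t - F t)
    hd.locallyIntegrable (by
      intro g hg hgc
      have hgc' := hg.continuous
      obtain ⟨C, hC⟩ := hgc.exists_bound_of_continuous hgc'
      have i1 : Integrable (fun t => g t * ma t) V :=
        Integrable.bdd_mul (c := C) hi hgc'.aestronglyMeasurable (Eventually.of_forall hC)
      have i2 : Integrable (fun t => g t * F t) V :=
        hFi.bdd_mul (c := C) hgc'.aestronglyMeasurable (Eventually.of_forall hC)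
      simp only [smul_eq_mul, mul_sub]
      rw [integral_sub i1 i2, key g hgc', sub_self])
  filter_upwards [h0] with t ht
  have := (le_abs_self _).trans (hF1 t)
  linarith

lemma sm_time {g : ℝ → ℝ} (hg : Continuous g) {u ut ux uxx : ℝ → ℝ → ℝ} (H : Sm u ut ux uxx) :
    Sm (fun t x => (∫ s in (0:ℝ)..t, g s) * u t x)
      (fun t x => g t * u t x + (∫ s in (0:ℝ)..t, g s) * ut t x)
      (fun t x => (∫ s in (0:ℝ)..t, g s) * ux t x) (fun t x => (∫ s in (0:ℝ)..t, g s) * uxx t x) := by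
  have d : ∀ t, HasDerivAt (fun t => ∫ s in (0:ℝ)..t, g s) (g t) t := fun t =>
    intervalIntegral.integral_hasDerivAt_right (hg.intervalIntegrable _ _)
      (hg.stronglyMeasurableAtFilter _ _) hg.continuousAt
  have c : Continuous fun t => ∫ s in (0:ℝ)..t, g s :=
    continuous_iff_continuousAt.2 fun t => (d t).continuousAt
  have c' : Continuous fun z : ℝ × ℝ => ∫ s in (0:ℝ)..z.1, g s := c.comp continuous_fst
  refine ⟨c'.mul H.c0, ((hg.comp continuous_fst).mul H.c0).add (c'.mul H.ct), c'.mul H.cx, c'.mul H.cxx, ?_, ?_, ?_⟩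
  · exact fun t x => (d t).mul (H.dt t x)
  · exact fun t x => (H.dx t x).const_mul _
  · exact fun t x => (H.dxx t x).const_mul _

lemma sm_one : Sm (fun _ _ => 1) (fun _ _ => 0) (fun _ _ => 0) (fun _ _ => 0) :=
  ⟨continuous_const, continuous_const, continuous_const, continuous_const,
    fun t _ => hasDerivAt_const t 1, fun _ x => hasDerivAt_const x 1, fun _ x => hasDerivAt_const x 0⟩

lemma MemR0.mass {T c1 c2 : ℝ} (hc : c1 < c2) {A : Set ℝ} {b σ : ℝ → ℝ → Measure (ℝ × ℝ) → ℝ → ℝ}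
    {m0 : Measure ℝ} {μ : Measure (ℝ × ℝ)} {m : ℝ → Measure (ℝ × ℝ)}
    (H : MemR0 T (Ioo c1 c2) A b σ m0 μ m) :
    ∀ᵐ t ∂(volume.restrict (Icc 0 T)), m t univ ≤ 1 := by
  obtain ⟨h1, h2, h3, h4⟩ := H
  have le : ∀ g : ℝ → ℝ, Continuous g → ∫ z, (∫ s in (0:ℝ)..z.1, g s) ∂μ ≤
      ∫ t in Icc 0 T, g t * (m t univ).toReal := by
    intro g hg
    have := h4 _ _ _ _ ((sm_time hg sm_one).cb hc) 0 (by intros; simp)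
    simpa [Measure.real, mul_comm] using this
  have := mass_le h2 h3.2.2.2 (fun g hg => le_antisymm (le g hg) (by
    have := le (fun t => - g t) hg.neg
    simp only [intervalIntegral.integral_neg, integral_neg, neg_mul] at this
    linarith))
  filter_upwards [this] with t ht
  rw [← ENNReal.ofReal_toReal (h3.1 t).ne]
  exact ENNReal.ofReal_le_one.2 ht

lemma MemRm.mass {T c1 c2 : ℝ} (hc : c1 < c2) {A : Set ℝ} {b σ : ℝ → ℝ → Measure (ℝ × ℝ) → ℝ → ℝ}
    {m0 : Measure ℝ} {μ : Measure (ℝ × ℝ)} {m mb : ℝ → Measure (ℝ × ℝ)}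
    (H : MemRm T (Ioo c1 c2) A b σ m0 mb μ m) :
    ∀ᵐ t ∂(volume.restrict (Icc 0 T)), m t univ ≤ 1 := by
  obtain ⟨h1, h2, h3, h4⟩ := H
  have := mass_le h2 h3.2.2.2 (fun g hg => by
    have := h4 _ _ _ _ ((sm_time hg sm_one).cb hc)
    simpa [Measure.real, mul_comm] using this)
  filter_upwards [this] with t ht
  rw [← ENNReal.ofReal_toReal (h3.1 t).ne]
  exact ENNReal.ofReal_le_one.2 ht

lemma exists_kernel {T : ℝ} {O A : Set ℝ} {m : ℝ → Measure (ℝ × ℝ)} (H : MemV T O A m)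
    (hm : ∀ᵐ t ∂(volume.restrict (Icc 0 T)), m t univ ≤ 1) :
    ∃ κ : Kernel ℝ (ℝ × ℝ), (∀ t, κ t univ ≤ 1) ∧ (∀ t, κ t (closure O ×ˢ A)ᶜ = 0) ∧
      ∀ᵐ t ∂(volume.restrict (Icc 0 T)), m t = κ t := by
  classical
  obtain ⟨h1, h2, h3, h4⟩ := H
  have hmm : Measurable m := Measure.measurable_of_measurable_coe _ h3
  have hs : MeasurableSet {t | m t univ ≤ 1} := (h3 _ MeasurableSet.univ) measurableSet_Iic
  refine ⟨⟨fun t => if m t univ ≤ 1 then m t else 0, Measurable.ite hs hmm measurable_const⟩, ?_, ?_, ?_⟩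
  · intro t
    show (if m t univ ≤ 1 then m t else 0) univ ≤ 1
    split_ifs with h
    · exact h
    · simp
  · intro t
    show (if m t univ ≤ 1 then m t else 0) _ = 0
    split_ifs with h
    · exact h2 t
    · simp
  · filter_upwards [hm] with t ht
    show m t = (if m t univ ≤ 1 then m t else 0)
    rw [if_pos ht]

end

section
open ProbabilityTheory

/-- integrals of a clamped function along a flow -/
def KI (T c1 c2 : ℝ) (κ : Kernel ℝ (ℝ × ℝ)) (w : ℝ × ℝ → ℝ) (t : ℝ) : ℝ :=
  ∫ p, w (pr T c1 c2 (t, p.1)) ∂(κ t)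

lemma fin_ker {κ : Kernel ℝ (ℝ × ℝ)} (h1 : ∀ t, κ t univ ≤ 1) : IsFiniteKernel κ :=
  ⟨1, ENNReal.one_lt_top, h1⟩

section
variable {T c1 c2 : ℝ} {A : Set ℝ} {κ : Kernel ℝ (ℝ × ℝ)}

lemma cont_pr (hT : 0 < T) (hc : c1 < c2) {w : ℝ × ℝ → ℝ} (hw : ContinuousOn w (Icc 0 T ×ˢ Icc c1 c2)) :
    Continuous fun z => w (pr T c1 c2 z) :=
  hw.comp_continuous (pr_cont T c1 c2) fun z => pr_mem hT.le hc.le z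

lemma KI_meas (hT : 0 < T) (hc : c1 < c2) (h1 : ∀ t, κ t univ ≤ 1) {w : ℝ × ℝ → ℝ}
    (hw : ContinuousOn w (Icc 0 T ×ˢ Icc c1 c2)) : Measurable (KI T c1 c2 κ w) := by
  haveI := fin_ker h1
  have hm : Measurable fun q : ℝ × (ℝ × ℝ) => w (pr T c1 c2 (q.1, q.2.1)) :=
    (cont_pr hT hc hw).measurable.comp (by fun_prop)
  exact (hm.stronglyMeasurable.integral_kernel_prod_right' (κ := κ)).measurable

lemma KI_integrable (hT : 0 < T) (hc : c1 < c2) (h1 : ∀ t, κ t univ ≤ 1) {w : ℝ × ℝ → ℝ}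
    (hw : ContinuousOn w (Icc 0 T ×ˢ Icc c1 c2)) (t : ℝ) :
    Integrable (fun p : ℝ × ℝ => w (pr T c1 c2 (t, p.1))) (κ t) := by
  haveI := fin_ker h1
  obtain ⟨C, hC⟩ := (isCompact_Icc.prod isCompact_Icc : IsCompact (Icc (0:ℝ) T ×ˢ Icc c1 c2)).exists_bound_of_continuousOn hw
  exact Integrable.of_bound ((cont_pr hT hc hw).measurable.comp (by fun_prop)).aestronglyMeasurable C
    (Eventually.of_forall fun p => hC _ (pr_mem hT.le hc.le _))

lemma KI_bd (hT : 0 < T) (hc : c1 < c2) (h1 : ∀ t, κ t univ ≤ 1) {w : ℝ × ℝ → ℝ} {U : ℝ}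
    (hU : ∀ z ∈ Icc 0 T ×ˢ Icc c1 c2, |w z| ≤ U) (t : ℝ) : |KI T c1 c2 κ w t| ≤ U := by
  haveI := fin_ker h1
  have hU0 : 0 ≤ U := (abs_nonneg _).trans (hU _ (pr_mem hT.le hc.le 0))
  rw [← Real.norm_eq_abs]
  refine (norm_integral_le_of_norm_le (integrable_const U) (Eventually.of_forall fun p => hU _ (pr_mem hT.le hc.le _))).trans ?_
  rw [integral_const, smul_eq_mul]
  refine mul_le_of_le_one_left hU0 ?_
  rw [Measure.real]
  exact ENNReal.toReal_le_of_le_ofReal zero_le_one (by simpa using h1 t)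

lemma KI_add (hT : 0 < T) (hc : c1 < c2) (h1 : ∀ t, κ t univ ≤ 1) {w w' : ℝ × ℝ → ℝ}
    (hw : ContinuousOn w (Icc 0 T ×ˢ Icc c1 c2)) (hw' : ContinuousOn w' (Icc 0 T ×ˢ Icc c1 c2)) (t : ℝ) :
    KI T c1 c2 κ (fun z => w z + w' z) t = KI T c1 c2 κ w t + KI T c1 c2 κ w' t :=
  integral_add (KI_integrable hT hc h1 hw t) (KI_integrable hT hc h1 hw' t)

lemma KI_sub (hT : 0 < T) (hc : c1 < c2) (h1 : ∀ t, κ t univ ≤ 1) {w w' : ℝ × ℝ → ℝ}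
    (hw : ContinuousOn w (Icc 0 T ×ˢ Icc c1 c2)) (hw' : ContinuousOn w' (Icc 0 T ×ˢ Icc c1 c2)) (t : ℝ) :
    KI T c1 c2 κ (fun z => w z - w' z) t = KI T c1 c2 κ w t - KI T c1 c2 κ w' t :=
  integral_sub (KI_integrable hT hc h1 hw t) (KI_integrable hT hc h1 hw' t)

lemma KI_eq (h2 : ∀ t, κ t (Icc c1 c2 ×ˢ A)ᶜ = 0) (w : ℝ × ℝ → ℝ) {t : ℝ} (ht : t ∈ Icc 0 T) :
    ∫ p, w (t, p.1) ∂(κ t) = KI T c1 c2 κ w t := by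
  refine integral_congr_ae ?_
  filter_upwards [measure_eq_zero_iff_ae_notMem.1 (h2 t)] with p hp
  have hp := notMem_compl_iff.1 hp
  show w (t, p.1) = w (pr T c1 c2 (t, p.1))
  rw [pr_id (show ((t, p.1) : ℝ × ℝ) ∈ Icc 0 T ×ˢ Icc c1 c2 from ⟨ht, hp.1⟩)]

end

/-- the time regularity estimate -/
lemma MemR0.est {T c1 c2 : ℝ} (hT : 0 < T) (hc : c1 < c2) {A : Set ℝ} {b σ : ℝ → ℝ → Measure (ℝ × ℝ) → ℝ → ℝ}
    {m0 : Measure ℝ} {μ : Measure (ℝ × ℝ)} {m : ℝ → Measure (ℝ × ℝ)}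
    (H : MemR0 T (Ioo c1 c2) A b σ m0 μ m) {κ : Kernel ℝ (ℝ × ℝ)} (h1 : ∀ t, κ t univ ≤ 1)
    (h2 : ∀ t, κ t (Icc c1 c2 ×ˢ A)ᶜ = 0) (hκ : ∀ᵐ t ∂(volume.restrict (Icc 0 T)), m t = κ t)
    {Cb Cs : ℝ} (hb : ∀ t x ν a, |b t x ν a| ≤ Cb) (hs : ∀ t x ν a, |σ t x ν a| ≤ Cs)
    {u ut ux uxx : ℝ → ℝ → ℝ} (hu : Sm u ut ux uxx) {U : ℝ}
    (hU : ∀ z ∈ Icc 0 T ×ˢ Icc c1 c2, |u z.1 z.2| ≤ U ∧ |ut z.1 z.2| ≤ U ∧ |ux z.1 z.2| ≤ U ∧ |uxx z.1 z.2| ≤ U)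
    {g : ℝ → ℝ} (hg : Continuous g) {K : ℝ} (hK : ∀ t ∈ Icc (0:ℝ) T, |∫ s in (0:ℝ)..t, g s| ≤ K) :
    ∫ t in Icc 0 T, g t * KI T c1 c2 κ (fun z => u z.1 z.2) t ≤ (U + U * T + (Cb * U + Cs ^ 2 / 2 * U) * T) * K := by
  haveI := fin_ker h1
  obtain ⟨H1, H2, H3, H4⟩ := H
  have hU0 : 0 ≤ U := (abs_nonneg _).trans (hU _ (pr_mem hT.le hc.le 0)).1
  have hK0 : 0 ≤ K := (abs_nonneg _).trans (hK 0 ⟨le_rfl, hT.le⟩)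
  have hCb : 0 ≤ Cb := (abs_nonneg _).trans (hb 0 0 0 0)
  set V := (volume : Measure ℝ).restrict (Icc 0 T) with hV
  have hVT : V.real univ = T := by simp [hV, Measure.real, hT.le]
  set θ : ℝ → ℝ := fun t => ∫ s in (0:ℝ)..t, g s with hθ
  have S := sm_time hg hu
  have Sn : Sm (fun t x => - (θ t * u t x)) (fun t x => - (g t * u t x + θ t * ut t x))
      (fun t x => - (θ t * ux t x)) (fun t x => - (θ t * uxx t x)) :=
    ⟨S.c0.neg, S.ct.neg, S.cx.neg, S.cxx.neg, fun t x => (S.dt t x).neg, fun t x => (S.dx t x).neg,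
      fun t x => (S.dxx t x).neg⟩
  have E := H4 _ _ _ _ (Sn.cb hc) (K * (Cb * U + Cs ^ 2 / 2 * U)) (by
    intro t ht x hx ν _ _ a _
    rw [closure_Ioo hc.ne] at hx
    have hz := hU (t, x) ⟨ht, hx⟩
    have e : b t x ν a * -(θ t * ux t x) + σ t x ν a ^ 2 / 2 * -(θ t * uxx t x)
      = - (θ t * (b t x ν a * ux t x + σ t x ν a ^ 2 / 2 * uxx t x)) := by ring
    rw [e, abs_neg, abs_mul]
    refine mul_le_mul (hK t ht) ?_ (abs_nonneg _) hK0
    refine (abs_add_le _ _).trans (add_le_add ?_ ?_)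
    · rw [abs_mul]; exact mul_le_mul (hb t x ν a) hz.2.2.1 (abs_nonneg _) hCb
    · rw [abs_mul, abs_div, abs_pow, abs_two]
      refine mul_le_mul ?_ hz.2.2.2 (abs_nonneg _) (by positivity)
      have := pow_le_pow_left₀ (abs_nonneg _) (hs t x ν a) 2
      linarith)
  have mass : ∫ t, (m t univ).toReal ∂V ≤ T := by
    have : ∫ t, (m t univ).toReal ∂V ≤ ∫ t, (1:ℝ) ∂V := by
      refine integral_mono_ae H3.2.2.2 (integrable_const _) ?_
      filter_upwards [hκ] with t ht
      rw [ht]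
      exact ENNReal.toReal_le_of_le_ofReal zero_le_one (by simpa using h1 t)
    simpa [hVT] using this
  have ci : ∀ {f : ℝ × ℝ → ℝ}, Continuous f → Integrable (KI T c1 c2 κ f) V := by
    intro f hf
    obtain ⟨C, hC⟩ := (isCompact_Icc.prod isCompact_Icc : IsCompact (Icc (0:ℝ) T ×ˢ Icc c1 c2)).exists_bound_of_continuousOn hf.continuousOn
    exact Integrable.of_bound (KI_meas hT hc h1 hf.continuousOn).aestronglyMeasurable C
      (Eventually.of_forall fun t => KI_bd hT hc h1 hC t)
  have cθ : Continuous θ := intervalIntegral.continuous_primitive (fun a b => hg.intervalIntegrable a b) 0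
  have Ct : ∫ t, (∫ p, (fun t x => - (g t * u t x + θ t * ut t x)) t p.1 ∂(m t)) ∂V
      = - (∫ t, g t * KI T c1 c2 κ (fun z => u z.1 z.2) t ∂V)
        - ∫ t, θ t * KI T c1 c2 κ (fun z => ut z.1 z.2) t ∂V := by
    have gi : ∀ {f : ℝ → ℝ} {v : ℝ × ℝ → ℝ}, Continuous f → Continuous v →
        Integrable (fun t => f t * KI T c1 c2 κ v t) V := by
      intro f v hf hv
      obtain ⟨C, hC⟩ := (isCompact_Icc (a := (0:ℝ)) (b := T)).exists_bound_of_continuousOn hf.continuousOn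
      refine (ci hv).bdd_mul (c := C) hf.aestronglyMeasurable ?_
      filter_upwards [ae_restrict_mem measurableSet_Icc] with t ht using hC t ht
    have gn : Integrable (fun t => - (g t * KI T c1 c2 κ (fun z => u z.1 z.2) t)) V := (gi hg hu.c0).neg
    rw [← integral_neg, ← integral_sub gn (gi cθ hu.ct)]
    refine integral_congr_ae ?_
    filter_upwards [hκ, ae_restrict_mem measurableSet_Icc] with t ht ht'
    rw [ht, ← KI_eq h2 _ ht', ← KI_eq h2 _ ht']
    have e := KI_integrable hT hc h1 hu.c0.continuousOn t
    have e' := KI_integrable hT hc h1 hu.ct.continuousOn t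
    have tr : ∀ v : ℝ × ℝ → ℝ, Integrable (fun p : ℝ × ℝ => v (pr T c1 c2 (t, p.1))) (κ t) →
        Integrable (fun p : ℝ × ℝ => v (t, p.1)) (κ t) := by
      intro v hv
      refine hv.congr ?_
      filter_upwards [measure_eq_zero_iff_ae_notMem.1 (h2 t)] with p hp
      have hp := notMem_compl_iff.1 hp
      rw [pr_id (show ((t, p.1) : ℝ × ℝ) ∈ Icc 0 T ×ˢ Icc c1 c2 from ⟨ht', hp.1⟩)]
    have i1 : Integrable (fun p : ℝ × ℝ => g t * u t p.1) (κ t) := (tr (fun z => u z.1 z.2) e).const_mul _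
    have i2 : Integrable (fun p : ℝ × ℝ => θ t * ut t p.1) (κ t) := (tr (fun z => ut z.1 z.2) e').const_mul _
    rw [integral_neg, integral_add i1 i2, integral_const_mul, integral_const_mul]
    ring
  rw [Ct] at E
  have B1 : |∫ p, - (θ p.1 * u p.1 p.2) ∂μ| ≤ K * U := by
    rw [← Real.norm_eq_abs]
    refine (norm_integral_le_of_norm_le (integrable_const (K * U)) ?_).trans_eq (by simp)
    filter_upwards [measure_eq_zero_iff_ae_notMem.1 H2] with z hz
    have hz := notMem_compl_iff.1 hz
    rw [closure_Ioo hc.ne] at hz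
    rw [norm_neg, norm_mul]
    exact mul_le_mul (hK _ hz.1) (hU z hz).1 (abs_nonneg _) hK0
  have B2 : |∫ t, θ t * KI T c1 c2 κ (fun z => ut z.1 z.2) t ∂V| ≤ K * U * T := by
    rw [← Real.norm_eq_abs]
    refine (norm_integral_le_of_norm_le (integrable_const (K * U)) ?_).trans_eq (by
      rw [integral_const, hVT]; simp [mul_comm])
    filter_upwards [ae_restrict_mem measurableSet_Icc] with t ht
    rw [norm_mul]
    exact mul_le_mul (hK _ ht) (KI_bd hT hc h1 (fun z hz => (hU z hz).2.1) t) (abs_nonneg _) hK0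
  have B3 : ∫ x, (fun t x => - (θ t * u t x)) 0 x ∂m0 = 0 := by simp [hθ]
  have B4 : K * (Cb * U + Cs ^ 2 / 2 * U) * ∫ t, (m t univ).toReal ∂V ≤ K * (Cb * U + Cs ^ 2 / 2 * U) * T :=
    mul_le_mul_of_nonneg_left mass (by positivity)
  rw [B3] at E
  have := abs_le.1 B1
  have := abs_le.1 B2
  linarith

end

section
open ProbabilityTheory

section
variable {T c1 c2 : ℝ} {A : Set ℝ} {κn : ℕ → Kernel ℝ (ℝ × ℝ)} {κ : Kernel ℝ (ℝ × ℝ)}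

lemma KI_L1 (hT : 0 < T) (hc : c1 < c2) (h1n : ∀ n t, κn n t univ ≤ 1) (h1 : ∀ t, κ t univ ≤ 1)
    (h2n : ∀ n t, κn n t (Icc c1 c2 ×ˢ A)ᶜ = 0) (h2 : ∀ t, κ t (Icc c1 c2 ×ˢ A)ᶜ = 0)
    (hest : ∀ u ut ux uxx, Sm u ut ux uxx → ∃ C', 0 ≤ C' ∧ ∀ g : ℝ → ℝ, Continuous g → ∀ K,
      (∀ t ∈ Icc (0:ℝ) T, |∫ s in (0:ℝ)..t, g s| ≤ K) →
      (∀ n, ∫ t in Icc 0 T, g t * KI T c1 c2 (κn n) (fun z => u z.1 z.2) t ≤ C' * K) ∧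
      ∫ t in Icc 0 T, g t * KI T c1 c2 κ (fun z => u z.1 z.2) t ≤ C' * K)
    (hconv : ConvV T (fun n t => κn n t) (fun t => κ t)) {w : ℝ × ℝ → ℝ}
    (hw : ContinuousOn w (Icc 0 T ×ˢ Icc c1 c2)) :
    Tendsto (fun n => ∫ t in Icc 0 T, |KI T c1 c2 (κn n) w t - KI T c1 c2 κ w t|) atTop (𝓝 0) := by
  have hQ : IsCompact (Icc (0:ℝ) T ×ˢ Icc c1 c2) := isCompact_Icc.prod isCompact_Icc
  set V := (volume : Measure ℝ).restrict (Icc 0 T) with hV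
  have hVT : V.real univ = T := by simp [hV, Measure.real, hT.le]
  rw [Metric.tendsto_atTop]
  intro ε hε
  obtain ⟨u, ut, ux, uxx, hu, happ⟩ := smooth_approx hQ hw (ε := ε / (4 * (T + 1))) (by positivity)
  obtain ⟨U, hU⟩ := hQ.exists_bound_of_continuousOn hu.c0.continuousOn
  obtain ⟨C', hC0, hC'⟩ := hest u ut ux uxx hu
  set f : ℝ × ℝ → ℝ := fun z => u z.1 z.2 with hf
  have mI : ∀ {κ : Kernel ℝ (ℝ × ℝ)}, (∀ t, κ t univ ≤ 1) → Measurable (KI T c1 c2 κ f) := fun h =>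
    KI_meas hT hc h hu.c0.continuousOn
  have bI : ∀ {κ : Kernel ℝ (ℝ × ℝ)}, (∀ t, κ t univ ≤ 1) → ∀ t, |KI T c1 c2 κ f t| ≤ U := fun h =>
    KI_bd hT hc h hU
  set δ : ℕ → ℝ → ℝ := fun n t => KI T c1 c2 (κn n) f t - KI T c1 c2 κ f t with hδ
  have mδ : ∀ n, Measurable (δ n) := fun n => (mI (h1n n)).sub (mI h1)
  have bδ : ∀ n t, |δ n t| ≤ U + U := fun n t => (abs_sub _ _).trans (add_le_add (bI (h1n n) t) (bI h1 t))
  have gint : ∀ {κ : Kernel ℝ (ℝ × ℝ)}, (∀ t, κ t univ ≤ 1) → ∀ {g : ℝ → ℝ}, Continuous g →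
      Integrable (fun t => g t * KI T c1 c2 κ f t) V := by
    intro κ h g hg
    have : Integrable g V := hg.continuousOn.integrableOn_compact isCompact_Icc
    exact this.mul_bdd (c := U) (mI h).aestronglyMeasurable (Eventually.of_forall (bI h))
  have gδ : ∀ n {g : ℝ → ℝ}, Continuous g → ∫ t, g t * δ n t ∂V =
      (∫ t, g t * KI T c1 c2 (κn n) f t ∂V) - ∫ t, g t * KI T c1 c2 κ f t ∂V := by
    intro n g hg
    rw [← integral_sub (gint (h1n n) hg) (gint h1 hg)]
    congr 1; ext t; simp only [hδ]; ring
  have hsq : Tendsto (fun n => ∫ t, (δ n t) ^ 2 ∂V) atTop (𝓝 0) := by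
    refine strong_of_weak (C' := C' + C') hT mδ bδ (by positivity) ?_ ?_
    · intro n g hg K hK
      rw [gδ n hg]
      have a1 := (hC' g hg K hK).1 n
      have a2 := (hC' (fun t => - g t) hg.neg K (fun t ht => by
        rw [intervalIntegral.integral_neg, abs_neg]; exact hK t ht)).2
      simp only [neg_mul, integral_neg] at a2
      rw [add_mul]
      linarith
    · intro g hg
      have hcp : Continuous fun t => g (max 0 (min T t)) := by fun_prop
      have hh : Continuous fun q : ℝ × ℝ × ℝ => g (max 0 (min T q.1)) * f (pr T c1 c2 (q.1, q.2.1)) :=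
        (hcp.comp continuous_fst).mul ((cont_pr hT hc hu.c0.continuousOn).comp (by fun_prop))
      obtain ⟨G, hG⟩ := (isCompact_Icc (a := (0:ℝ)) (b := T)).exists_bound_of_continuousOn hg.continuousOn
      have hcl : ∀ t, max 0 (min T t) ∈ Icc 0 T := fun t => ⟨le_max_left _ _, max_le hT.le (min_le_left _ _)⟩
      have G0 : 0 ≤ G := (norm_nonneg _).trans (hG _ (hcl 0))
      have := hconv (fun t p => g (max 0 (min T t)) * f (pr T c1 c2 (t, p.1))) hh ⟨G * U, fun t p => by
        rw [abs_mul]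
        exact mul_le_mul (hG _ (hcl t)) (hU _ (pr_mem hT.le hc.le _)) (abs_nonneg _) G0⟩
      have e : ∀ κ : Kernel ℝ (ℝ × ℝ), (∫ t in Icc 0 T, ∫ p, g (max 0 (min T t)) * f (pr T c1 c2 (t, p.1)) ∂(κ t))
          = ∫ t, g t * KI T c1 c2 κ f t ∂V := by
        intro κ
        refine setIntegral_congr_fun measurableSet_Icc fun t ht => ?_
        simp only [integral_const_mul]
        rw [min_eq_right ht.2, max_eq_right ht.1]
        rfl
      simp only [e] at this
      have e2 : (fun n => ∫ t in Icc 0 T, g t * δ n t) = fun n =>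
          (∫ t, g t * KI T c1 c2 (κn n) f t ∂V) - ∫ t, g t * KI T c1 c2 κ f t ∂V := funext fun n => gδ n hg
      rw [e2]
      have := this.sub_const (∫ t, g t * KI T c1 c2 κ f t ∂V)
      rwa [sub_self] at this
  have hs2 : Tendsto (fun n => √ (∫ t, (δ n t) ^ 2 ∂V) * √ T) atTop (𝓝 0) := by
    have := ((Real.continuous_sqrt.tendsto _).comp hsq).mul_const (√ T)
    simpa using this
  obtain ⟨n0, hn0⟩ := Metric.tendsto_atTop.1 hs2 (ε / 2) (by positivity)
  refine ⟨n0, fun n hn => ?_⟩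
  have h3 := hn0 n hn
  rw [Real.dist_eq, sub_zero, abs_of_nonneg (by positivity)] at h3
  rw [Real.dist_eq, sub_zero, abs_of_nonneg (integral_nonneg fun _ => abs_nonneg _)]
  have L1 : ∫ t, |δ n t| ∂V ≤ √ (∫ t, (δ n t) ^ 2 ∂V) * √ T := by
    have := integral_mul_le_Lp_mul_Lq_of_nonneg (μ := V) (f := fun t => |δ n t|) (g := fun _ => (1:ℝ))
      Real.HolderConjugate.two_two (Eventually.of_forall fun _ => abs_nonneg _)
      (Eventually.of_forall fun _ => zero_le_one)
      (MemLp.of_bound (mδ n).abs.aestronglyMeasurable (U + U) (Eventually.of_forall fun t => by simpa using bδ n t))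
      (memLp_const 1)
    rw [Real.sqrt_eq_rpow, Real.sqrt_eq_rpow]
    simpa [hVT, hT.le] using this
  have pw : ∀ t, |KI T c1 c2 (κn n) w t - KI T c1 c2 κ w t| ≤ |δ n t| + 2 * (ε / (4 * (T + 1))) := by
    intro t
    have q : ∀ {κ : Kernel ℝ (ℝ × ℝ)}, (∀ t, κ t univ ≤ 1) →
        |KI T c1 c2 κ f t - KI T c1 c2 κ w t| ≤ ε / (4 * (T + 1)) := by
      intro κ h
      rw [← KI_sub hT hc h hu.c0.continuousOn hw]
      exact KI_bd hT hc h (fun z hz => happ z hz) t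
    have q1 := abs_le.1 (q (h1n n))
    have q2 := abs_le.1 (q h1)
    have q3 := neg_abs_le (δ n t)
    have q4 := le_abs_self (δ n t)
    simp only [hδ] at q3 q4 ⊢
    rw [abs_le]; constructor <;> linarith [q1.1, q1.2, q2.1, q2.2]
  have iδ : Integrable (fun t => |δ n t|) V :=
    (Integrable.of_bound (mδ n).aestronglyMeasurable (U + U) (Eventually.of_forall (bδ n))).abs
  have L2 : ∫ t, |KI T c1 c2 (κn n) w t - KI T c1 c2 κ w t| ∂V ≤ ∫ t, (|δ n t| + 2 * (ε / (4 * (T + 1)))) ∂V :=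
    integral_mono_of_nonneg (Eventually.of_forall fun _ => abs_nonneg _) (iδ.add (integrable_const _))
      (Eventually.of_forall pw)
  rw [integral_add iδ (integrable_const _), integral_const, hVT, smul_eq_mul] at L2
  have L3 : T * (2 * (ε / (4 * (T + 1)))) < ε / 2 := by
    rw [show T * (2 * (ε / (4 * (T + 1)))) = T * ε / (2 * (T + 1)) by field_simp; ring, div_lt_div_iff₀ (by positivity) (by positivity)]
    nlinarith
  linarith

lemma subseq (hT : 0 < T) (hc : c1 < c2) (h1n : ∀ n t, κn n t univ ≤ 1) (h1 : ∀ t, κ t univ ≤ 1)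
    (h2n : ∀ n t, κn n t (Icc c1 c2 ×ˢ A)ᶜ = 0) (h2 : ∀ t, κ t (Icc c1 c2 ×ˢ A)ᶜ = 0)
    (hest : ∀ u ut ux uxx, Sm u ut ux uxx → ∃ C', 0 ≤ C' ∧ ∀ g : ℝ → ℝ, Continuous g → ∀ K,
      (∀ t ∈ Icc (0:ℝ) T, |∫ s in (0:ℝ)..t, g s| ≤ K) →
      (∀ n, ∫ t in Icc 0 T, g t * KI T c1 c2 (κn n) (fun z => u z.1 z.2) t ≤ C' * K) ∧
      ∫ t in Icc 0 T, g t * KI T c1 c2 κ (fun z => u z.1 z.2) t ≤ C' * K)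
    (hconv : ConvV T (fun n t => κn n t) (fun t => κ t)) {ι : Type} [Fintype ι] {w : ι → ℝ × ℝ → ℝ}
    (hw : ∀ i, ContinuousOn (w i) (Icc 0 T ×ˢ Icc c1 c2)) :
    ∃ φ : ℕ → ℕ, StrictMono φ ∧ ∀ᵐ t ∂(volume.restrict (Icc 0 T)), ∀ i,
      Tendsto (fun k => KI T c1 c2 (κn (φ k)) (w i) t) atTop (𝓝 (KI T c1 c2 κ (w i) t)) := by
  have hQ : IsCompact (Icc (0:ℝ) T ×ˢ Icc c1 c2) := isCompact_Icc.prod isCompact_Icc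
  set V := (volume : Measure ℝ).restrict (Icc 0 T) with hV
  set F : ℕ → ℝ → ℝ := fun n t => ∑ i, |KI T c1 c2 (κn n) (w i) t - KI T c1 c2 κ (w i) t| with hF
  have mi : ∀ n i, Measurable fun t => |KI T c1 c2 (κn n) (w i) t - KI T c1 c2 κ (w i) t| := fun n i =>
    ((KI_meas hT hc (h1n n) (hw i)).sub (KI_meas hT hc h1 (hw i))).abs
  have ii : ∀ n i, Integrable (fun t => |KI T c1 c2 (κn n) (w i) t - KI T c1 c2 κ (w i) t|) V := by
    intro n i
    obtain ⟨C, hC⟩ := hQ.exists_bound_of_continuousOn (hw i)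
    refine Integrable.of_bound (mi n i).aestronglyMeasurable (C + C) (Eventually.of_forall fun t => ?_)
    rw [Real.norm_eq_abs, abs_abs]
    exact (abs_sub _ _).trans (add_le_add (KI_bd hT hc (h1n n) hC t) (KI_bd hT hc h1 hC t))
  have hlim : Tendsto (fun n => ∫ t, F n t ∂V) atTop (𝓝 0) := by
    have : (fun n => ∫ t, F n t ∂V) = fun n => ∑ i, ∫ t, |KI T c1 c2 (κn n) (w i) t - KI T c1 c2 κ (w i) t| ∂V := by
      ext n; exact integral_finset_sum _ fun i _ => ii n i
    rw [this, ← Finset.sum_const_zero (s := (Finset.univ : Finset ι))]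
    exact tendsto_finset_sum _ fun i _ => KI_L1 hT hc h1n h1 h2n h2 hest hconv (hw i)
  have F0 : ∀ n t, 0 ≤ F n t := fun n t => Finset.sum_nonneg fun i _ => abs_nonneg _
  have iF : ∀ n, Integrable (F n) V := fun n => integrable_finset_sum _ fun i _ => ii n i
  have hin : TendstoInMeasure V F atTop (fun _ => 0) := by
    refine tendstoInMeasure_of_tendsto_eLpNorm one_ne_zero (fun n => (iF n).aestronglyMeasurable)
      aestronglyMeasurable_const ?_
    have e : (fun n => eLpNorm (F n - fun _ => 0) 1 V) = fun n => ENNReal.ofReal (∫ t, F n t ∂V) := by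
      ext n
      rw [eLpNorm_one_eq_lintegral_enorm, ofReal_integral_eq_lintegral_ofReal (iF n) (Eventually.of_forall (F0 n))]
      congr 1; ext t
      simp only [Pi.sub_apply, sub_zero]
      rw [Real.enorm_of_nonneg (F0 n t)]
    rw [e]
    simpa using ENNReal.tendsto_ofReal hlim
  obtain ⟨φ, hφ, hae⟩ := hin.exists_seq_tendsto_ae
  refine ⟨φ, hφ, ?_⟩
  filter_upwards [hae] with t ht i
  rw [tendsto_iff_norm_sub_tendsto_zero]
  refine squeeze_zero (fun _ => norm_nonneg _) (fun k => ?_) ht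
  exact Finset.single_le_sum (f := fun i => |KI T c1 c2 (κn (φ k)) (w i) t - KI T c1 c2 κ (w i) t|)
    (fun i _ => abs_nonneg _) (Finset.mem_univ i)
end

end

section
open ProbabilityTheory

/-- disintegration identity between a flow and its (t,x) marginal with a control kernel -/
def Dis (T : ℝ) (m : ℝ → Measure (ℝ × ℝ)) (M : Measure (ℝ × ℝ)) (ν : Kernel (ℝ × ℝ) ℝ) : Prop :=
  ∀ f : ℝ × (ℝ × ℝ) → ℝ, Measurable f → (∃ C, ∀ q, |f q| ≤ C) →
    ∫ t in Icc 0 T, ∫ p, f (t, p) ∂(m t) = ∫ z, ∫ a, f (z.1, (z.2, a)) ∂(ν z) ∂M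

lemma disint {T c1 c2 : ℝ} {A : Set ℝ} (hA : MeasurableSet A) {a0 : ℝ} (ha0 : a0 ∈ A)
    {κ : Kernel ℝ (ℝ × ℝ)} (h1 : ∀ t, κ t univ ≤ 1) (h2 : ∀ t, κ t (Icc c1 c2 ×ˢ A)ᶜ = 0) :
    ∃ (M : Measure (ℝ × ℝ)) (ν : Kernel (ℝ × ℝ) ℝ), IsFiniteMeasure M ∧ IsMarkovKernel ν ∧
      (∀ z, ν z Aᶜ = 0) ∧ M (Icc 0 T ×ˢ Icc c1 c2)ᶜ = 0 ∧
      (∀ f : ℝ → ℝ, Continuous f → Integrable f → (∀ t, 0 ≤ f t) → ∫ z, f z.1 ∂M ≤ ∫ t, f t) ∧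
      Dis T (fun t => κ t) M ν := by
  classical
  haveI := fin_ker h1
  set V := (volume : Measure ℝ).restrict (Icc 0 T) with hV
  set e : ℝ × (ℝ × ℝ) → (ℝ × ℝ) × ℝ := fun q => ((q.1, q.2.1), q.2.2) with he
  have em : Measurable e := by fun_prop
  set M3 := (V ⊗ₘ κ).map e with hM3
  set ν0 := M3.condKernel with hν0
  have hd : M3.fst ⊗ₘ ν0 = M3 := M3.disintegrate ν0
  have hS : MeasurableSet {z | ν0 z Aᶜ = 0} := (Kernel.measurable_coe ν0 hA.compl) (measurableSet_singleton 0)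
  set ν : Kernel (ℝ × ℝ) ℝ := Kernel.piecewise hS ν0 (Kernel.const _ (Measure.dirac a0)) with hν
  have hνa : ∀ z, ν z = if ν0 z Aᶜ = 0 then ν0 z else Measure.dirac a0 := by
    intro z; rw [hν, Kernel.piecewise_apply]; rfl
  have hsup : M3 (univ ×ˢ Aᶜ) = 0 := by
    rw [hM3, Measure.map_apply em (MeasurableSet.univ.prod hA.compl),
      Measure.compProd_apply (em (MeasurableSet.univ.prod hA.compl))]
    rw [lintegral_eq_zero_iff' (by
      exact (Kernel.measurable_kernel_prodMk_left (em (MeasurableSet.univ.prod hA.compl))).aemeasurable)]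
    refine Eventually.of_forall fun t => ?_
    refine measure_mono_null ?_ (h2 t)
    intro p hp
    simp only [e, mem_preimage, mem_prod, mem_univ, true_and, mem_compl_iff] at hp ⊢
    tauto
  have hae : ∀ᵐ z ∂M3.fst, ν0 z Aᶜ = 0 := by
    rw [← hd, Measure.compProd_apply (MeasurableSet.univ.prod hA.compl)] at hsup
    rw [lintegral_eq_zero_iff' (Kernel.measurable_kernel_prodMk_left (MeasurableSet.univ.prod hA.compl)).aemeasurable] at hsup
    filter_upwards [hsup] with z hz
    have e1 : Prod.mk z ⁻¹' (univ ×ˢ Aᶜ : Set ((ℝ × ℝ) × ℝ)) = Aᶜ := by ext a; simp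
    rw [e1] at hz
    exact hz
  have hνae : ∀ᵐ z ∂M3.fst, ν z = ν0 z := by
    filter_upwards [hae] with z hz
    rw [hνa, if_pos hz]
  haveI : IsMarkovKernel ν := ⟨fun z => by rw [hνa]; split_ifs <;> infer_instance⟩
  have hdis : Dis T (fun t => κ t) M3.fst ν := by
    rintro f hf ⟨C, hC⟩
    have i1 : Integrable f (V ⊗ₘ κ) := Integrable.of_bound hf.aestronglyMeasurable C (Eventually.of_forall hC)
    have hg : Measurable fun q : (ℝ × ℝ) × ℝ => f (q.1.1, (q.1.2, q.2)) := hf.comp (by fun_prop)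
    have i2 : Integrable (fun q : (ℝ × ℝ) × ℝ => f (q.1.1, (q.1.2, q.2))) (M3.fst ⊗ₘ ν0) :=
      Integrable.of_bound hg.aestronglyMeasurable C (Eventually.of_forall fun q => hC _)
    rw [← Measure.integral_compProd i1]
    calc ∫ x, f x ∂(V ⊗ₘ κ) = ∫ q : (ℝ × ℝ) × ℝ, f (q.1.1, (q.1.2, q.2)) ∂M3 := by
          rw [hM3, integral_map em.aemeasurable hg.aestronglyMeasurable]
      _ = ∫ z, ∫ a, f (z.1, (z.2, a)) ∂(ν0 z) ∂M3.fst := by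
          rw [← Measure.integral_compProd i2, hd]
      _ = _ := by
          refine integral_congr_ae ?_
          filter_upwards [hνae] with z hz
          rw [hz]
  refine ⟨M3.fst, ν, inferInstance, inferInstance, ?_, ?_, ?_, hdis⟩
  · intro z
    rw [hνa]
    split_ifs with h
    · exact h
    · simp [hA.compl, ha0]
  · have hQm : MeasurableSet (Icc (0:ℝ) T ×ˢ Icc c1 c2) := measurableSet_Icc.prod measurableSet_Icc
    rw [Measure.fst_apply hQm.compl, hM3, Measure.map_apply em (measurable_fst hQm.compl),
      Measure.compProd_apply (em (measurable_fst hQm.compl)),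
      lintegral_eq_zero_iff' (Kernel.measurable_kernel_prodMk_left (em (measurable_fst hQm.compl))).aemeasurable]
    filter_upwards [ae_restrict_mem measurableSet_Icc] with t ht
    refine measure_mono_null ?_ (h2 t)
    intro p hp
    simp only [e, mem_preimage, mem_prod, mem_compl_iff] at hp ⊢
    tauto
  · intro f hf hfi hf0
    have hfm : Measurable fun q : ℝ × (ℝ × ℝ) => f q.1 := hf.measurable.comp measurable_fst
    have hf1 : AEStronglyMeasurable (fun q : ℝ × (ℝ × ℝ) => f q.1) (V ⊗ₘ κ) := hfm.aestronglyMeasurable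
    have hk : ∀ t, (κ t).real univ ≤ 1 := fun t => ENNReal.toReal_le_of_le_ofReal zero_le_one (by simpa using h1 t)
    have i1 : Integrable (fun q : ℝ × (ℝ × ℝ) => f q.1) (V ⊗ₘ κ) := by
      rw [Measure.integrable_compProd_iff hf1]
      refine ⟨Eventually.of_forall fun t => integrable_const (f t), ?_⟩
      refine Integrable.mono' hfi.restrict.norm ?_ (Eventually.of_forall fun t => ?_)
      · have : StronglyMeasurable fun q : ℝ × (ℝ × ℝ) => ‖f q.1‖ := hfm.norm.stronglyMeasurable
        exact (this.integral_kernel_prod_right' (κ := κ)).aestronglyMeasurable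
      · simp only [integral_const, smul_eq_mul, norm_mul, norm_norm]
        refine mul_le_of_le_one_left (norm_nonneg _) ?_
        rw [Real.norm_of_nonneg measureReal_nonneg]; exact hk t
    have : ∫ z, f z.1 ∂M3.fst = ∫ q : ℝ × (ℝ × ℝ), f q.1 ∂(V ⊗ₘ κ) := by
      rw [Measure.fst, integral_map measurable_fst.aemeasurable (by exact (hf.measurable.comp measurable_fst).aestronglyMeasurable), hM3,
        integral_map em.aemeasurable (by
          exact (hf.measurable.comp (measurable_fst.comp measurable_fst)).aestronglyMeasurable)]
    rw [this, Measure.integral_compProd i1]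
    refine le_trans (integral_mono_of_nonneg (Eventually.of_forall fun t => integral_nonneg fun _ => hf0 t)
      hfi.restrict (Eventually.of_forall fun t => ?_)) (setIntegral_le_integral hfi (Eventually.of_forall hf0))
    simp only [integral_const, smul_eq_mul]
    exact mul_le_of_le_one_left (hf0 t) (hk t)

lemma wd_int {p : ℝ × ℝ → ℝ} (hp : Measurable p) (h0 : ∀ z, 0 ≤ p z) (g : ℝ × ℝ → ℝ) :
    ∫ z, g z ∂(volume.withDensity fun z => ENNReal.ofReal (p z)) = ∫ z, g z * p z := by
  rw [integral_withDensity_eq_integral_toReal_smul (by fun_prop) (Eventually.of_forall fun _ => ENNReal.ofReal_lt_top)]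
  refine integral_congr_ae (Eventually.of_forall fun z => ?_)
  simp [ENNReal.toReal_ofReal (h0 z), mul_comm]

lemma p_int {T c1 c2 : ℝ} {p : ℝ × ℝ → ℝ} (hp : MemLp p 2) (hQ : ∀ z ∉ Icc 0 T ×ˢ Icc c1 c2, p z = 0) :
    Integrable p := by
  have hQc : IsCompact (Icc (0:ℝ) T ×ˢ Icc c1 c2) := isCompact_Icc.prod isCompact_Icc
  have : IntegrableOn p (Icc (0:ℝ) T ×ˢ Icc c1 c2) := by
    haveI : IsFiniteMeasure ((volume : Measure (ℝ × ℝ)).restrict (Icc (0:ℝ) T ×ˢ Icc c1 c2)) :=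
      ⟨by simpa using hQc.measure_lt_top⟩
    exact (hp.restrict _).integrable (by norm_num)
  rwa [integrableOn_iff_integrable_of_support_subset] at this
  intro z hz
  by_contra h
  exact hz (hQ z h)

lemma wd_fin {T c1 c2 : ℝ} {p : ℝ × ℝ → ℝ} (hp : MemLp p 2) (hQ : ∀ z ∉ Icc 0 T ×ˢ Icc c1 c2, p z = 0) :
    IsFiniteMeasure (volume.withDensity fun z => ENNReal.ofReal (p z)) :=
  isFiniteMeasure_withDensity_ofReal (p_int hp hQ).2

lemma wd_null {T c1 c2 : ℝ} {p : ℝ × ℝ → ℝ} (hQ : ∀ z ∉ Icc 0 T ×ˢ Icc c1 c2, p z = 0) :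
    (volume.withDensity fun z => ENNReal.ofReal (p z)) (Icc 0 T ×ˢ Icc c1 c2)ᶜ = 0 := by
  have hQm : MeasurableSet (Icc (0:ℝ) T ×ˢ Icc c1 c2) := measurableSet_Icc.prod measurableSet_Icc
  rw [withDensity_apply _ hQm.compl]
  rw [setLIntegral_congr_fun hQm.compl (g := fun _ => 0)]
  · simp
  · intro z hz
    simp [hQ z hz]

lemma rebuild {T c1 c2 : ℝ} (hc : c1 < c2) {A : Set ℝ} (hA : MeasurableSet A)
    {ν : Kernel (ℝ × ℝ) ℝ} [IsMarkovKernel ν] (hν : ∀ z, ν z Aᶜ = 0)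
    {p : ℝ × ℝ → ℝ} (hpm : Measurable p) (hp : MemLp p 2) (h0 : ∀ z, 0 ≤ p z)
    (hQ : ∀ z ∉ Icc 0 T ×ˢ Icc c1 c2, p z = 0) :
    ∃ m : ℝ → Measure (ℝ × ℝ), MemV T (Ioo c1 c2) A m ∧
      Dis T m (volume.withDensity fun z => ENNReal.ofReal (p z)) ν := by
  classical
  have hpi := p_int hp hQ
  set η : Kernel ℝ ℝ := Kernel.withDensity (Kernel.const ℝ (volume : Measure ℝ)) (fun t x => ENNReal.ofReal (p (t, x))) with hη
  have hpm' : Measurable (Function.uncurry fun t x => ENNReal.ofReal (p (t, x))) := hpm.ennreal_ofReal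
  have hηt : ∀ t, η t = volume.withDensity fun x => ENNReal.ofReal (p (t, x)) := fun t => by
    rw [hη, Kernel.withDensity_apply _ hpm', Kernel.const_apply]
  haveI : IsSFiniteKernel η := by
    rw [hη]; exact Kernel.IsSFiniteKernel.withDensity _ (fun _ _ => ENNReal.ofReal_ne_top)
  have hmass : ∀ t, (η ⊗ₖ ν) t univ = ∫⁻ x, ENNReal.ofReal (p (t, x)) := by
    intro t
    rw [Kernel.compProd_apply_univ, hηt, withDensity_apply _ MeasurableSet.univ, Measure.restrict_univ]
  set S : Set ℝ := {t | (η ⊗ₖ ν) t univ < ⊤} with hS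
  have hSm : MeasurableSet S := (Kernel.measurable_coe _ MeasurableSet.univ) measurableSet_Iio
  have hpt : ∀ᵐ t : ℝ, Integrable fun x => p (t, x) := Integrable.prod_right_ae (μ := volume) (ν := volume) hpi
  have hSae : ∀ᵐ t : ℝ, t ∈ S := by
    filter_upwards [hpt] with t ht
    show (η ⊗ₖ ν) t univ < ⊤
    rw [hmass]
    have := ht.2
    rw [hasFiniteIntegral_iff_ofReal (Eventually.of_forall fun x => h0 _)] at this
    exact this
  set K : Kernel ℝ (ℝ × ℝ) := Kernel.piecewise hSm (η ⊗ₖ ν) 0 with hK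
  have hKt : ∀ t, K t = if t ∈ S then (η ⊗ₖ ν) t else 0 := by
    intro t; rw [hK, Kernel.piecewise_apply]; rfl
  have hdis : ∀ f : ℝ × (ℝ × ℝ) → ℝ, Measurable f → (∃ C, ∀ q, |f q| ≤ C) →
      (∀ᵐ t : ℝ, ∫ q, f (t, q) ∂(K t) = ∫ x, (∫ a, f (t, (x, a)) ∂(ν (t, x))) * p (t, x)) ∧
      Integrable (fun z : ℝ × ℝ => (∫ a, f (z.1, (z.2, a)) ∂(ν z)) * p z) := by
    rintro f hf ⟨C, hC⟩
    constructor
    · filter_upwards [hSae] with t ht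
      rw [hKt, if_pos ht]
      haveI : IsFiniteMeasure ((η ⊗ₖ ν) t) := ⟨ht⟩
      have hf' : Measurable fun q => f (t, q) := hf.comp (by fun_prop)
      rw [ProbabilityTheory.integral_compProd (Integrable.of_bound hf'.aestronglyMeasurable C (Eventually.of_forall fun q => hC _)),
        hηt, integral_withDensity_eq_integral_toReal_smul (by fun_prop) (Eventually.of_forall fun _ => ENNReal.ofReal_lt_top)]
      refine integral_congr_ae (Eventually.of_forall fun x => ?_)
      simp [ENNReal.toReal_ofReal (h0 _), mul_comm]
    · have hg : StronglyMeasurable fun q : (ℝ × ℝ) × ℝ => f (q.1.1, (q.1.2, q.2)) :=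
        (hf.comp (by fun_prop)).stronglyMeasurable
      have hg' : StronglyMeasurable fun z : ℝ × ℝ => ∫ a, f (z.1, (z.2, a)) ∂(ν z) :=
        hg.integral_kernel_prod_right' (κ := ν)
      refine Integrable.bdd_mul (c := C) hpi hg'.aestronglyMeasurable (Eventually.of_forall fun z => ?_)
      refine (norm_integral_le_of_norm_le (integrable_const C) (Eventually.of_forall fun a => hC _)).trans ?_
      simp
  have hout : ∀ t ∉ Icc (0:ℝ) T, ∀ x, p (t, x) = 0 := fun t ht x => hQ _ fun h => ht h.1
  refine ⟨fun t => K t, ⟨?_, ?_, ?_, ?_⟩, ?_⟩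
  · intro t
    show K t univ < ⊤
    rw [hKt]
    split_ifs with h
    · exact h
    · simp
  · intro t
    show K t _ = 0
    rw [hKt]
    split_ifs with h
    · rw [closure_Ioo hc.ne]
      have hm : MeasurableSet ((Icc c1 c2 ×ˢ A)ᶜ : Set (ℝ × ℝ)) := (measurableSet_Icc.prod hA).compl
      rw [Kernel.compProd_apply hm, hηt, lintegral_withDensity_eq_lintegral_mul _ (by fun_prop) (by
        exact (Kernel.measurable_kernel_prodMk_left' hm t))]
      rw [lintegral_eq_zero_iff' (by
        exact ((by fun_prop : Measurable fun x => ENNReal.ofReal (p (t, x))).mul (Kernel.measurable_kernel_prodMk_left' hm t)).aemeasurable)]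
      refine Eventually.of_forall fun x => ?_
      simp only [Pi.mul_apply, Pi.zero_apply, mul_eq_zero]
      by_cases hx : x ∈ Icc c1 c2
      · right
        refine measure_mono_null ?_ (hν (t, x))
        intro a ha
        simp only [mem_preimage, mem_compl_iff, mem_prod] at ha ⊢
        tauto
      · left
        rw [hQ (t, x) fun h => hx h.2]; simp
    · simp
  · intro B hB
    exact Kernel.measurable_coe K hB
  · have h := hdis (fun _ => 1) measurable_const ⟨1, by simp⟩
    have i := Integrable.integral_prod_left (μ := volume) (ν := volume) h.2
    refine Integrable.congr (f := fun t => ∫ x, (∫ a, (1:ℝ) ∂(ν (t, x))) * p (t, x)) i.restrict ?_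
    filter_upwards [ae_restrict_of_ae h.1] with t ht
    rw [← ht]; simp [Measure.real]
  · intro f hf hC
    obtain ⟨h, i⟩ := hdis f hf hC
    rw [wd_int hpm h0]
    calc _ = ∫ t in Icc 0 T, ∫ x, (∫ a, f (t, (x, a)) ∂(ν (t, x))) * p (t, x) := by
          refine integral_congr_ae (ae_restrict_of_ae h)
      _ = ∫ t, ∫ x, (∫ a, f (t, (x, a)) ∂(ν (t, x))) * p (t, x) := by
          refine setIntegral_eq_integral_of_forall_compl_eq_zero fun t ht => ?_
          simp [hout t ht]
      _ = _ := (integral_prod (μ := volume) (ν := volume) _ i).symm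

end

section
open ProbabilityTheory

def zv (T c1 c2 : ℝ) {d : ℕ} (κ : Kernel ℝ (ℝ × ℝ)) (chat : ℝ → ℝ → Fin d → ℝ) (t : ℝ) : Fin d → ℝ :=
  fun i => KI T c1 c2 κ (fun z => chat z.1 z.2 i) t

def bL {d : ℕ} (bbar : ℝ → ℝ → (Fin d → ℝ) → ℝ → ℝ) (zb : ℝ → Fin d → ℝ) (ν : Kernel (ℝ × ℝ) ℝ) (z : ℝ × ℝ) : ℝ :=
  ∫ a, bbar z.1 z.2 (zb z.1) a ∂(ν z)

def aL {d : ℕ} (c0 : ℝ) (σbar : ℝ → ℝ → (Fin d → ℝ) → ℝ → ℝ) (zs : ℝ → Fin d → ℝ) (a0 : ℝ) (z : ℝ × ℝ) : ℝ :=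
  max c0 (σbar z.1 z.2 (zs z.1) a0 ^ 2 / 2)

lemma bL_meas1
    {d : ℕ} {cbar : ℝ → ℝ → (Fin d → ℝ) → ℝ → ℝ}
    (hm : Measurable (fun q : ℝ × ℝ × (Fin d → ℝ) × ℝ => cbar q.1 q.2.1 q.2.2.1 q.2.2.2))
    {zc : ℝ → Fin d → ℝ} (hz : Measurable zc) : Measurable fun q : ℝ × (ℝ × ℝ) => cbar q.1 q.2.1 (zc q.1) q.2.2 :=
  hm.comp (g := fun q : ℝ × ℝ × (Fin d → ℝ) × ℝ => cbar q.1 q.2.1 q.2.2.1 q.2.2.2)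
    (f := fun q : ℝ × (ℝ × ℝ) => (q.1, q.2.1, zc q.1, q.2.2)) (by fun_prop)

lemma bL_meas
    {d : ℕ} {cbar : ℝ → ℝ → (Fin d → ℝ) → ℝ → ℝ}
    (hm : Measurable (fun q : ℝ × ℝ × (Fin d → ℝ) × ℝ => cbar q.1 q.2.1 q.2.2.1 q.2.2.2))
    {zc : ℝ → Fin d → ℝ} (hz : Measurable zc) {ν : Kernel (ℝ × ℝ) ℝ} [IsMarkovKernel ν] : Measurable (bL cbar zc ν) := by
  have hg : StronglyMeasurable fun q : (ℝ × ℝ) × ℝ => cbar q.1.1 q.1.2 (zc q.1.1) q.2 :=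
    ((bL_meas1 hm hz).comp (f := fun q : (ℝ × ℝ) × ℝ => (q.1.1, (q.1.2, q.2))) (by fun_prop)).stronglyMeasurable
  exact (hg.integral_kernel_prod_right' (κ := ν)).measurable

lemma aL_meas
    {d : ℕ} {cbar : ℝ → ℝ → (Fin d → ℝ) → ℝ → ℝ}
    (hm : Measurable (fun q : ℝ × ℝ × (Fin d → ℝ) × ℝ => cbar q.1 q.2.1 q.2.2.1 q.2.2.2))
    {zc : ℝ → Fin d → ℝ} (hz : Measurable zc) {c0 a0 : ℝ} : Measurable (aL c0 cbar zc a0) := by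
  have hg : Measurable fun q : ℝ × ℝ => cbar q.1 q.2 (zc q.1) a0 :=
    (bL_meas1 hm hz).comp (f := fun q : ℝ × ℝ => (q.1, (q.2, a0))) (by fun_prop)
  exact measurable_const.max ((hg.pow_const 2).div_const 2)


lemma bL_bd {d : ℕ} {cbar : ℝ → ℝ → (Fin d → ℝ) → ℝ → ℝ} {C : ℝ} (hC : ∀ t x z a, |cbar t x z a| ≤ C)
    (zc : ℝ → Fin d → ℝ) (ν : Kernel (ℝ × ℝ) ℝ) [IsMarkovKernel ν] (z : ℝ × ℝ) : |bL cbar zc ν z| ≤ C := by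
  rw [← Real.norm_eq_abs]
  refine (norm_integral_le_of_norm_le (integrable_const C) (Eventually.of_forall fun a => hC _ _ _ _)).trans ?_
  simp

lemma aL_bd {d : ℕ} {cbar : ℝ → ℝ → (Fin d → ℝ) → ℝ → ℝ} {C c0 : ℝ} (hC : ∀ t x z a, |cbar t x z a| ≤ C)
    (h0 : c0 ≤ C ^ 2 / 2) (zc : ℝ → Fin d → ℝ) (a0 : ℝ) (z : ℝ × ℝ) : aL c0 cbar zc a0 z ≤ C ^ 2 / 2 := by
  refine max_le h0 ?_
  have := sq_le_sq' (abs_le.1 (hC z.1 z.2 (zc z.1) a0)).1 (abs_le.1 (hC z.1 z.2 (zc z.1) a0)).2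
  linarith

lemma cb_pr {T c1 c2 : ℝ} (hT : 0 < T) (hc : c1 < c2) {w : ℝ → ℝ → ℝ}
    (hw : ContinuousOn (fun p : ℝ × ℝ => w p.1 p.2) (Icc 0 T ×ˢ closure (Ioo c1 c2))) :
    Continuous fun z : ℝ × ℝ => w (pr T c1 c2 z).1 (pr T c1 c2 z).2 := by
  rw [closure_Ioo hc.ne] at hw
  exact cont_pr hT hc hw

/-- rewriting the generator term of the constraint with the disintegrated measure -/
lemma fp_rw {T c1 c2 : ℝ} (hT : 0 < T) (hc : c1 < c2) {A : Set ℝ} {d : ℕ}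
    {b σ : ℝ → ℝ → Measure (ℝ × ℝ) → ℝ → ℝ}
    {bbar σbar : ℝ → ℝ → (Fin d → ℝ) → ℝ → ℝ} {bhat σhat : ℝ → ℝ → Fin d → ℝ}
    (hb : MFCoeff T (Ioo c1 c2) A d b bbar bhat) (hσ : MFCoeff T (Ioo c1 c2) A d σ σbar σhat)
    (hσa : ∀ t x (ν : Measure (ℝ × ℝ)) a a', σ t x ν a = σ t x ν a')
    {cσ : ℝ} (hcσ : 0 < cσ) (hσc : ∀ t x (ν : Measure (ℝ × ℝ)) a, cσ ≤ σ t x ν a) (a0 : ℝ)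
    {m : ℝ → Measure (ℝ × ℝ)} (hV : MemV T (Ioo c1 c2) A m) {M : Measure (ℝ × ℝ)} {ν : Kernel (ℝ × ℝ) ℝ}
    [IsMarkovKernel ν] (hM : M (Icc 0 T ×ˢ Icc c1 c2)ᶜ = 0) (hD : Dis T m M ν)
    {mb : ℝ → Measure (ℝ × ℝ)} {κ : Kernel ℝ (ℝ × ℝ)} (h1 : ∀ t, κ t univ ≤ 1)
    (h2 : ∀ t, κ t (Icc c1 c2 ×ˢ A)ᶜ = 0) (hκ : ∀ᵐ t ∂(volume.restrict (Icc 0 T)), mb t = κ t)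
    {u ut ux uxx : ℝ → ℝ → ℝ} (hu : IsCb12 T (Ioo c1 c2) u ut ux uxx) :
    ∫ t in Icc 0 T, (∫ p, (ut t p.1 + (b t p.1 (mb t) p.2 * ux t p.1
                + σ t p.1 (mb t) p.2 ^ 2 / 2 * uxx t p.1)) ∂(m t)) =
      ∫ z, (ut z.1 z.2 + (bL bbar (zv T c1 c2 κ bhat) ν z * ux z.1 z.2
        + aL (cσ ^ 2 / 2) σbar (zv T c1 c2 κ σhat) a0 z * uxx z.1 z.2)) ∂M := by
  obtain ⟨-, hb2, ⟨Cb, hb3⟩, hb4, hb5, hb6, -⟩ := hb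
  obtain ⟨-, hs2, ⟨Cs, hs3⟩, hs4, hs5, hs6, -⟩ := hσ
  set P := pr T c1 c2 with hP
  have ct := cb_pr hT hc hu.cont_t
  have cx := cb_pr hT hc hu.cont_x
  have cxx := cb_pr hT hc hu.cont_xx
  obtain ⟨U, hU⟩ := hu.bdd
  have hcl : closure (Ioo c1 c2) = Icc c1 c2 := closure_Ioo hc.ne
  have hPm : ∀ z, P z ∈ Icc 0 T ×ˢ Icc c1 c2 := fun z => pr_mem hT.le hc.le z
  have hU' : ∀ z, |ut (P z).1 (P z).2| ≤ U ∧ |ux (P z).1 (P z).2| ≤ U ∧ |uxx (P z).1 (P z).2| ≤ U := by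
    intro z
    have := hU _ (hPm z).1 (P z).2 (by rw [hcl]; exact (hPm z).2)
    exact this.2
  have hU0 : 0 ≤ U := (abs_nonneg _).trans (hU' 0).1
  have zm : ∀ chat : ℝ → ℝ → Fin d → ℝ, ContinuousOn (fun p : ℝ × ℝ => chat p.1 p.2) (Icc 0 T ×ˢ closure (Ioo c1 c2)) →
      Measurable (zv T c1 c2 κ chat) := by
    intro chat h
    rw [hcl] at h
    exact measurable_pi_iff.2 fun i => KI_meas hT hc h1 ((continuous_apply i).comp_continuousOn h)
  set zb := zv T c1 c2 κ bhat with hzb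
  set zs := zv T c1 c2 κ σhat with hzs
  have zbm : Measurable zb := zm _ hb6
  have zsm : Measurable zs := zm _ hs6
  set al := aL (cσ ^ 2 / 2) σbar zs a0 with hal
  have alm : Measurable al := aL_meas hs4 zsm
  have hcs : cσ ≤ Cs := (hσc 0 0 0 0).trans (by rw [hs2]; exact (le_abs_self _).trans (hs3 _ _ _ _))
  have h0c : cσ ^ 2 / 2 ≤ Cs ^ 2 / 2 := by gcongr
  have alb : ∀ z, |al z| ≤ Cs ^ 2 / 2 := fun z => by
    rw [abs_of_nonneg (le_trans (by positivity) (le_max_left _ _))]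
    exact aL_bd hs3 h0c zs a0 z
  set f : ℝ × (ℝ × ℝ) → ℝ := fun q => ut (P (q.1, q.2.1)).1 (P (q.1, q.2.1)).2
    + (bbar q.1 q.2.1 (zb q.1) q.2.2 * ux (P (q.1, q.2.1)).1 (P (q.1, q.2.1)).2
      + al (q.1, q.2.1) * uxx (P (q.1, q.2.1)).1 (P (q.1, q.2.1)).2) with hf
  have qm : Measurable fun q : ℝ × (ℝ × ℝ) => (q.1, q.2.1) := by fun_prop
  have fm : Measurable f :=
    (ct.measurable.comp qm).add (((bL_meas1 hb4 zbm).mul (cx.measurable.comp qm)).add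
      ((alm.comp qm).mul (cxx.measurable.comp qm)))
  have fb : ∃ C, ∀ q, |f q| ≤ C := by
    refine ⟨U + (Cb * U + Cs ^ 2 / 2 * U), fun q => ?_⟩
    refine (abs_add_le _ _).trans (add_le_add (hU' _).1 ((abs_add_le _ _).trans (add_le_add ?_ ?_)))
    · rw [abs_mul]
      exact mul_le_mul (hb3 _ _ _ _) (hU' _).2.1 (abs_nonneg _) ((abs_nonneg _).trans (hb3 0 0 0 0))
    · rw [abs_mul]
      exact mul_le_mul (alb _) (hU' _).2.2 (abs_nonneg _) (by positivity)
  have hzv : ∀ t ∈ Icc 0 T, ∀ chat : ℝ → ℝ → Fin d → ℝ,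
      (fun i => ∫ p, chat t p.1 i ∂(κ t)) = zv T c1 c2 κ chat t := by
    intro t ht chat
    funext i
    exact KI_eq h2 (fun z => chat z.1 z.2 i) ht
  have hL : ∫ t in Icc 0 T, (∫ p, (ut t p.1 + (b t p.1 (mb t) p.2 * ux t p.1
                + σ t p.1 (mb t) p.2 ^ 2 / 2 * uxx t p.1)) ∂(m t)) =
      ∫ t in Icc 0 T, ∫ p, f (t, p) ∂(m t) := by
    refine integral_congr_ae ?_
    filter_upwards [hκ, ae_restrict_mem measurableSet_Icc] with t h ht
    refine integral_congr_ae ?_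
    filter_upwards [measure_eq_zero_iff_ae_notMem.1 (hV.2.1 t)] with p hp
    have hp := notMem_compl_iff.1 hp
    rw [hcl] at hp
    have e : P (t, p.1) = (t, p.1) := pr_id (show ((t, p.1) : ℝ × ℝ) ∈ Icc 0 T ×ˢ Icc c1 c2 from ⟨ht, hp.1⟩)
    have e1 : b t p.1 (mb t) p.2 = bbar t p.1 (zb t) p.2 := by
      rw [h, hb2, hzv t ht]
    have e2 : σ t p.1 (mb t) p.2 ^ 2 / 2 = al (t, p.1) := by
      have e3 : σ t p.1 (κ t) a0 = σbar t p.1 (zs t) a0 := by rw [hs2, hzv t ht]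
      rw [h, hσa _ _ _ _ a0, e3]
      refine (max_eq_right ?_).symm
      show cσ ^ 2 / 2 ≤ σbar t p.1 (zs t) a0 ^ 2 / 2
      rw [← e3]
      have := hσc t p.1 (κ t) a0
      gcongr
    simp only [hf, e, e1, e2]
  rw [hL, hD f fm fb]
  refine integral_congr_ae ?_
  filter_upwards [measure_eq_zero_iff_ae_notMem.1 hM] with z hz
  have hz := notMem_compl_iff.1 hz
  have e : P (z.1, z.2) = (z.1, z.2) := pr_id hz
  simp only [hf, e]
  have ib : Integrable (fun a => bbar z.1 z.2 (zb z.1) a) (ν z) :=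
    Integrable.of_bound ((bL_meas1 hb4 zbm).comp (f := fun a : ℝ => (z.1, (z.2, a))) (by fun_prop)).aestronglyMeasurable Cb
      (Eventually.of_forall fun a => hb3 _ _ _ _)
  have i2 : Integrable (fun a => bbar z.1 z.2 (zb z.1) a * ux z.1 z.2 + al (z.1, z.2) * uxx z.1 z.2) (ν z) :=
    (ib.mul_const _).add (integrable_const _)
  rw [integral_add (integrable_const _) i2, integral_add (ib.mul_const _) (integrable_const _), integral_mul_const]
  simp [bL]

end

section
open ProbabilityTheory

section
variable {T c1 c2 : ℝ}

lemma conv_gp {p : ℝ × ℝ → ℝ} {pk : ℕ → ℝ × ℝ → ℝ} (hp : MemLp p 2) (hpQ : ∀ z, z ∉ Icc 0 T ×ˢ Icc c1 c2 → p z = 0)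
    (hpk : ∀ k, MemLp (pk k) 2) (hpkQ : ∀ k z, z ∉ Icc 0 T ×ˢ Icc c1 c2 → pk k z = 0)
    (hL : Tendsto (fun k => ∫ z, (pk k z - p z) ^ 2) atTop (𝓝 0))
    {Gk : ℕ → ℝ × ℝ → ℝ} {G : ℝ × ℝ → ℝ} (hGm : ∀ k, Measurable (Gk k)) {C : ℝ}
    (hC : ∀ k z, |Gk k z| ≤ C)
    (hG : ∀ᵐ z : ℝ × ℝ, z ∈ Icc 0 T ×ˢ Icc c1 c2 → Tendsto (fun k => Gk k z) atTop (𝓝 (G z))) :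
    Tendsto (fun k => ∫ z, Gk k z * pk k z) atTop (𝓝 (∫ z, G z * p z)) := by
  set Q := Icc (0:ℝ) T ×ˢ Icc c1 c2 with hQ
  have hQc : IsCompact Q := isCompact_Icc.prod isCompact_Icc
  have hQm : MeasurableSet Q := measurableSet_Icc.prod measurableSet_Icc
  have hp1 : Integrable p := p_int hp hpQ
  have h1 : Tendsto (fun k => ∫ z, Gk k z * p z) atTop (𝓝 (∫ z, G z * p z)) := by
    refine tendsto_integral_of_dominated_convergence (fun z => C * |p z|) (fun k => ?_) (hp1.abs.const_mul C) (fun k => ?_) ?_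
    · exact (hGm k).aestronglyMeasurable.mul hp1.1
    · refine Eventually.of_forall fun z => ?_
      rw [norm_mul]
      exact mul_le_mul_of_nonneg_right (hC k z) (norm_nonneg _)
    · filter_upwards [hG] with z hz
      by_cases h : z ∈ Q
      · exact (hz h).mul_const _
      · simp [hpQ z h]
  set D : ℝ := √(∫ z, (Q.indicator (fun _ => C) z) ^ 2) with hD
  have hGI : ∀ k, MemLp (Q.indicator (Gk k)) 2 := by
    intro k
    have : MemLp (Q.indicator fun _ => C) 2 (volume : Measure (ℝ × ℝ)) :=
      memLp_indicator_const 2 hQm C (Or.inr hQc.measure_lt_top.ne)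
    refine this.mono ((hGm k).indicator hQm).aestronglyMeasurable (Eventually.of_forall fun z => ?_)
    by_cases h : z ∈ Q
    · simp only [indicator_of_mem h]
      exact (hC k z).trans (le_abs_self C)
    · simp [indicator_of_notMem h]
  have hCI : MemLp (Q.indicator fun _ => C) 2 (volume : Measure (ℝ × ℝ)) :=
      memLp_indicator_const 2 hQm C (Or.inr hQc.measure_lt_top.ne)
  have h2 : ∀ k, |(∫ z, Gk k z * pk k z) - ∫ z, Gk k z * p z| ≤ D * √(∫ z, (pk k z - p z) ^ 2) := by
    intro k
    have i1 : Integrable fun z => Gk k z * pk k z :=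
      Integrable.bdd_mul (c := C) (p_int (hpk k) (hpkQ k)) (hGm k).aestronglyMeasurable (Eventually.of_forall (hC k))
    have i2 : Integrable fun z => Gk k z * p z :=
      Integrable.bdd_mul (c := C) hp1 (hGm k).aestronglyMeasurable (Eventually.of_forall (hC k))
    rw [← integral_sub i1 i2]
    have e : ∫ z, (Gk k z * pk k z - Gk k z * p z) = ∫ z, Q.indicator (Gk k) z * (pk k z - p z) := by
      refine integral_congr_ae (Eventually.of_forall fun z => ?_)
      by_cases h : z ∈ Q
      · simp only [indicator_of_mem h]; ring
      · simp [indicator_of_notMem h, hpQ z h, hpkQ k z h]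
    rw [e]
    refine (cs_int (hGI k) ((hpk k).sub hp)).trans ?_
    refine mul_le_mul_of_nonneg_right (Real.sqrt_le_sqrt ?_) (Real.sqrt_nonneg _)
    refine integral_mono (hGI k).integrable_sq hCI.integrable_sq fun z => ?_
    by_cases h : z ∈ Q
    · simp only [indicator_of_mem h]
      exact sq_le_sq.2 ((hC k z).trans (le_abs_self C))
    · simp [indicator_of_notMem h]
  have h3 : Tendsto (fun k => D * √(∫ z, (pk k z - p z) ^ 2)) atTop (𝓝 0) := by
    have := (Real.continuous_sqrt.tendsto 0).comp hL
    simpa using this.const_mul D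
  have h4 : Tendsto (fun k => (∫ z, Gk k z * pk k z) - ∫ z, Gk k z * p z) atTop (𝓝 0) := squeeze_zero_norm h2 h3
  simpa using h4.add h1

lemma conv_sq {p : ℝ × ℝ → ℝ} (hp : MemLp p 2) (hpQ : ∀ z, z ∉ Icc 0 T ×ˢ Icc c1 c2 → p z = 0)
    {Gk : ℕ → ℝ × ℝ → ℝ} {G : ℝ × ℝ → ℝ} (hGm : ∀ k, Measurable (Gk k)) (hGm' : Measurable G) {C : ℝ}
    (hC : ∀ k z, |Gk k z| ≤ C) (hC' : ∀ z, |G z| ≤ C)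
    (hG : ∀ᵐ z : ℝ × ℝ, z ∈ Icc 0 T ×ˢ Icc c1 c2 → Tendsto (fun k => Gk k z) atTop (𝓝 (G z))) :
    Tendsto (fun k => ∫ z, ((G z - Gk k z) * p z) ^ 2) atTop (𝓝 0) := by
  have : Tendsto (fun k => ∫ z, ((G z - Gk k z) * p z) ^ 2) atTop (𝓝 (∫ _ : ℝ × ℝ, (0:ℝ))) := by
    refine tendsto_integral_of_dominated_convergence (fun z => (C + C) ^ 2 * p z ^ 2) (fun k => ?_)
      (hp.integrable_sq.const_mul _) (fun k => ?_) ?_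
    · exact ((hGm'.sub (hGm k)).aestronglyMeasurable.mul hp.1).pow 2
    · refine Eventually.of_forall fun z => ?_
      rw [Real.norm_of_nonneg (sq_nonneg _), mul_pow]
      refine mul_le_mul_of_nonneg_right (sq_le_sq.2 ?_) (sq_nonneg _)
      exact (abs_sub _ _).trans ((add_le_add (hC' z) (hC k z)).trans (le_abs_self _))
    · filter_upwards [hG] with z hz
      by_cases h : z ∈ Icc 0 T ×ˢ Icc c1 c2
      · have := (((hz h).const_sub (G z)).mul_const (p z)).pow 2
        simpa using this
      · simp [hpQ z h]
  simpa using this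

lemma weak_of_sm (hT : 0 < T) (hc : c1 < c2) {μ : Measure (ℝ × ℝ)} {μk : ℕ → Measure (ℝ × ℝ)}
    (hp : IsProbabilityMeasure μ) (hpk : ∀ k, IsProbabilityMeasure (μk k))
    (hμ : μ (Icc 0 T ×ˢ Icc c1 c2)ᶜ = 0) (hμk : ∀ k, μk k (Icc 0 T ×ˢ Icc c1 c2)ᶜ = 0)
    (h : ∀ u ut ux uxx, Sm u ut ux uxx → Tendsto (fun k => ∫ z, u z.1 z.2 ∂(μk k)) atTop (𝓝 (∫ z, u z.1 z.2 ∂μ))) :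
    WeakConv μk μ := by
  intro f hf _
  rw [Metric.tendsto_atTop]
  intro ε hε
  obtain ⟨u, ut, ux, uxx, hu, happ⟩ := smooth_approx
    (isCompact_Icc.prod isCompact_Icc : IsCompact (Icc (0:ℝ) T ×ˢ Icc c1 c2)) hf.continuousOn (ε := ε / 4) (by positivity)
  obtain ⟨n0, hn0⟩ := Metric.tendsto_atTop.1 (h u ut ux uxx hu) (ε / 4) (by positivity)
  have key : ∀ ρ : Measure (ℝ × ℝ), IsProbabilityMeasure ρ → ρ (Icc 0 T ×ˢ Icc c1 c2)ᶜ = 0 →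
      |(∫ z, u z.1 z.2 ∂ρ) - ∫ z, f z ∂ρ| ≤ ε / 4 := by
    intro ρ hρ hρ0
    rw [← integral_sub (int_bd hρ0 hu.c0) (int_bd hρ0 hf), ← Real.norm_eq_abs]
    refine (norm_integral_le_of_norm_le (integrable_const (ε / 4)) ?_).trans ?_
    · filter_upwards [measure_eq_zero_iff_ae_notMem.1 hρ0] with z hz
      exact happ z (notMem_compl_iff.1 hz)
    · simp
  refine ⟨n0, fun n hn => ?_⟩
  have a1 := key μ hp hμ
  have a2 := key (μk n) (hpk n) (hμk n)
  have a3 := hn0 n hn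
  rw [Real.dist_eq] at a3 ⊢
  rw [abs_le] at a1 a2
  rw [abs_lt] at a3 ⊢
  constructor <;> linarith [a1.1, a1.2, a2.1, a2.2, a3.1, a3.2]

lemma stable (hT : 0 < T) (hc : c1 < c2) {c0 C B : ℝ} (hc0 : 0 < c0) {N μ M : Measure (ℝ × ℝ)}
    [IsProbabilityMeasure N] [IsProbabilityMeasure μ] [IsFiniteMeasure M]
    (hN : N (Icc 0 T ×ˢ Icc c1 c2)ᶜ = 0) (hN0 : ∀ᵐ z ∂N, z.1 = 0)
    (hμ : μ (Icc 0 T ×ˢ Icc c1 c2)ᶜ = 0) (hM : M (Icc 0 T ×ˢ Icc c1 c2)ᶜ = 0)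
    (hmar : ∀ f : ℝ → ℝ, Continuous f → Integrable f → (∀ t, 0 ≤ f t) → ∫ z, f z.1 ∂M ≤ ∫ t, f t)
    {a b : ℝ × ℝ → ℝ} {ak bk : ℕ → ℝ × ℝ → ℝ}
    (ha : Measurable a) (hb : Measurable b) (hak : ∀ k, Measurable (ak k)) (hbk : ∀ k, Measurable (bk k))
    (ha1 : ∀ z, c0 ≤ a z) (ha2 : ∀ z, a z ≤ C) (hb1 : ∀ z, |b z| ≤ B)
    (hak1 : ∀ k z, c0 ≤ ak k z) (hak2 : ∀ k z, ak k z ≤ C) (hbk1 : ∀ k z, |bk k z| ≤ B)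
    (hac : ∀ᵐ z : ℝ × ℝ, z ∈ Icc 0 T ×ˢ Icc c1 c2 → Tendsto (fun k => ak k z) atTop (𝓝 (a z)))
    (hbc : ∀ᵐ z : ℝ × ℝ, z ∈ Icc 0 T ×ˢ Icc c1 c2 → Tendsto (fun k => bk k z) atTop (𝓝 (b z)))
    (hFP : FPM T c1 c2 N μ M a b) :
    ∃ (pk : ℕ → ℝ × ℝ → ℝ) (μk : ℕ → Measure (ℝ × ℝ)),
      (∀ k, Measurable (pk k) ∧ MemLp (pk k) 2 ∧ (∀ z, 0 ≤ pk k z) ∧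
        (∀ z, z ∉ Icc 0 T ×ˢ Icc c1 c2 → pk k z = 0) ∧ IsProbabilityMeasure (μk k) ∧
        μk k (Icc 0 T ×ˢ Icc c1 c2)ᶜ = 0 ∧
        FPM T c1 c2 N (μk k) (volume.withDensity fun z => ENNReal.ofReal (pk k z)) (ak k) (bk k)) ∧
      WeakConv μk μ ∧
      ∀ G : ℝ × ℝ → ℝ, Measurable G → (∃ C', ∀ z, |G z| ≤ C') →
        Tendsto (fun k => ∫ z, G z ∂(volume.withDensity fun z => ENNReal.ofReal (pk k z))) atTop (𝓝 (∫ z, G z ∂M)) := by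
  obtain ⟨p, hpm, hp2, hp0, hpQ, hMp⟩ := density_exists hc hc0 hN hμ hM hmar ha hb ha2 ha1 hb1 hFP
  have eqv : ∀ {μ' : Measure (ℝ × ℝ)} {p a b : ℝ × ℝ → ℝ}, Measurable p → (∀ z, 0 ≤ p z) →
      (FPM T c1 c2 N μ' (volume.withDensity fun z => ENNReal.ofReal (p z)) a b ↔ FPd T c1 c2 0 N μ' p a b) := by
    intro μ' p a b hpm hp0
    refine forall_congr' fun u => forall_congr' fun ut => forall_congr' fun ux => forall_congr' fun uxx =>
      forall_congr' fun _ => ?_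
    rw [wd_int hpm hp0]
    simp only [zero_mul, sub_zero, add_assoc]
  have hFd : FPd T c1 c2 0 N μ p a b := (eqv hpm hp0).1 (hMp ▸ hFP)
  have aabs : ∀ z, |a z| ≤ C := fun z => by rw [abs_of_nonneg (hc0.le.trans (ha1 z))]; exact ha2 z
  have akabs : ∀ k z, |ak k z| ≤ C := fun k z => by rw [abs_of_nonneg (hc0.le.trans (hak1 k z))]; exact hak2 k z
  choose pk μk h1 h2 h3 h4 h5 h6 h7 h8 using fun k =>
    core hT hc hc0 hN hN0 hμ hpm hp2 hp0 hpQ ha hb (hak k) (hbk k) aabs hb1 (hak1 k) (hak2 k) (hbk1 k) hFd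
  have hL : Tendsto (fun k => ∫ z, (pk k z - p z) ^ 2) atTop (𝓝 0) := by
    refine squeeze_zero (fun k => integral_nonneg fun z => sq_nonneg _) h8 ?_
    have := (((conv_sq hp2 hpQ hak ha akabs aabs hac).add (conv_sq hp2 hpQ hbk hb hbk1 hb1 hbc)).const_mul
      (Kst c0 C B)).const_mul (Real.exp ((B ^ 2 / c0 + 1) * T) ^ 2)
    simpa using this
  have hFM : ∀ k, FPM T c1 c2 N (μk k) (volume.withDensity fun z => ENNReal.ofReal (pk k z)) (ak k) (bk k) :=
    fun k => (eqv (h1 k) (h3 k)).2 (h7 k)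
  have hpr : ∀ k, IsProbabilityMeasure (μk k) := by
    intro k
    haveI := h5 k
    have := hFM k _ _ _ _ (sm_one.cb hc)
    simp [Measure.real] at this
    refine ⟨?_⟩
    rw [← ENNReal.toReal_eq_one_iff]; exact this
  refine ⟨pk, μk, fun k => ⟨h1 k, h2 k, h3 k, h4 k, hpr k, h6 k, hFM k⟩, ?_, ?_⟩
  · refine weak_of_sm hT hc inferInstance hpr hμ h6 fun u ut ux uxx hu => ?_
    have hcb := hu.cb (T := T) hc
    obtain ⟨U, hU⟩ := hcb.bdd
    rw [closure_Ioo hc.ne] at hU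
    set P := pr T c1 c2 with hP
    have hU' : ∀ z, |ut (P z).1 (P z).2| ≤ U ∧ |ux (P z).1 (P z).2| ≤ U ∧ |uxx (P z).1 (P z).2| ≤ U :=
      fun z => (hU _ (pr_mem hT.le hc.le z).1 _ (pr_mem hT.le hc.le z).2).2
    set G : (ℝ × ℝ → ℝ) → (ℝ × ℝ → ℝ) → ℝ × ℝ → ℝ := fun a b z =>
      ut (P z).1 (P z).2 + (b z * ux (P z).1 (P z).2 + a z * uxx (P z).1 (P z).2) with hG
    have hGe : ∀ (q a b : ℝ × ℝ → ℝ), (∀ z, z ∉ Icc 0 T ×ˢ Icc c1 c2 → q z = 0) →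
        ∫ z, (ut z.1 z.2 + (b z * ux z.1 z.2 + a z * uxx z.1 z.2)) * q z = ∫ z, G a b z * q z := by
      intro q a b hq
      refine integral_congr_ae (Eventually.of_forall fun z => ?_)
      by_cases h : z ∈ Icc 0 T ×ˢ Icc c1 c2
      · simp only [hG, hP, pr_id h]
      · simp [hq z h]
    have mt : Measurable fun z => ut (P z).1 (P z).2 := (cb_pr hT hc hcb.cont_t).measurable
    have mx : Measurable fun z => ux (P z).1 (P z).2 := (cb_pr hT hc hcb.cont_x).measurable
    have mxx : Measurable fun z => uxx (P z).1 (P z).2 := (cb_pr hT hc hcb.cont_xx).measurable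
    have e0 : ∫ z, u z.1 z.2 ∂μ = (∫ z, u z.1 z.2 ∂N) + ∫ z, G a b z * p z := by
      rw [hFP u ut ux uxx hcb, hMp, wd_int hpm hp0, hGe p a b hpQ]
    have ek : ∀ k, ∫ z, u z.1 z.2 ∂(μk k) = (∫ z, u z.1 z.2 ∂N) + ∫ z, G (ak k) (bk k) z * pk k z := by
      intro k
      rw [hFM k u ut ux uxx hcb, wd_int (h1 k) (h3 k), hGe _ _ _ (h4 k)]
    simp only [e0, ek]
    refine tendsto_const_nhds.add (conv_gp hp2 hpQ h2 h4 hL (C := U + (B * U + C * U)) (fun k => ?_) (fun k z => ?_) ?_)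
    · exact mt.add (((hbk k).mul mx).add ((hak k).mul mxx))
    · refine (abs_add_le _ _).trans (add_le_add (hU' _).1 ((abs_add_le _ _).trans (add_le_add ?_ ?_)))
      · rw [abs_mul]
        exact mul_le_mul (hbk1 k z) (hU' z).2.1 (abs_nonneg _) ((abs_nonneg _).trans (hbk1 k z))
      · rw [abs_mul]
        exact mul_le_mul (akabs k z) (hU' z).2.2 (abs_nonneg _) ((abs_nonneg _).trans (akabs k z))
    · filter_upwards [hac, hbc] with z hz1 hz2 hz
      exact tendsto_const_nhds.add (((hz2 hz).mul_const _).add ((hz1 hz).mul_const _))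
  · rintro G hG ⟨C', hC'⟩
    rw [hMp, wd_int hpm hp0]
    simp only [wd_int (h1 _) (h3 _)]
    exact conv_gp hp2 hpQ h2 h4 hL (fun _ => hG) (fun _ => hC') (Eventually.of_forall fun z _ => tendsto_const_nhds)

end

end

section
open ProbabilityTheory

lemma case_c {T : ℝ} (hT : 0 < T) {c1 c2 : ℝ} (hc : c1 < c2) {A : Set ℝ} (hA : IsCompact A)
    {d : ℕ} {b σ : ℝ → ℝ → Measure (ℝ × ℝ) → ℝ → ℝ}
    {bbar σbar : ℝ → ℝ → (Fin d → ℝ) → ℝ → ℝ} {bhat σhat : ℝ → ℝ → Fin d → ℝ}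
    (hb : MFCoeff T (Ioo c1 c2) A d b bbar bhat) (hσ : MFCoeff T (Ioo c1 c2) A d σ σbar σhat)
    (hσa : ∀ t x (ν : Measure (ℝ × ℝ)) a a', σ t x ν a = σ t x ν a')
    {cσ : ℝ} (hcσ : 0 < cσ) (hσc : ∀ t x (ν : Measure (ℝ × ℝ)) a, cσ ≤ σ t x ν a)
    {m0 : Measure ℝ} (hm0 : InitAssumption2 (Ioo c1 c2) m0)
    {μbarn : ℕ → Measure (ℝ × ℝ)} {mbarn : ℕ → ℝ → Measure (ℝ × ℝ)}
    (hR0 : ∀ n, MemR0 T (Ioo c1 c2) A b σ m0 (μbarn n) (mbarn n))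
    {μbar : Measure (ℝ × ℝ)} {mbar : ℝ → Measure (ℝ × ℝ)}
    (hR0lim : MemR0 T (Ioo c1 c2) A b σ m0 μbar mbar) (hmbarconv : ConvV T mbarn mbar)
    {μ : Measure (ℝ × ℝ)} {m : ℝ → Measure (ℝ × ℝ)}
    (hRm : MemRm T (Ioo c1 c2) A b σ m0 mbar μ m) {a0 : ℝ} (ha0 : a0 ∈ A) :
    ∃ φ : ℕ → ℕ, StrictMono φ ∧
      ∃ (μk : ℕ → Measure (ℝ × ℝ)) (mk : ℕ → ℝ → Measure (ℝ × ℝ)),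
        (∀ k, MemRm T (Ioo c1 c2) A b σ m0 (mbarn (φ k)) (μk k) (mk k)) ∧
        WeakConv μk μ ∧ ConvV T mk m := by
  have hcl : closure (Ioo c1 c2) = Icc c1 c2 := closure_Ioo hc.ne
  have hAm : MeasurableSet A := hA.measurableSet
  obtain ⟨κm, m1, m2, m3⟩ := exists_kernel hRm.2.2.1 (hRm.mass hc)
  obtain ⟨κ, h1, h2, h3⟩ := exists_kernel hR0lim.2.2.1 (hR0lim.mass hc)
  choose κn h1n h2n h3n using fun n => exists_kernel (hR0 n).2.2.1 ((hR0 n).mass hc)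
  simp only [hcl] at m2 h2 h2n
  have Hb := hb
  have Hσ := hσ
  obtain ⟨-, hb2, ⟨Cb, hb3⟩, hb4, hb5, hb6, -⟩ := hb
  obtain ⟨-, hs2, ⟨Cs, hs3⟩, hs4, hs5, hs6, -⟩ := hσ
  rw [hcl] at hb6 hs6
  have hbC : ∀ t x ν a, |b t x ν a| ≤ Cb := fun t x ν a => by rw [hb2]; exact hb3 _ _ _ _
  have hsC : ∀ t x ν a, |σ t x ν a| ≤ Cs := fun t x ν a => by rw [hs2]; exact hs3 _ _ _ _
  have hCb0 : 0 ≤ Cb := (abs_nonneg _).trans (hbC 0 0 0 0)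
  have hest : ∀ u ut ux uxx, Sm u ut ux uxx → ∃ C', 0 ≤ C' ∧ ∀ g : ℝ → ℝ, Continuous g → ∀ K,
      (∀ t ∈ Icc (0:ℝ) T, |∫ s in (0:ℝ)..t, g s| ≤ K) →
      (∀ n, ∫ t in Icc 0 T, g t * KI T c1 c2 (κn n) (fun z => u z.1 z.2) t ≤ C' * K) ∧
      ∫ t in Icc 0 T, g t * KI T c1 c2 κ (fun z => u z.1 z.2) t ≤ C' * K := by
    intro u ut ux uxx hu
    obtain ⟨U, hU⟩ := (hu.cb (T := T) hc).bdd
    rw [hcl] at hU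
    have hU1 : ∀ z ∈ Icc 0 T ×ˢ Icc c1 c2, |u z.1 z.2| ≤ U ∧ |ut z.1 z.2| ≤ U ∧ |ux z.1 z.2| ≤ U ∧ |uxx z.1 z.2| ≤ U :=
      fun z hz => hU z.1 hz.1 z.2 hz.2
    have hU0 : 0 ≤ U := (abs_nonneg _).trans (hU1 _ (pr_mem hT.le hc.le 0)).1
    refine ⟨U + U * T + (Cb * U + Cs ^ 2 / 2 * U) * T, by positivity, fun g hg K hK => ⟨fun n => ?_, ?_⟩⟩
    · exact (hR0 n).est hT hc (h1n n) (h2n n) (h3n n) hbC hsC hu hU1 hg hK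
    · exact hR0lim.est hT hc h1 h2 h3 hbC hsC hu hU1 hg hK
  have hconv : ConvV T (fun n t => κn n t) (fun t => κ t) := by
    intro h hh hC
    have e : ∀ (m : ℝ → Measure (ℝ × ℝ)) (κ : Kernel ℝ (ℝ × ℝ)), (∀ᵐ t ∂(volume.restrict (Icc 0 T)), m t = κ t) →
        ∫ t in Icc 0 T, (∫ p, h t p ∂(κ t)) = ∫ t in Icc 0 T, (∫ p, h t p ∂(m t)) := by
      intro m κ hm
      refine integral_congr_ae ?_
      filter_upwards [hm] with t ht
      rw [ht]
    have := hmbarconv h hh hC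
    rw [← e mbar κ h3] at this
    simp only [← e _ _ (h3n _)] at this
    exact this
  set w : Fin d ⊕ Fin d → ℝ × ℝ → ℝ := fun i z => Sum.elim (bhat z.1 z.2) (σhat z.1 z.2) i with hw
  have hwc : ∀ i, ContinuousOn (w i) (Icc 0 T ×ˢ Icc c1 c2) := by
    rintro (i | i)
    · exact (continuous_apply i).comp_continuousOn hb6
    · exact (continuous_apply i).comp_continuousOn hs6
  obtain ⟨φ, hφ, hlim⟩ := subseq hT hc h1n h1 h2n h2 hest hconv hwc
  have hlim' : ∀ᵐ t : ℝ, t ∈ Icc 0 T →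
      Tendsto (fun k => zv T c1 c2 (κn (φ k)) bhat t) atTop (𝓝 (zv T c1 c2 κ bhat t)) ∧
      Tendsto (fun k => zv T c1 c2 (κn (φ k)) σhat t) atTop (𝓝 (zv T c1 c2 κ σhat t)) := by
    filter_upwards [(ae_restrict_iff' measurableSet_Icc).1 hlim] with t ht htT
    exact ⟨tendsto_pi_nhds.2 fun i => ht htT (Sum.inl i), tendsto_pi_nhds.2 fun i => ht htT (Sum.inr i)⟩
  have hlimz : ∀ᵐ z : ℝ × ℝ, z.1 ∈ Icc 0 T →
      Tendsto (fun k => zv T c1 c2 (κn (φ k)) bhat z.1) atTop (𝓝 (zv T c1 c2 κ bhat z.1)) ∧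
      Tendsto (fun k => zv T c1 c2 (κn (φ k)) σhat z.1) atTop (𝓝 (zv T c1 c2 κ σhat z.1)) :=
    Measure.quasiMeasurePreserving_fst.ae (μa := (volume : Measure (ℝ × ℝ))) hlim'
  have zm : ∀ (κ : Kernel ℝ (ℝ × ℝ)) (chat : ℝ → ℝ → Fin d → ℝ), (∀ t, κ t univ ≤ 1) →
      ContinuousOn (fun p : ℝ × ℝ => chat p.1 p.2) (Icc 0 T ×ˢ Icc c1 c2) →
      Measurable (zv T c1 c2 κ chat) := by
    intro κ chat hk h
    exact measurable_pi_iff.2 fun i => KI_meas hT hc hk ((continuous_apply i).comp_continuousOn h)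
  obtain ⟨M, ν, hMf, hνm, hνA, hMQ, hmar, hD⟩ := disint (T := T) hAm ha0 m1 m2
  have hDm : Dis T m M ν := by
    intro f hf hC
    rw [← hD f hf hC]
    refine integral_congr_ae ?_
    filter_upwards [m3] with t ht
    rw [ht]
  obtain ⟨hm0p, hm0s, -⟩ := hm0
  set N := m0.map (Prod.mk (0:ℝ)) with hN
  have hem : MeasurableEmbedding (Prod.mk (0:ℝ) : ℝ → ℝ × ℝ) := measurableEmbedding_prodMk_left _
  haveI : IsProbabilityMeasure N := Measure.isProbabilityMeasure_map hem.measurable.aemeasurable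
  have hNi : ∀ u : ℝ → ℝ → ℝ, ∫ z, u z.1 z.2 ∂N = ∫ x, u 0 x ∂m0 := fun u => by
    rw [hN, hem.integral_map]
  have hNQ : N (Icc 0 T ×ˢ Icc c1 c2)ᶜ = 0 := by
    rw [hN, hem.map_apply]
    refine measure_mono_null ?_ hm0s
    intro x hx hx'
    exact hx ⟨⟨le_rfl, hT.le⟩, Ioo_subset_Icc_self hx'⟩
  have hN0 : ∀ᵐ z ∂N, z.1 = 0 := by
    rw [hN, hem.ae_map_iff]
    exact Eventually.of_forall fun x => rfl
  have hμp := hRm.1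
  have hμQ := hRm.2.1
  rw [hcl] at hμQ
  have hcs : cσ ≤ Cs := (hσc 0 0 0 0).trans ((le_abs_self _).trans (hsC _ _ _ _))
  have h0c : cσ ^ 2 / 2 ≤ Cs ^ 2 / 2 := by gcongr
  have hFP : FPM T c1 c2 N μ M (aL (cσ ^ 2 / 2) σbar (zv T c1 c2 κ σhat) a0) (bL bbar (zv T c1 c2 κ bhat) ν) := by
    intro u ut ux uxx hu
    rw [hRm.2.2.2 u ut ux uxx hu, hNi, fp_rw hT hc Hb Hσ hσa hcσ hσc a0 hRm.2.2.1 hMQ hDm h1 h2 h3 hu]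
  obtain ⟨pk, μk, hk, hW, hG⟩ := stable hT hc (c0 := cσ ^ 2 / 2) (C := Cs ^ 2 / 2) (B := Cb) (by positivity) hNQ hN0 hμQ hMQ hmar
    (a := aL (cσ ^ 2 / 2) σbar (zv T c1 c2 κ σhat) a0) (b := bL bbar (zv T c1 c2 κ bhat) ν)
    (ak := fun k => aL (cσ ^ 2 / 2) σbar (zv T c1 c2 (κn (φ k)) σhat) a0)
    (bk := fun k => bL bbar (zv T c1 c2 (κn (φ k)) bhat) ν)
    (aL_meas hs4 (zm _ _ h1 hs6)) (bL_meas hb4 (zm _ _ h1 hb6))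
    (fun k => aL_meas hs4 (zm _ _ (h1n _) hs6)) (fun k => bL_meas hb4 (zm _ _ (h1n _) hb6))
    (fun z => le_max_left _ _) (aL_bd hs3 h0c _ _) (bL_bd hb3 _ _)
    (fun k z => le_max_left _ _) (fun k => aL_bd hs3 h0c _ _) (fun k => bL_bd hb3 _ _)
    (by
      filter_upwards [hlimz] with z hz hzQ
      have h := (hz hzQ.1).2
      have hcz : Continuous fun v : Fin d → ℝ => σbar z.1 z.2 v a0 :=
        (hs5 z.1).comp_continuous (f := fun v : Fin d → ℝ => (z.2, v, a0)) (by fun_prop)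
          fun v => ⟨mem_univ _, mem_univ _, ha0⟩
      exact tendsto_const_nhds.max ((((hcz.tendsto _).comp h).pow 2).div_const 2))
    (by
      filter_upwards [hlimz] with z hz hzQ
      have h := (hz hzQ.1).1
      refine tendsto_integral_of_dominated_convergence (fun _ => Cb) (fun k => ?_) (integrable_const _)
        (fun k => Eventually.of_forall fun a => hb3 _ _ _ _) ?_
      · exact ((bL_meas1 hb4 (zm _ _ (h1n (φ k)) hb6)).comp (f := fun a : ℝ => (z.1, (z.2, a))) (by fun_prop)).aestronglyMeasurable
      · filter_upwards [measure_eq_zero_iff_ae_notMem.1 (hνA z)] with a ha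
        have ha := notMem_compl_iff.1 ha
        have hcz : Continuous fun v : Fin d → ℝ => bbar z.1 z.2 v a :=
          (hb5 z.1).comp_continuous (f := fun v : Fin d → ℝ => (z.2, v, a)) (by fun_prop)
            fun v => ⟨mem_univ _, mem_univ _, ha⟩
        exact (hcz.tendsto _).comp h)
    hFP
  choose k1 k2 k3 k4 k5 k6 k7 using hk
  choose mk hmkV hmkD using fun k => rebuild hc hAm hνA (k1 k) (k2 k) (k3 k) (k4 k)
  refine ⟨φ, hφ, μk, mk, fun k => ⟨k5 k, by rw [hcl]; exact k6 k, hmkV k, ?_⟩, hW, ?_⟩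
  · intro u ut ux uxx hu
    rw [k7 k u ut ux uxx hu, hNi, fp_rw hT hc Hb Hσ hσa hcσ hσc a0 (hmkV k) (wd_null (k4 k)) (hmkD k)
      (h1n (φ k)) (h2n (φ k)) (h3n (φ k)) hu]
  · rintro h hh ⟨C, hC⟩
    have hfm : Measurable fun q : ℝ × (ℝ × ℝ) => h q.1 q.2 := hh.measurable
    have hfb : ∃ C, ∀ q : ℝ × (ℝ × ℝ), |h q.1 q.2| ≤ C := ⟨C, fun q => hC _ _⟩
    have e0 := hDm _ hfm hfb
    have ek := fun k => hmkD k _ hfm hfb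
    simp only at e0 ek
    rw [e0]
    simp only [ek]
    refine hG _ ?_ ⟨C, fun z => ?_⟩
    · have hg : StronglyMeasurable fun q : (ℝ × ℝ) × ℝ => h q.1.1 (q.1.2, q.2) :=
        (hfm.comp (f := fun q : (ℝ × ℝ) × ℝ => (q.1.1, (q.1.2, q.2))) (by fun_prop)).stronglyMeasurable
      exact (hg.integral_kernel_prod_right' (κ := ν)).measurable
    · rw [← Real.norm_eq_abs]
      refine (norm_integral_le_of_norm_le (integrable_const C) (Eventually.of_forall fun a => hC _ _)).trans ?_
      simp

end

/-- Lower hemicontinuity of the constraint correspondence: under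
the additional assumption that either the coefficients are measure-independent or
`O` is an open interval with uncontrolled uniformly elliptic `σ`, if
`(μ̄ⁿ, m̄ⁿ) ⊆ R₀` converges to `(μ̄, m̄) ∈ R₀` and `(μ, m) ∈ R[m̄]`, then along a
subsequence there exist `(μᵏ, mᵏ) ∈ R[m̄^{n_k}]` with `μᵏ ⇀ μ` and `mᵏ → m` in `V`. -/
theorem constraint_correspondence_lower_hemicontinuous
    (T : ℝ) (hT : 0 < T) (O A : Set ℝ) (hO : IsOpen O) (hA : IsCompact A)
    (d : ℕ) (hd : 0 < d)
    (b σ : ℝ → ℝ → Measure (ℝ × ℝ) → ℝ → ℝ)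
    (bbar σbar : ℝ → ℝ → (Fin d → ℝ) → ℝ → ℝ) (bhat σhat : ℝ → ℝ → Fin d → ℝ)
    (hb : MFCoeff T O A d b bbar bhat) (hσ : MFCoeff T O A d σ σbar σhat)
    (hσpos : ∀ t x ν a, 0 ≤ σ t x ν a)
    (halt : MeasIndepOrInterval O b σ)
    (m0 : Measure ℝ) (hm0 : InitAssumption2 O m0)
    (μbarn : ℕ → Measure (ℝ × ℝ)) (mbarn : ℕ → ℝ → Measure (ℝ × ℝ))
    (hR0 : ∀ n, MemR0 T O A b σ m0 (μbarn n) (mbarn n))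
    (μbar : Measure (ℝ × ℝ)) (mbar : ℝ → Measure (ℝ × ℝ))
    (hR0lim : MemR0 T O A b σ m0 μbar mbar)
    (hμbarconv : WeakConv μbarn μbar) (hmbarconv : ConvV T mbarn mbar)
    (μ : Measure (ℝ × ℝ)) (m : ℝ → Measure (ℝ × ℝ))
    (hRm : MemRm T O A b σ m0 mbar μ m) :
    ∃ φ : ℕ → ℕ, StrictMono φ ∧
      ∃ (μk : ℕ → Measure (ℝ × ℝ)) (mk : ℕ → ℝ → Measure (ℝ × ℝ)),
        (∀ k, MemRm T O A b σ m0 (mbarn (φ k)) (μk k) (mk k)) ∧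
        WeakConv μk μ ∧ ConvV T mk m := by
  have conv_const : WeakConv (fun _ => μ) μ ∧ ConvV T (fun _ => m) m :=
    ⟨fun _ _ _ => tendsto_const_nhds, fun _ _ _ => tendsto_const_nhds⟩
  rcases halt with hind | ⟨⟨c1, c2, hc, rfl⟩, hσa, cσ, hcσ, hσc⟩
  · refine ⟨id, strictMono_id, fun _ => μ, fun _ => m, fun k => ⟨hRm.1, hRm.2.1, hRm.2.2.1, ?_⟩, conv_const⟩
    intro u ut ux uxx hu
    rw [hRm.2.2.2 u ut ux uxx hu]
    congr 1
    refine integral_congr_ae (Eventually.of_forall fun t => ?_)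
    refine integral_congr_ae (Eventually.of_forall fun p => ?_)
    have h := hind t p.1 (mbar t) (mbarn (id k) t) p.2
    simp only [h.1, h.2]
  · rcases A.eq_empty_or_nonempty with hAe | ⟨a0, ha0⟩
    · have hz : ∀ t, m t = 0 := by
        intro t
        have := hRm.2.2.1.2.1 t
        rw [hAe] at this
        simpa using this
      refine ⟨id, strictMono_id, fun _ => μ, fun _ => m, fun k => ⟨hRm.1, hRm.2.1, hRm.2.2.1, ?_⟩, conv_const⟩
      intro u ut ux uxx hu
      rw [hRm.2.2.2 u ut ux uxx hu]
      simp [hz]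
    · exact case_c hT hc hA hb hσ hσa hcσ hσc hm0 hR0 hR0lim hmbarconv hRm ha0
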